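/- Let d ≥ 1, m ∈ ℝ, 0 < q < ∞, and s > τ_q := d/min(1,q) − d. Let a ∈ S^m_{1,1}. Then there is a constant C such that for every tempered distribution f with ‖f‖_{F_∞^{s+m,q}} < ∞, the limit T_a f := lim_{N→∞} Σ_{j=0}^{N} Σ_{k=0}^{N} T_{a_{j,k}} f exists in S′(ℝ^d) and ‖T_a f‖_{F_∞^{s,q}} ≤ C ‖f‖_{F_∞^{s+m,q}}; that is, T_a is bounded from F_∞^{s+m,q} to F_∞^{s,q}. -/

import Mathlib

noncomputable section

open MeasureTheory SchwartzMap Complex RealInnerProductSpace Filter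
open scoped ENNReal NNReal ContDiff SchwartzMap

/-- Euclidean space `ℝ^d`. -/
abbrev RD (d : ℕ) : Type := EuclideanSpace ℝ (Fin d)

/-- Tempered distributions on `ℝ^d`. -/
abbrev TD (d : ℕ) : Type := 𝓢(RD d, ℂ) →L[ℂ] ℂ

/-- Fourier transform of a Schwartz function (with the convention
`f̂(ξ) = ∫ f(x) e^{-2πi⟨x,ξ⟩} dx`). -/
def fourierS {d : ℕ} (f : 𝓢(RD d, ℂ)) : 𝓢(RD d, ℂ) :=
  SchwartzMap.fourierTransformCLM ℂ f

/-- Hörmander symbol class `S^m_{1,1}`: `a` is smooth and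
`‖∂_ξ^α ∂_x^β a(x,ξ)‖ ≤ c_{α,β} (1+‖ξ‖)^{m-|α|+|β|}` for all orders of derivatives. -/
def IsSymbolS11 (d : ℕ) (m : ℝ) (a : RD d → RD d → ℂ) : Prop :=
  ContDiff ℝ ∞ (fun p : RD d × RD d => a p.1 p.2) ∧
  ∀ α β : ℕ, ∃ c : ℝ, ∀ x ξ : RD d,
    ‖iteratedFDeriv ℝ α (fun ξ' => iteratedFDeriv ℝ β (fun x' => a x' ξ') x) ξ‖
      ≤ c * (1 + ‖ξ‖) ^ (m - (α : ℝ) + (β : ℝ))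

/-- The pseudo-differential operator `T_a f(x) = ∫ a(x,ξ) f̂(ξ) e^{2πi⟨x,ξ⟩} dξ`
acting on a Schwartz function `f`. -/
def pdo {d : ℕ} (a : RD d → RD d → ℂ) (f : 𝓢(RD d, ℂ)) (x : RD d) : ℂ :=
  ∫ ξ, a x ξ * fourierS f ξ * Complex.exp (2 * Real.pi * Complex.I * ((⟪x, ξ⟫ : ℝ) : ℂ))

/-- Littlewood–Paley data: a Schwartz function `φ` with `φ̂` supported in
`{1/2 ≤ |ξ| ≤ 2}` and `Σ_{k∈ℤ} φ̂(2^{-k}ξ) = 1` for `ξ ≠ 0`, together with the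
low-frequency piece `Φ` determined by `Φ̂ = 1 - Σ_{k≥1} φ̂(2^{-k}·)`. -/
structure LPData (d : ℕ) where
  φ : 𝓢(RD d, ℂ)
  Φ : 𝓢(RD d, ℂ)
  supp_φ : ∀ ξ : RD d, fourierS φ ξ ≠ 0 → 1/2 ≤ ‖ξ‖ ∧ ‖ξ‖ ≤ 2
  sum_φ : ∀ ξ : RD d, ξ ≠ 0 → HasSum (fun k : ℤ => fourierS φ ((2:ℝ)^(-k) • ξ)) 1
  Φ_def : ∀ ξ : RD d, fourierS Φ ξ = 1 - ∑' k : ℕ, fourierS φ (((2:ℝ)^(k+1))⁻¹ • ξ)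

/-- The Littlewood–Paley convolution kernel: `Φ` for `k = 0` and
`φ_k = 2^{kd} φ(2^k ·)` for `k ≥ 1`. -/
def LPkernel {d : ℕ} (D : LPData d) : ℕ → RD d → ℂ
  | 0, x => D.Φ x
  | (k+1), x => (((2:ℝ)^((k+1) * d) : ℝ) : ℂ) * D.φ ((2:ℝ)^(k+1) • x)

/-- The Fourier transform of the `k`-th Littlewood–Paley kernel, i.e. `φ̂_k = φ̂(2^{-k}·)`
for `k ≥ 1` and `Φ̂` for `k = 0`. -/
def LPhat {d : ℕ} (D : LPData d) : ℕ → RD d → ℂ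
  | 0, ξ => fourierS D.Φ ξ
  | (k+1), ξ => fourierS D.φ (((2:ℝ)^(k+1))⁻¹ • ξ)

/-- Littlewood–Paley operator `Π_k g = φ_k ∗ g` (with `φ_0 := Φ`) acting on functions. -/
def LP {d : ℕ} (D : LPData d) (k : ℕ) (g : RD d → ℂ) (x : RD d) : ℂ :=
  ∫ y, LPkernel D k y * g (x - y)

/-- `Π*_k = Π_{k-1} + Π_k + Π_{k+1}` (with the convention `φ_{-1} := 0`). -/
def LPstar {d : ℕ} (D : LPData d) (k : ℕ) (g : RD d → ℂ) (x : RD d) : ℂ :=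
  (if k = 0 then 0 else LP D (k-1) g x) + LP D k g x + LP D (k+1) g x

open Classical in
/-- Pairing of a tempered distribution with a plain function: it gives `u ψ` if the
function is (the coercion of) a Schwartz function `ψ`, and `0` otherwise. -/
def pairing {d : ℕ} (u : TD d) (g : RD d → ℂ) : ℂ :=
  if h : ∃ ψ : 𝓢(RD d, ℂ), ⇑ψ = g then u h.choose else 0

/-- Fourier transform of a tempered distribution, `⟨û, ψ⟩ = ⟨u, ψ̂⟩`. -/
def fourierTD {d : ℕ} (u : TD d) : TD d :=
  u.comp (SchwartzMap.fourierTransformCLM ℂ)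

/-- Littlewood–Paley operator on tempered distributions:
`Π_k u (x) = ⟨u, φ_k(x - ·)⟩`. -/
def LPdist {d : ℕ} (D : LPData d) (k : ℕ) (u : TD d) (x : RD d) : ℂ :=
  pairing u (fun y => LPkernel D k (x - y))

/-- The symbol `a_{j,k}(x,ξ) = (φ_j ∗ a(·,ξ))(x) · φ̂_k(ξ)` (with `Φ` replacing `φ_0`). -/
def symbolPiece {d : ℕ} (D : LPData d) (a : RD d → RD d → ℂ) (j k : ℕ)
    (x ξ : RD d) : ℂ :=
  (∫ y, LPkernel D j y * a (x - y) ξ) * LPhat D k ξ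

/-- `T_{a_{j,k}} u (x) = ⟨û, a_{j,k}(x,·) e^{2πi⟨x,·⟩}⟩` for a tempered distribution `u`. -/
def pdoPieceD {d : ℕ} (D : LPData d) (a : RD d → RD d → ℂ) (j k : ℕ)
    (u : TD d) (x : RD d) : ℂ :=
  pairing (fourierTD u)
    (fun ξ => symbolPiece D a j k x ξ * Complex.exp (2 * Real.pi * Complex.I * ((⟪x, ξ⟫ : ℝ) : ℂ)))

/-- Partial sums `Σ_{j=0}^N Σ_{k=0}^N T_{a_{j,k}} u (x)`. -/
def pdoPartial {d : ℕ} (D : LPData d) (a : RD d → RD d → ℂ) (N : ℕ)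
    (u : TD d) (x : RD d) : ℂ :=
  ∑ j ∈ Finset.range (N+1), ∑ k ∈ Finset.range (N+1), pdoPieceD D a j k u x

/-- `T_a u` converges in `S'` to the tempered distribution `Tf`: the partial sums
`Σ_{j,k≤N} T_{a_{j,k}} u` (which are functions) converge to `Tf` weakly. -/
def ConvergesInSPrime {d : ℕ} (D : LPData d) (a : RD d → RD d → ℂ)
    (u : TD d) (Tf : TD d) : Prop :=
  ∀ ψ : 𝓢(RD d, ℂ),
    Tendsto (fun N => ∫ x, pdoPartial D a N u x * ψ x) atTop (nhds (Tf ψ))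

/-- The dyadic cube of level `ν` (side length `2^{-ν}`) indexed by `n ∈ ℤ^d`. -/
def dyadicCube (d : ℕ) (ν : ℤ) (n : Fin d → ℤ) : Set (RD d) :=
  {x | ∀ i, (n i : ℝ) * (2:ℝ)^(-ν) ≤ x i ∧ x i < ((n i : ℝ) + 1) * (2:ℝ)^(-ν)}

/-- The local quantity `(|P|⁻¹ ∫_P Σ_{k=k₀}^∞ 2^{skq} ‖g_k(x)‖^q dx)^{1/q}` for the
dyadic cube `P` of level `μ` indexed by `n` (so that `|P|⁻¹ = 2^{μd}`). -/
def cubePiece (d : ℕ) (μ : ℕ) (n : Fin d → ℤ) (k₀ : ℕ) (s q : ℝ)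
    (g : ℕ → RD d → ℂ) : ℝ≥0∞ :=
  ((2:ℝ≥0∞)^((μ:ℝ)*(d:ℝ)) *
    ∫⁻ x in dyadicCube d μ n,
      ∑' j : ℕ, (2:ℝ≥0∞)^(s*((k₀:ℝ)+(j:ℝ))*q) * (‖g (k₀+j) x‖₊ : ℝ≥0∞)^q) ^ (1/q)

/-- The `F_∞^{s,q}` norm (for `q < ∞`) of a function, computed from its
Littlewood–Paley pieces:
`‖Π_0 g‖_∞ + sup_{l(P)<1 dyadic} (|P|⁻¹ ∫_P Σ_{k=-log₂ l(P)}^∞ 2^{skq}|Π_k g|^q)^{1/q}`. -/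
def FinftyNormFun {d : ℕ} (D : LPData d) (s q : ℝ) (g : RD d → ℂ) : ℝ≥0∞ :=
  (⨆ x : RD d, (‖LP D 0 g x‖₊ : ℝ≥0∞)) +
  ⨆ (μ : ℕ) (_ : 1 ≤ μ) (n : Fin d → ℤ),
    cubePiece d μ n μ s q (fun k x => LP D k g x)

/-- The `F_∞^{s,q}` norm (for `q < ∞`) of a tempered distribution. -/
def FinftyNormDist {d : ℕ} (D : LPData d) (s q : ℝ) (u : TD d) : ℝ≥0∞ :=
  (⨆ x : RD d, (‖LPdist D 0 u x‖₊ : ℝ≥0∞)) +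
  ⨆ (μ : ℕ) (_ : 1 ≤ μ) (n : Fin d → ℤ),
    cubePiece d μ n μ s q (fun k x => LPdist D k u x)

/-- The (axis-parallel, closed) cube with corner `c` and side length `L`. -/
def cube (d : ℕ) (c : RD d) (L : ℝ) : Set (RD d) :=
  {x | ∀ i, c i ≤ x i ∧ x i ≤ c i + L}

/-- The average of `g` over the cube with corner `c` and side length `L`. -/
def cubeMean {d : ℕ} (c : RD d) (L : ℝ) (g : RD d → ℂ) : ℂ :=
  (L^d)⁻¹ • ∫ x in cube d c L, g x

/-- The `bmo` norm (local BMO):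
`sup_{l(Q)≥1} |Q|⁻¹∫_Q |g| + sup_{l(Q)<1} |Q|⁻¹∫_Q |g - g_Q|`, over all cubes `Q`. -/
def bmoNorm (d : ℕ) (g : RD d → ℂ) : ℝ≥0∞ :=
  (⨆ (c : RD d) (L : ℝ) (_ : 1 ≤ L),
    ENNReal.ofReal ((L^d)⁻¹) * ∫⁻ x in cube d c L, (‖g x‖₊ : ℝ≥0∞)) +
  (⨆ (c : RD d) (L : ℝ) (_ : 0 < L) (_ : L < 1),
    ENNReal.ofReal ((L^d)⁻¹) * ∫⁻ x in cube d c L, (‖g x - cubeMean c L g‖₊ : ℝ≥0∞))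

/-- The Peetre maximal function `𝔐_{σ,R} g(x) = sup_y ‖g(x-y)‖/(1+R‖y‖)^σ`. -/
def peetre {d : ℕ} (σ R : ℝ) (g : RD d → ℂ) (x : RD d) : ℝ≥0∞ :=
  ⨆ y : RD d, (‖g (x - y)‖₊ : ℝ≥0∞) / ENNReal.ofReal ((1 + R * ‖y‖) ^ σ)

/-- `g` has (distributional) Fourier support contained in `K`: the pairing
`⟨ĝ, ψ⟩ = ∫ g · ψ̂` vanishes for every Schwartz `ψ` whose support does not meet `K`. -/
def HasFourierSupportIn {d : ℕ} (g : RD d → ℂ) (K : Set (RD d)) : Prop :=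
  ∀ ψ : 𝓢(RD d, ℂ), tsupport ⇑ψ ∩ K = ∅ → ∫ x, g x * fourierS ψ x = 0

/-! ### Polynomial weights and the kernels `η_{k,L}` -/

/-- The weight `1 + 2^k ‖x‖`. -/
def scaleWeight {d : ℕ} (k : ℕ) (x : RD d) : ℝ≥0∞ := ENNReal.ofReal (1 + 2 ^ k * ‖x‖)

/-- The `L¹`-normalised kernel `2^{kd} (1 + 2^k ‖x‖)^{-L}`. -/
def etaKernel {d : ℕ} (k : ℕ) (L : ℝ) (x : RD d) : ℝ≥0∞ :=
  2 ^ (k * d) * scaleWeight k x ^ (-L)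

/-- Convolution of nonnegative functions. -/
def lconvol {d : ℕ} (w f : RD d → ℝ≥0∞) (x : RD d) : ℝ≥0∞ := ∫⁻ y, w (x - y) * f y

section Weights

variable {d : ℕ}

lemma scaleWeight_ne_top (k : ℕ) (x : RD d) : scaleWeight k x ≠ ⊤ := ENNReal.ofReal_ne_top

lemma one_le_scaleWeight (k : ℕ) (x : RD d) : 1 ≤ scaleWeight k x := by
  unfold scaleWeight
  rw [ENNReal.one_le_ofReal]
  have : 0 ≤ (2:ℝ) ^ k * ‖x‖ := by positivity
  linarith

lemma scaleWeight_ne_zero (k : ℕ) (x : RD d) : scaleWeight k x ≠ 0 :=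
  (zero_lt_one.trans_le (one_le_scaleWeight k x)).ne'

lemma scaleWeight_neg (k : ℕ) (x : RD d) : scaleWeight k (-x) = scaleWeight k x := by
  simp [scaleWeight]

lemma scaleWeight_sub_comm (k : ℕ) (x y : RD d) : scaleWeight k (x - y) = scaleWeight k (y - x) := by
  rw [← scaleWeight_neg, neg_sub]

lemma scaleWeight_add_le (k : ℕ) (x y : RD d) :
    scaleWeight k (x + y) ≤ scaleWeight k x * scaleWeight k y := by
  unfold scaleWeight
  rw [← ENNReal.ofReal_mul (by positivity)]
  apply ENNReal.ofReal_le_ofReal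
  have h := norm_add_le x y
  have h1 : (0:ℝ) < 2 ^ k := by positivity
  have h2 : (2:ℝ) ^ k * ‖x + y‖ ≤ 2 ^ k * (‖x‖ + ‖y‖) := by gcongr
  nlinarith [mul_nonneg (mul_nonneg h1.le (norm_nonneg x)) (mul_nonneg h1.le (norm_nonneg y))]

lemma scaleWeight_mono {k l : ℕ} (h : k ≤ l) (x : RD d) : scaleWeight k x ≤ scaleWeight l x := by
  unfold scaleWeight
  gcongr
  norm_num

lemma continuous_scaleWeight (k : ℕ) : Continuous (scaleWeight k : RD d → ℝ≥0∞) := by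
  unfold scaleWeight
  exact ENNReal.continuous_ofReal.comp (by fun_prop)

@[fun_prop]
lemma measurable_scaleWeight (k : ℕ) : Measurable (scaleWeight k : RD d → ℝ≥0∞) :=
  (continuous_scaleWeight k).measurable

@[fun_prop]
lemma measurable_etaKernel (k : ℕ) (L : ℝ) : Measurable (etaKernel k L : RD d → ℝ≥0∞) := by
  unfold etaKernel
  fun_prop

lemma scaleWeight_rpow_mul_rpow (k : ℕ) (x : RD d) (r t : ℝ) :
    scaleWeight k x ^ r * scaleWeight k x ^ t = scaleWeight k x ^ (r + t) :=
  (ENNReal.rpow_add r t (scaleWeight_ne_zero k x) (scaleWeight_ne_top k x)).symm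

lemma scaleWeight_rpow_ne_top (k : ℕ) (x : RD d) (r : ℝ) : scaleWeight k x ^ r ≠ ⊤ :=
  ENNReal.rpow_ne_top_of_ne_zero (scaleWeight_ne_zero k x) (scaleWeight_ne_top k x)

lemma scaleWeight_rpow_ne_zero (k : ℕ) (x : RD d) (r : ℝ) : scaleWeight k x ^ r ≠ 0 := by
  simp [ENNReal.rpow_eq_zero_iff, scaleWeight_ne_zero, scaleWeight_ne_top]

lemma scaleWeight_rpow_neg_mul (k : ℕ) (x : RD d) (r : ℝ) :
    scaleWeight k x ^ (-r) * scaleWeight k x ^ r = 1 := by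
  rw [scaleWeight_rpow_mul_rpow, neg_add_cancel, ENNReal.rpow_zero]

lemma one_le_scaleWeight_rpow (k : ℕ) (x : RD d) {r : ℝ} (hr : 0 ≤ r) :
    1 ≤ scaleWeight k x ^ r := by
  simpa using ENNReal.rpow_le_rpow (one_le_scaleWeight k x) hr

lemma etaKernel_mul_scaleWeight_rpow (k : ℕ) (L r : ℝ) (x : RD d) :
    etaKernel k L x * scaleWeight k x ^ r = etaKernel k (L - r) x := by
  unfold etaKernel
  rw [mul_assoc, scaleWeight_rpow_mul_rpow]
  congr 2
  ring

lemma etaKernel_anti (k : ℕ) {L L' : ℝ} (h : L ≤ L') (x : RD d) :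
    etaKernel k L' x ≤ etaKernel k L x := by
  unfold etaKernel
  gcongr
  · exact one_le_scaleWeight k x

lemma etaKernel_neg (k : ℕ) (L : ℝ) (x : RD d) : etaKernel k L (-x) = etaKernel k L x := by
  simp [etaKernel, scaleWeight_neg]

lemma etaKernel_sub_comm (k : ℕ) (L : ℝ) (x y : RD d) :
    etaKernel k L (x - y) = etaKernel k L (y - x) := by
  rw [← etaKernel_neg, neg_sub]

lemma etaKernel_ne_top (k : ℕ) (L : ℝ) (x : RD d) : etaKernel k L x ≠ ⊤ :=
  ENNReal.mul_ne_top (by simp) (scaleWeight_rpow_ne_top k x _)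

lemma etaKernel_ne_zero (k : ℕ) (L : ℝ) (x : RD d) : etaKernel k L x ≠ 0 :=
  mul_ne_zero (by simp) (scaleWeight_rpow_ne_zero k x _)

/-- Weights to a negative power are slowly varying. -/
lemma scaleWeight_rpow_neg_le (k : ℕ) {L : ℝ} (hL : 0 ≤ L) (x y : RD d) :
    scaleWeight k x ^ (-L) ≤ scaleWeight k (x - y) ^ L * scaleWeight k y ^ (-L) := by
  have h : scaleWeight k y ^ L ≤ scaleWeight k (x - y) ^ L * scaleWeight k x ^ L := by
    rw [← ENNReal.mul_rpow_of_nonneg _ _ hL]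
    gcongr
    have := scaleWeight_add_le k (y - x) x
    rwa [sub_add_cancel, scaleWeight_sub_comm] at this
  calc scaleWeight k x ^ (-L) = scaleWeight k x ^ (-L) * (scaleWeight k y ^ (-L) * scaleWeight k y ^ L) := by
        rw [scaleWeight_rpow_neg_mul, mul_one]
    _ ≤ scaleWeight k x ^ (-L) * (scaleWeight k y ^ (-L) *
          (scaleWeight k (x - y) ^ L * scaleWeight k x ^ L)) := by gcongr
    _ = (scaleWeight k x ^ (-L) * scaleWeight k x ^ L) *
          (scaleWeight k (x - y) ^ L * scaleWeight k y ^ (-L)) := by ring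
    _ = _ := by rw [scaleWeight_rpow_neg_mul, one_mul]

lemma etaKernel_le (k : ℕ) {L : ℝ} (hL : 0 ≤ L) (x y : RD d) :
    etaKernel k L x ≤ scaleWeight k (x - y) ^ L * etaKernel k L y := by
  unfold etaKernel
  rw [mul_left_comm]
  gcongr
  exact scaleWeight_rpow_neg_le k hL x y

lemma lconvol_etaKernel_le (k : ℕ) {L : ℝ} (hL : 0 ≤ L) (f : RD d → ℝ≥0∞) (x y : RD d) :
    lconvol (etaKernel k L) f x ≤ scaleWeight k (x - y) ^ L * lconvol (etaKernel k L) f y := by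
  unfold lconvol
  rw [← lintegral_const_mul' _ _ (scaleWeight_rpow_ne_top k _ _)]
  refine lintegral_mono fun z => ?_
  rw [← mul_assoc]
  gcongr
  have := etaKernel_le k hL (x - z) (y - z)
  rwa [sub_sub_sub_cancel_right] at this

lemma lconvol_mono {w w' f f' : RD d → ℝ≥0∞} (hw : ∀ x, w x ≤ w' x) (hf : ∀ x, f x ≤ f' x)
    (x : RD d) : lconvol w f x ≤ lconvol w' f' x := by
  unfold lconvol
  gcongr with y
  · exact hw _
  · exact hf _

lemma measurable_lconvol {w f : RD d → ℝ≥0∞} (hw : Measurable w) (hf : Measurable f) :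
    Measurable (lconvol w f) := by
  unfold lconvol
  exact Measurable.lintegral_prod_right' (f := fun p : RD d × RD d => w (p.1 - p.2) * f p.2)
    (by fun_prop)

/-- The mass of `η_{0,L}`. -/
def etaMass (d : ℕ) (L : ℝ) : ℝ≥0∞ := ∫⁻ x : RD d, etaKernel 0 L x

lemma etaMass_ne_top {L : ℝ} (hL : (d : ℝ) < L) : etaMass d L ≠ ⊤ := by
  have h := integrable_one_add_norm (E := RD d) (μ := volume) (r := L) (by simpa using hL)
  have h2 := h.lintegral_lt_top
  unfold etaMass
  refine ne_of_lt (lt_of_eq_of_lt (lintegral_congr fun x => ?_) h2)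
  simp only [etaKernel, scaleWeight, zero_mul, pow_zero, one_mul]
  rw [ENNReal.ofReal_rpow_of_pos (by positivity)]

lemma lintegral_etaKernel (k : ℕ) (L : ℝ) : ∫⁻ x : RD d, etaKernel k L x = etaMass d L := by
  have h : ∫⁻ x : RD d, etaKernel 0 L ((2:ℝ) ^ k • x) =
      ENNReal.ofReal |(((2:ℝ) ^ k) ^ d)⁻¹| • ∫⁻ x : RD d, etaKernel 0 L x := by
    have h := Measure.map_addHaar_smul (volume : Measure (RD d)) (r := (2:ℝ) ^ k) (by positivity)
    rw [← lintegral_map (f := fun x : RD d => etaKernel 0 L x) (by fun_prop)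
      (measurable_const_smul _), h, lintegral_smul_measure]
    simp
  have h2 : ∀ x : RD d, etaKernel k L x = 2 ^ (k * d) * etaKernel 0 L ((2:ℝ) ^ k • x) := by
    intro x
    simp [etaKernel, scaleWeight, norm_smul]
  simp_rw [h2]
  rw [lintegral_const_mul' _ _ (by simp), h, etaMass]
  rw [smul_eq_mul, ← mul_assoc]
  have : (2:ℝ≥0∞) ^ (k * d) * ENNReal.ofReal |(((2:ℝ) ^ k) ^ d)⁻¹| = 1 := by
    rw [abs_of_nonneg (by positivity), ← pow_mul, ENNReal.ofReal_inv_of_pos (by positivity),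
      ENNReal.ofReal_pow (by norm_num)]
    simp only [ENNReal.ofReal_ofNat]
    exact ENNReal.mul_inv_cancel (by simp) (by simp)
  rw [this, one_mul]

lemma lintegral_etaKernel_sub (k : ℕ) (L : ℝ) (x : RD d) :
    ∫⁻ y : RD d, etaKernel k L (x - y) = etaMass d L := by
  rw [lintegral_sub_left_eq_self (fun y => etaKernel k L y) x, lintegral_etaKernel]

lemma lintegral_etaKernel_sub' (k : ℕ) (L : ℝ) (x : RD d) :
    ∫⁻ y : RD d, etaKernel k L (y - x) = etaMass d L := by
  simp_rw [etaKernel_sub_comm k L _ x]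
  exact lintegral_etaKernel_sub k L x

/-- Associativity of convolution with `η`, coarser scale on the left. -/
lemma lconvol_lconvol_etaKernel_le {k l : ℕ} (h : l ≤ k) {M M' : ℝ} (hM' : 0 ≤ M')
    {f : RD d → ℝ≥0∞} (hf : Measurable f) (x : RD d) :
    lconvol (etaKernel l M') (lconvol (etaKernel k M) f) x ≤
      etaMass d (M - M') * lconvol (etaKernel l M') f x := by
  have hpt : ∀ y z : RD d, etaKernel l M' (x - z) * etaKernel k M (z - y) ≤
      etaKernel l M' (x - y) * etaKernel k (M - M') (z - y) := by
    intro y z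
    have h1 : etaKernel l M' (x - z) ≤ scaleWeight k (z - y) ^ M' * etaKernel l M' (x - y) := by
      refine (etaKernel_le l hM' (x - z) (x - y)).trans ?_
      rw [sub_sub_sub_cancel_left]
      gcongr
      rw [scaleWeight_sub_comm]
      exact scaleWeight_mono h _
    calc _ ≤ scaleWeight k (z - y) ^ M' * etaKernel l M' (x - y) * etaKernel k M (z - y) := by gcongr
      _ = etaKernel l M' (x - y) * (etaKernel k M (z - y) * scaleWeight k (z - y) ^ M') := by ring
      _ = _ := by rw [etaKernel_mul_scaleWeight_rpow]
  calc lconvol (etaKernel l M') (lconvol (etaKernel k M) f) x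
      = ∫⁻ z, ∫⁻ y, etaKernel l M' (x - z) * (etaKernel k M (z - y) * f y) := by
        unfold lconvol
        refine lintegral_congr fun z => ?_
        rw [lintegral_const_mul' _ _ (etaKernel_ne_top _ _ _)]
    _ = ∫⁻ y, ∫⁻ z, etaKernel l M' (x - z) * (etaKernel k M (z - y) * f y) := by
        rw [lintegral_lintegral_swap]
        fun_prop
    _ ≤ ∫⁻ y, ∫⁻ z, etaKernel k (M - M') (z - y) * (etaKernel l M' (x - y) * f y) := by
        refine lintegral_mono fun y => lintegral_mono fun z => ?_
        calc _ = etaKernel l M' (x - z) * etaKernel k M (z - y) * f y := by ring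
          _ ≤ etaKernel l M' (x - y) * etaKernel k (M - M') (z - y) * f y :=
            mul_le_mul_left (hpt y z) _
          _ = _ := by ring
    _ = ∫⁻ y, etaMass d (M - M') * (etaKernel l M' (x - y) * f y) := by
        refine lintegral_congr fun y => ?_
        rw [lintegral_mul_const _ (by fun_prop), lintegral_etaKernel_sub']
    _ = _ := by
        rw [lintegral_const_mul _ (by fun_prop)]; rfl

end Weights

/-! ### Jensen-type inequalities -/

/-- Jensen's inequality for a weighted integral. -/
lemma lintegral_mul_rpow_le {α : Type*} [MeasurableSpace α] (μ : Measure α) {w f : α → ℝ≥0∞}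
    (hw : Measurable w) (hf : Measurable f) {q : ℝ} (hq : 1 ≤ q) :
    (∫⁻ x, w x * f x ∂μ) ^ q ≤ (∫⁻ x, w x ∂μ) ^ (q - 1) * ∫⁻ x, w x * f x ^ q ∂μ := by
  have hq0 : 0 < q := by linarith
  have hq1 : 1 / q ≤ 1 := by rw [div_le_one hq0]; exact hq
  have h := ENNReal.lintegral_mul_norm_pow_le (μ := μ) (f := w) (g := fun x => w x * f x ^ q)
    (p := 1 - 1 / q) (q := 1 / q) hw.aemeasurable (by fun_prop) (by linarith) (by positivity)
    (by ring)
  have h2 : ∀ x, w x ^ (1 - 1 / q) * (w x * f x ^ q) ^ (1 / q) = w x * f x := by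
    intro x
    rw [ENNReal.mul_rpow_of_nonneg _ _ (by positivity), ← mul_assoc,
      ← ENNReal.rpow_add_of_nonneg _ _ (by linarith) (by positivity), ← ENNReal.rpow_mul]
    have e1 : 1 - 1 / q + 1 / q = 1 := by ring
    have e2 : q * (1 / q) = 1 := by field_simp
    rw [e1, e2, ENNReal.rpow_one, ENNReal.rpow_one]
  simp_rw [h2] at h
  refine (ENNReal.rpow_le_rpow h hq0.le).trans ?_
  rw [ENNReal.mul_rpow_of_nonneg _ _ hq0.le, ← ENNReal.rpow_mul, ← ENNReal.rpow_mul]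
  have e1 : (1 - 1 / q) * q = q - 1 := by field_simp
  have e2 : (1 / q) * q = 1 := by field_simp
  rw [e1, e2, ENNReal.rpow_one]

lemma tsum_rpow_le_of_le_one {q : ℝ} (hq : 0 < q) (hq1 : q ≤ 1) (t : ℕ → ℝ≥0∞) :
    (∑' k, t k) ^ q ≤ ∑' k, t k ^ q := by
  have h : Tendsto (fun n => (∑ k ∈ Finset.range n, t k) ^ q) atTop (nhds ((∑' k, t k) ^ q)) :=
    (ENNReal.continuous_rpow_const.tendsto _).comp (ENNReal.tendsto_nat_tsum t)
  refine le_of_tendsto' h fun n => ?_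
  refine le_trans ?_ (ENNReal.sum_le_tsum (Finset.range n))
  induction n with
  | zero => simp [ENNReal.zero_rpow_of_pos hq]
  | succ n ih =>
    rw [Finset.sum_range_succ, Finset.sum_range_succ]
    exact (ENNReal.rpow_add_le_add_rpow _ _ hq.le hq1).trans (by gcongr)

/-- A weighted sum to the power `q`, for any `q > 0`. -/
lemma tsum_mul_rpow_le {q : ℝ} (hq : 0 < q) (w t : ℕ → ℝ≥0∞) :
    (∑' k, w k * t k) ^ q ≤
      (∑' k, w k) ^ (q - min 1 q) * ∑' k, w k ^ min 1 q * t k ^ q := by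
  rcases le_total q 1 with h | h
  · rw [min_eq_right h]
    simp only [sub_self, ENNReal.rpow_zero, one_mul]
    refine (tsum_rpow_le_of_le_one hq h _).trans_eq (tsum_congr fun k => ?_)
    rw [ENNReal.mul_rpow_of_nonneg _ _ hq.le]
  · rw [min_eq_left h]
    have := lintegral_mul_rpow_le (Measure.count : Measure ℕ) (w := w) (f := t)
      (measurable_of_countable _) (measurable_of_countable _) h
    simpa [lintegral_count] using this

/-! ### The `r`-trick -/

section RTrick

variable {d : ℕ}

lemma lconvol_etaKernel_rpow_le (k : ℕ) (L : ℝ) {f : RD d → ℝ≥0∞} (hf : Measurable f) {q : ℝ}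
    (hq : 1 ≤ q) (x : RD d) :
    lconvol (etaKernel k L) f x ^ q ≤
      etaMass d L ^ (q - 1) * lconvol (etaKernel k L) (fun y => f y ^ q) x := by
  have := lintegral_mul_rpow_le volume (w := fun y => etaKernel k L (x - y)) (f := f)
    (by fun_prop) hf hq
  rwa [lintegral_etaKernel_sub] at this

lemma scaleWeight_rpow_neg_mul_le (k : ℕ) {L : ℝ} (hL : 0 ≤ L) (x y z : RD d) :
    scaleWeight k (x - y) ^ (-L) * scaleWeight k (y - z) ^ (-L) ≤ scaleWeight k (x - z) ^ (-L) := by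
  have h := scaleWeight_rpow_neg_le k hL (y - z) (x - z)
  rw [sub_sub_sub_cancel_right] at h
  calc _ ≤ scaleWeight k (x - y) ^ (-L) *
        (scaleWeight k (y - x) ^ L * scaleWeight k (x - z) ^ (-L)) := by gcongr
    _ = _ := by
      rw [scaleWeight_sub_comm k y x, ← mul_assoc, scaleWeight_rpow_neg_mul, one_mul]

/-- The `r`-trick for exponents below one, assuming that the Peetre maximal function is finite. -/
lemma rpow_le_lconvol_of_iSup_ne_top (k : ℕ) {q M : ℝ} (hq : 0 < q) (hq1 : q ≤ 1) (hM : 0 ≤ M)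
    {f : RD d → ℝ≥0∞} (hf : Measurable f) {C : ℝ≥0∞}
    (h : ∀ x, f x ≤ C * lconvol (etaKernel k (M / q)) f x) (x : RD d)
    (hP : (⨆ y, f y * scaleWeight k (x - y) ^ (-(M / q))) ≠ ⊤) :
    f x ^ q ≤ C * lconvol (etaKernel k M) (fun y => f y ^ q) x := by
  set P := ⨆ y, f y * scaleWeight k (x - y) ^ (-(M / q)) with hPdef
  set I := lconvol (etaKernel k M) (fun y => f y ^ q) x with hI
  have hMq : 0 ≤ M / q := by positivity
  have hle : ∀ y, f y * scaleWeight k (x - y) ^ (-(M / q)) ≤ P := fun y => le_iSup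
    (fun y => f y * scaleWeight k (x - y) ^ (-(M / q))) y
  have hfx : f x ≤ P := by
    have := hle x
    simpa [scaleWeight] using this
  rcases eq_or_ne P 0 with h0 | h0
  · rw [h0] at hfx
    rw [le_zero_iff.mp hfx, ENNReal.zero_rpow_of_pos hq]
    exact zero_le
  have hintg : ∀ y, f y * scaleWeight k (x - y) ^ (-(M / q)) ≤ C * (P ^ (1 - q) * I) := by
    intro y
    calc f y * scaleWeight k (x - y) ^ (-(M / q))
        ≤ C * lconvol (etaKernel k (M / q)) f y * scaleWeight k (x - y) ^ (-(M / q)) := by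
          gcongr; exact h y
      _ = C * ∫⁻ z, etaKernel k (M / q) (y - z) * f z * scaleWeight k (x - y) ^ (-(M / q)) := by
          rw [mul_assoc, lconvol, lintegral_mul_const _ (by fun_prop)]
      _ ≤ C * ∫⁻ z, P ^ (1 - q) * (etaKernel k M (x - z) * f z ^ q) := by
          refine mul_le_mul_right (lintegral_mono fun z => ?_) _
          calc etaKernel k (M / q) (y - z) * f z * scaleWeight k (x - y) ^ (-(M / q))
              = 2 ^ (k * d) * (f z * (scaleWeight k (x - y) ^ (-(M / q)) *
                  scaleWeight k (y - z) ^ (-(M / q)))) := by unfold etaKernel; ring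
            _ ≤ 2 ^ (k * d) * (f z * scaleWeight k (x - z) ^ (-(M / q))) := by
                gcongr; exact scaleWeight_rpow_neg_mul_le k hMq x y z
            _ = 2 ^ (k * d) * ((f z * scaleWeight k (x - z) ^ (-(M / q))) ^ (1 - q) *
                  (f z * scaleWeight k (x - z) ^ (-(M / q))) ^ q) := by
                rw [← ENNReal.rpow_add_of_nonneg _ _ (by linarith) hq.le, sub_add_cancel,
                  ENNReal.rpow_one]
            _ ≤ 2 ^ (k * d) * (P ^ (1 - q) *
                  (f z * scaleWeight k (x - z) ^ (-(M / q))) ^ q) := by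
                refine mul_le_mul_right (mul_le_mul_left
                  (ENNReal.rpow_le_rpow (hle z) (by linarith)) _) _
            _ = P ^ (1 - q) * (etaKernel k M (x - z) * f z ^ q) := by
                rw [ENNReal.mul_rpow_of_nonneg _ _ hq.le, ← ENNReal.rpow_mul]
                have : -(M / q) * q = -M := by field_simp
                rw [this, etaKernel]
                ring
      _ = C * (P ^ (1 - q) * I) := by
          rw [lintegral_const_mul _ (by fun_prop)]; rfl
  have hPle : P ≤ C * (P ^ (1 - q) * I) := iSup_le hintg
  have h1 : P ^ (1 - q) ≠ 0 := by simp [ENNReal.rpow_eq_zero_iff, h0, hP]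
  have h2 : P ^ (1 - q) ≠ ⊤ := ENNReal.rpow_ne_top_of_nonneg (by linarith) hP
  have hPq : P ^ q ≤ C * I := by
    have h3 : P ^ (1 - q) * P ^ q ≤ P ^ (1 - q) * (C * I) := by
      rw [← ENNReal.rpow_add_of_nonneg _ _ (by linarith) hq.le, sub_add_cancel, ENNReal.rpow_one]
      calc P ≤ C * (P ^ (1 - q) * I) := hPle
        _ = _ := by ring
    exact (ENNReal.mul_le_mul_iff_right h1 h2).mp h3
  exact (ENNReal.rpow_le_rpow hfx hq.le).trans hPq

/-- The `r`-trick: a reproducing inequality for `f` yields one for `f ^ q`, for a function of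
polynomial growth for which `η_{k,M} ∗ f ^ q` is bounded. -/
lemma rpow_le_lconvol (k : ℕ) {q M : ℝ} (hq : 0 < q) (hM : 0 ≤ M)
    {f : RD d → ℝ≥0∞} (hf : Measurable f)
    (hrep : ∀ L, ∃ C : ℝ≥0∞, C ≠ ⊤ ∧ ∀ x, f x ≤ C * lconvol (etaKernel k L) f x)
    (hgrowth : ∃ C : ℝ≥0∞, ∃ K : ℝ, C ≠ ⊤ ∧ 0 ≤ K ∧ ∀ x, f x ≤ C * scaleWeight k x ^ K)
    {B : ℝ≥0∞} (hB : B ≠ ⊤) (hbd : ∀ x, lconvol (etaKernel k M) (fun y => f y ^ q) x ≤ B)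
    {C : ℝ≥0∞} (h : ∀ x, f x ≤ C * lconvol (etaKernel k (M / min 1 q)) f x)
    (x : RD d) :
    f x ^ q ≤ C ^ max 1 q * etaMass d M ^ (max 1 q - 1) *
      lconvol (etaKernel k M) (fun y => f y ^ q) x := by
  rcases le_total 1 q with hq1 | hq1
  · rw [min_eq_left hq1, div_one] at h
    rw [max_eq_right hq1, mul_assoc]
    calc f x ^ q ≤ (C * lconvol (etaKernel k M) f x) ^ q := ENNReal.rpow_le_rpow (h x) hq.le
      _ = C ^ q * lconvol (etaKernel k M) f x ^ q := ENNReal.mul_rpow_of_nonneg _ _ hq.le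
      _ ≤ _ := by gcongr; exact lconvol_etaKernel_rpow_le k M hf hq1 x
  rw [min_eq_right hq1] at h
  simp only [max_eq_left hq1, sub_self, ENNReal.rpow_one, ENNReal.rpow_zero, mul_one]
  obtain ⟨Cg, K, hCg, hK, hg⟩ := hgrowth
  set M₁ := max M (q * K) with hM₁
  have hM₁0 : 0 ≤ M₁ := hM.trans (le_max_left _ _)
  have hKM₁ : K ≤ M₁ / q := by
    rw [le_div_iff₀ hq, mul_comm]; exact le_max_right _ _
  obtain ⟨C₁, hC₁, hr⟩ := hrep (M₁ / q)
  have hP₁ : ∀ x, (⨆ y, f y * scaleWeight k (x - y) ^ (-(M₁ / q))) ≠ ⊤ := by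
    intro x
    refine ne_top_of_le_ne_top (ENNReal.mul_ne_top hCg (scaleWeight_rpow_ne_top k x K))
      (iSup_le fun y => ?_)
    calc f y * scaleWeight k (x - y) ^ (-(M₁ / q))
        ≤ Cg * scaleWeight k y ^ K * scaleWeight k (x - y) ^ (-K) := by
          gcongr
          · exact hg y
          · exact one_le_scaleWeight k _
      _ ≤ Cg * (scaleWeight k x * scaleWeight k (x - y)) ^ K * scaleWeight k (x - y) ^ (-K) := by
          gcongr
          have := scaleWeight_add_le k x (y - x)
          rwa [add_sub_cancel, scaleWeight_sub_comm] at this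
      _ = Cg * scaleWeight k x ^ K * (scaleWeight k (x - y) ^ (-K) * scaleWeight k (x - y) ^ K) := by
          rw [ENNReal.mul_rpow_of_nonneg _ _ hK]; ring
      _ = Cg * scaleWeight k x ^ K := by rw [scaleWeight_rpow_neg_mul, mul_one]
  have hbound : ∀ y, f y ≤ (C₁ * B) ^ (1 / q) := by
    intro y
    rw [one_div, ENNReal.le_rpow_inv_iff hq]
    refine (rpow_le_lconvol_of_iSup_ne_top k hq hq1 hM₁0 hf hr y (hP₁ y)).trans ?_
    gcongr
    refine (lconvol_mono (fun z => etaKernel_anti k (le_max_left _ _) z) (fun _ => le_rfl) y).trans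
      (hbd y)
  refine rpow_le_lconvol_of_iSup_ne_top k hq hq1 hM hf h x ?_
  refine ne_top_of_le_ne_top (ENNReal.rpow_ne_top_of_nonneg (by positivity)
    (ENNReal.mul_ne_top hC₁ hB) : (C₁ * B) ^ (1 / q) ≠ ⊤) (iSup_le fun y => ?_)
  calc f y * scaleWeight k (x - y) ^ (-(M / q)) ≤ (C₁ * B) ^ (1 / q) * 1 := by
        gcongr
        · exact hbound y
        · rw [ENNReal.rpow_neg]
          exact ENNReal.inv_le_one.mpr (one_le_scaleWeight_rpow k _ (by positivity))
    _ = _ := mul_one _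

end RTrick

/-! ### Dyadic cubes -/

section Cubes

variable {d : ℕ}

lemma dyadicCube_eq_preimage (ν : ℤ) (n : Fin d → ℤ) :
    dyadicCube d ν n = (fun x : RD d => x.ofLp) ⁻¹' Set.pi Set.univ
      (fun i => Set.Ico ((n i : ℝ) * (2:ℝ) ^ (-ν)) (((n i : ℝ) + 1) * (2:ℝ) ^ (-ν))) := by
  ext x
  simp [dyadicCube]

lemma measurableSet_dyadicCube (ν : ℤ) (n : Fin d → ℤ) : MeasurableSet (dyadicCube d ν n) := by
  rw [dyadicCube_eq_preimage]
  refine (MeasurableSet.univ_pi fun i => measurableSet_Ico).preimage ?_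
  exact (EuclideanSpace.volume_preserving_symm_measurableEquiv_toLp (Fin d)).measurable

lemma volume_dyadicCube (μ : ℕ) (n : Fin d → ℤ) :
    (2:ℝ≥0∞) ^ ((μ:ℝ) * (d:ℝ)) * volume (dyadicCube d μ n) = 1 := by
  have h1 : volume (dyadicCube d μ n) = ENNReal.ofReal ((2:ℝ) ^ (-(μ:ℤ))) ^ d := by
    rw [dyadicCube_eq_preimage]
    have h := (EuclideanSpace.volume_preserving_symm_measurableEquiv_toLp (Fin d)).measure_preimage
      (s := Set.pi Set.univ (fun i => Set.Ico ((n i : ℝ) * (2:ℝ) ^ (-(μ:ℤ)))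
        (((n i : ℝ) + 1) * (2:ℝ) ^ (-(μ:ℤ)))))
      (MeasurableSet.univ_pi fun i => measurableSet_Ico).nullMeasurableSet
    refine h.trans ?_
    rw [Real.volume_pi_Ico]
    simp [add_mul]
  rw [h1, zpow_neg, zpow_natCast, ENNReal.ofReal_inv_of_pos (by positivity),
    ENNReal.ofReal_pow (by norm_num), ← Nat.cast_mul, ENNReal.rpow_natCast]
  simp only [ENNReal.ofReal_ofNat]
  rw [← ENNReal.inv_pow, ← pow_mul]
  exact ENNReal.mul_inv_cancel (by simp) (by simp)

lemma iUnion_dyadicCube (μ : ℤ) : ⋃ n, dyadicCube d μ n = Set.univ := by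
  refine Set.eq_univ_of_forall fun x => Set.mem_iUnion.mpr ⟨fun i => ⌊x i * (2:ℝ) ^ μ⌋, fun i => ?_⟩
  have h2 : (0:ℝ) < 2 ^ μ := by positivity
  rw [zpow_neg]
  constructor
  · rw [← div_eq_mul_inv, div_le_iff₀ h2]
    exact Int.floor_le _
  · rw [← div_eq_mul_inv, lt_div_iff₀ h2]
    exact Int.lt_floor_add_one _

lemma pairwise_disjoint_dyadicCube (μ : ℤ) :
    Pairwise (Function.onFun Disjoint (dyadicCube d μ)) := by
  intro n n' hn
  refine Set.disjoint_left.mpr fun x hx hx' => hn (funext fun i => ?_)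
  have h2 : (0:ℝ) < 2 ^ (-μ) := by positivity
  have h3 : (n i : ℝ) < n' i + 1 := lt_of_mul_lt_mul_right ((hx i).1.trans_lt (hx' i).2) h2.le
  have h4 : (n' i : ℝ) < n i + 1 := lt_of_mul_lt_mul_right ((hx' i).1.trans_lt (hx i).2) h2.le
  have h5 : n i < n' i + 1 := by exact_mod_cast h3
  have h6 : n' i < n i + 1 := by exact_mod_cast h4
  omega

lemma scaleWeight_sub_le_of_mem_dyadicCube {μ : ℕ} {n : Fin d → ℤ} {x y : RD d}
    (hx : x ∈ dyadicCube d μ n) (hy : y ∈ dyadicCube d μ n) :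
    scaleWeight μ (x - y) ≤ ENNReal.ofReal (1 + √d) := by
  unfold scaleWeight
  apply ENNReal.ofReal_le_ofReal
  have h2 : (0:ℝ) < 2 ^ (-(μ:ℤ)) := by positivity
  have hxy : ‖x - y‖ ≤ √d * 2 ^ (-(μ:ℤ)) := by
    rw [EuclideanSpace.norm_eq, Real.sqrt_le_left (by positivity), mul_pow,
      Real.sq_sqrt (by positivity)]
    calc ∑ i, ‖(x - y) i‖ ^ 2 ≤ ∑ _i : Fin d, ((2:ℝ) ^ (-(μ:ℤ))) ^ 2 := by
          refine Finset.sum_le_sum fun i _ => ?_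
          refine pow_le_pow_left₀ (norm_nonneg _) ?_ 2
          rw [Real.norm_eq_abs, abs_le, PiLp.sub_apply]
          have h := hx i
          have h' := hy i
          rw [add_mul, one_mul] at h h'
          constructor <;> linarith
      _ = _ := by simp
  have : (2:ℝ) ^ μ * ‖x - y‖ ≤ 2 ^ μ * (√d * 2 ^ (-(μ:ℤ))) := by gcongr
  have e : (2:ℝ) ^ μ * (√d * 2 ^ (-(μ:ℤ))) = √d := by
    rw [zpow_neg, zpow_natCast]; field_simp
  linarith

/-- If all averages of `S` over cubes of level `μ` are at most `B`, then so is, up to a constant,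
any `η_μ`-average of `S`. -/
lemma lconvol_etaKernel_le_of_cubes (μ : ℕ) {L : ℝ} (hL : 0 ≤ L) {S : RD d → ℝ≥0∞}
    (hS : Measurable S) {B : ℝ≥0∞}
    (hB : ∀ n, (2:ℝ≥0∞) ^ ((μ:ℝ) * (d:ℝ)) * ∫⁻ x in dyadicCube d μ n, S x ≤ B) (c : RD d) :
    lconvol (etaKernel μ L) S c ≤ ENNReal.ofReal (1 + √d) ^ L * etaMass d L * B := by
  have key : ∀ n, ∫⁻ y in dyadicCube d μ n, etaKernel μ L (c - y) * S y ≤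
      ENNReal.ofReal (1 + √d) ^ L * B * ∫⁻ z in dyadicCube d μ n, etaKernel μ L (c - z) := by
    intro n
    set E := ENNReal.ofReal (1 + √d) ^ L * ∫⁻ z in dyadicCube d μ n, etaKernel μ L (c - z) with hE
    have h1 : ∀ y ∈ dyadicCube d μ n,
        etaKernel μ L (c - y) ≤ (2:ℝ≥0∞) ^ ((μ:ℝ) * (d:ℝ)) * E := by
      intro y hy
      calc etaKernel μ L (c - y) = (2:ℝ≥0∞) ^ ((μ:ℝ) * (d:ℝ)) *
            ∫⁻ z in dyadicCube d μ n, etaKernel μ L (c - y) := by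
            rw [lintegral_const, Measure.restrict_apply_univ, mul_left_comm,
              volume_dyadicCube, mul_one]
        _ ≤ (2:ℝ≥0∞) ^ ((μ:ℝ) * (d:ℝ)) *
            ∫⁻ z in dyadicCube d μ n, ENNReal.ofReal (1 + √d) ^ L * etaKernel μ L (c - z) := by
            refine mul_le_mul_right (setLIntegral_mono' (measurableSet_dyadicCube _ _)
              fun z hz => ?_) _
            refine (etaKernel_le μ hL (c - y) (c - z)).trans ?_
            rw [sub_sub_sub_cancel_left]
            gcongr
            exact scaleWeight_sub_le_of_mem_dyadicCube hz hy
        _ = _ := by rw [lintegral_const_mul _ (by fun_prop)]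
    calc ∫⁻ y in dyadicCube d μ n, etaKernel μ L (c - y) * S y
        ≤ ∫⁻ y in dyadicCube d μ n, (2:ℝ≥0∞) ^ ((μ:ℝ) * (d:ℝ)) * E * S y := by
          refine setLIntegral_mono' (measurableSet_dyadicCube _ _) fun y hy => ?_
          exact mul_le_mul_left (h1 y hy) _
      _ = E * ((2:ℝ≥0∞) ^ ((μ:ℝ) * (d:ℝ)) * ∫⁻ y in dyadicCube d μ n, S y) := by
          rw [lintegral_const_mul _ hS]; ring
      _ ≤ E * B := by gcongr; exact hB n
      _ = _ := by rw [hE]; ring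
  unfold lconvol
  rw [← setLIntegral_univ, ← iUnion_dyadicCube (μ : ℤ), lintegral_iUnion
    (fun n => measurableSet_dyadicCube _ n) (pairwise_disjoint_dyadicCube _)]
  refine (ENNReal.tsum_le_tsum key).trans ?_
  rw [ENNReal.tsum_mul_left, ← lintegral_iUnion
    (fun n => measurableSet_dyadicCube _ n) (pairwise_disjoint_dyadicCube _), iUnion_dyadicCube,
    setLIntegral_univ, lintegral_etaKernel_sub]
  exact le_of_eq (by ring)

/-- The average of `η_{ν,L} ∗ S` over a cube of level `μ ≤ ν`. -/
lemma lintegral_dyadicCube_lconvol_le {μ ν : ℕ} (h : μ ≤ ν) {L : ℝ} (hL : 0 ≤ L)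
    {S : RD d → ℝ≥0∞} (hS : Measurable S) {n : Fin d → ℤ} {c : RD d}
    (hc : c ∈ dyadicCube d μ n) :
    (2:ℝ≥0∞) ^ ((μ:ℝ) * (d:ℝ)) * ∫⁻ x in dyadicCube d μ n, lconvol (etaKernel ν (L + L)) S x ≤
      ENNReal.ofReal (1 + √d) ^ L * etaMass d L * lconvol (etaKernel μ L) S c := by
  have hpt : ∀ x ∈ dyadicCube d μ n, ∀ y, (2:ℝ≥0∞) ^ ((μ:ℝ) * (d:ℝ)) *
      etaKernel ν (L + L) (x - y) ≤
      ENNReal.ofReal (1 + √d) ^ L * etaKernel μ L (c - y) * etaKernel ν L (x - y) := by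
    intro x hx y
    have h1 : scaleWeight ν (x - y) ^ (-L) ≤ ENNReal.ofReal (1 + √d) ^ L *
        scaleWeight μ (c - y) ^ (-L) := by
      calc scaleWeight ν (x - y) ^ (-L) ≤ scaleWeight μ (x - y) ^ (-L) := by
            rw [ENNReal.rpow_neg, ENNReal.rpow_neg]
            gcongr
            exact scaleWeight_mono h _
        _ ≤ scaleWeight μ (x - c) ^ L * scaleWeight μ (c - y) ^ (-L) := by
            have := scaleWeight_rpow_neg_le μ hL (x - y) (c - y)
            rwa [sub_sub_sub_cancel_right] at this
        _ ≤ _ := by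
            gcongr
            exact scaleWeight_sub_le_of_mem_dyadicCube hx hc
    have e2 : (2:ℝ≥0∞) ^ ((μ:ℝ) * (d:ℝ)) = 2 ^ (μ * d) := by
      rw [← Nat.cast_mul, ENNReal.rpow_natCast]
    have e3 : etaKernel ν (L + L) (x - y) = etaKernel ν L (x - y) * scaleWeight ν (x - y) ^ (-L) := by
      rw [etaKernel_mul_scaleWeight_rpow, sub_neg_eq_add]
    rw [e3, e2]
    calc _ ≤ 2 ^ (μ * d) * (etaKernel ν L (x - y) * (ENNReal.ofReal (1 + √d) ^ L *
        scaleWeight μ (c - y) ^ (-L))) := by gcongr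
      _ = _ := by unfold etaKernel; ring
  have hmeas := measurable_lconvol (measurable_etaKernel ν (L + L)) hS
  calc (2:ℝ≥0∞) ^ ((μ:ℝ) * (d:ℝ)) * ∫⁻ x in dyadicCube d μ n, lconvol (etaKernel ν (L + L)) S x
      = ∫⁻ x in dyadicCube d μ n, ∫⁻ y, (2:ℝ≥0∞) ^ ((μ:ℝ) * (d:ℝ)) *
          etaKernel ν (L + L) (x - y) * S y := by
        rw [← lintegral_const_mul _ hmeas]
        refine lintegral_congr fun x => ?_
        rw [lconvol, ← lintegral_const_mul _ (by fun_prop)]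
        simp_rw [mul_assoc]
    _ ≤ ∫⁻ x in dyadicCube d μ n, ∫⁻ y, etaKernel ν L (x - y) *
          (ENNReal.ofReal (1 + √d) ^ L * etaKernel μ L (c - y) * S y) := by
        refine setLIntegral_mono' (measurableSet_dyadicCube _ _) fun x hx => lintegral_mono fun y => ?_
        calc _ ≤ ENNReal.ofReal (1 + √d) ^ L * etaKernel μ L (c - y) * etaKernel ν L (x - y) * S y :=
              mul_le_mul_left (hpt x hx y) _
          _ = _ := by ring
    _ ≤ ∫⁻ x, ∫⁻ y, etaKernel ν L (x - y) *
          (ENNReal.ofReal (1 + √d) ^ L * etaKernel μ L (c - y) * S y) := setLIntegral_le_lintegral _ _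
    _ = ∫⁻ y, ∫⁻ x, etaKernel ν L (x - y) *
          (ENNReal.ofReal (1 + √d) ^ L * etaKernel μ L (c - y) * S y) := by
        rw [lintegral_lintegral_swap]
        fun_prop
    _ = ∫⁻ y, ENNReal.ofReal (1 + √d) ^ L * etaMass d L * (etaKernel μ L (c - y) * S y) := by
        refine lintegral_congr fun y => ?_
        rw [lintegral_mul_const _ (by fun_prop), lintegral_etaKernel_sub']
        ring
    _ = _ := by rw [lintegral_const_mul _ (by fun_prop)]; rfl

end Cubes

/-! ### Averages of slowly varying functions -/

section SlowlyVarying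

variable {d : ℕ}

lemma etaMass_ne_zero (L : ℝ) : etaMass d L ≠ 0 := by
  unfold etaMass
  intro h
  rw [lintegral_eq_zero_iff (by fun_prop)] at h
  have h2 : ∀ᵐ _x : RD d, False := by
    filter_upwards [h] with x hx
    exact etaKernel_ne_zero 0 L x hx
  rw [Filter.eventually_false_iff_eq_bot, ae_eq_bot] at h2
  exact NeZero.ne volume h2

/-- Pointwise bound for the product of `η_{l,M'}` and a function varying slowly at scale
`2^{-k} ≤ 2^{-l}`. -/
lemma etaKernel_mul_le_lconvol {k l : ℕ} (hkl : l ≤ k) {M M' : ℝ} (hM' : 0 ≤ M')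
    {h : RD d → ℝ≥0∞} (hh : Measurable h)
    (hslow : ∀ z z', h z ≤ scaleWeight k (z - z') ^ M * h z') (x z : RD d) :
    etaKernel l M' (x - z) * h z * etaMass d (M' + M) ≤
      2 ^ (k * d) * lconvol (etaKernel l M') h x := by
  calc etaKernel l M' (x - z) * h z * etaMass d (M' + M)
      = ∫⁻ z', etaKernel l M' (x - z) * h z * etaKernel k (M' + M) (z - z') := by
        rw [lintegral_const_mul _ (by fun_prop), lintegral_etaKernel_sub]
    _ ≤ ∫⁻ z', 2 ^ (k * d) * (etaKernel l M' (x - z') * h z') := by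
        refine lintegral_mono fun z' => ?_
        have h1 : etaKernel l M' (x - z) ≤ scaleWeight k (z - z') ^ M' * etaKernel l M' (x - z') := by
          refine (etaKernel_le l hM' (x - z) (x - z')).trans ?_
          rw [sub_sub_sub_cancel_left, scaleWeight_sub_comm]
          gcongr
          exact scaleWeight_mono hkl _
        calc _ ≤ (scaleWeight k (z - z') ^ M' * etaKernel l M' (x - z')) *
              (scaleWeight k (z - z') ^ M * h z') * etaKernel k (M' + M) (z - z') := by
              gcongr
              exact hslow z z'
          _ = etaKernel k (M' + M) (z - z') * scaleWeight k (z - z') ^ M' *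
              scaleWeight k (z - z') ^ M * (etaKernel l M' (x - z') * h z') := by ring
          _ = _ := by
              rw [etaKernel_mul_scaleWeight_rpow, etaKernel_mul_scaleWeight_rpow]
              simp [etaKernel]
    _ = _ := by rw [lintegral_const_mul _ (by fun_prop)]; rfl

lemma two_rpow_ne_top (r : ℝ) : (2:ℝ≥0∞) ^ r ≠ ⊤ :=
  ENNReal.rpow_ne_top_of_ne_zero (by simp) (by simp)

lemma two_rpow_add (r t : ℝ) : (2:ℝ≥0∞) ^ (r + t) = 2 ^ r * 2 ^ t :=
  ENNReal.rpow_add _ _ (by simp) (by simp)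

/-- Averaging the `q`-th root of a function that varies slowly at a finer scale. -/
lemma lconvol_rpow_inv_le {q M M' : ℝ} (hq : 0 < q) (hM' : 0 ≤ M')
    (hMM : (d:ℝ) < M' + M) {k l : ℕ} (hkl : l ≤ k) {h : RD d → ℝ≥0∞} (hh : Measurable h)
    (hslow : ∀ z z', h z ≤ scaleWeight k (z - z') ^ M * h z') (x : RD d) :
    lconvol (etaKernel l (M' / min 1 q)) (fun y => h y ^ (1 / q)) x ≤
      (etaMass d M' ^ (1 - 1 / max 1 q) * (etaMass d (M' + M))⁻¹ ^ (1 / min 1 q - 1)) *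
      (2:ℝ≥0∞) ^ (((d:ℝ) / min 1 q - d) * ((k:ℝ) - l)) *
      lconvol (etaKernel l M') h x ^ (1 / q) := by
  rcases le_total 1 q with hq1 | hq1
  · simp only [min_eq_left hq1, max_eq_right hq1, div_one, sub_self, zero_mul, ENNReal.rpow_zero,
      mul_one]
    have := lconvol_etaKernel_rpow_le l M' (f := fun y => h y ^ (1 / q)) (by fun_prop) hq1 x
    simp_rw [← ENNReal.rpow_mul, one_div_mul_cancel hq.ne', ENNReal.rpow_one] at this
    have h2 := ENNReal.rpow_le_rpow this (by positivity : 0 ≤ 1 / q)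
    rw [ENNReal.mul_rpow_of_nonneg _ _ (by positivity), ← ENNReal.rpow_mul, ← ENNReal.rpow_mul,
      mul_one_div_cancel hq.ne', ENNReal.rpow_one] at h2
    refine h2.trans_eq ?_
    congr 2
    field_simp
  · simp only [min_eq_right hq1, max_eq_left hq1, div_one, sub_self, ENNReal.rpow_zero,
      one_mul]
    set I := lconvol (etaKernel l M') h x with hI
    set m := etaMass d (M' + M) with hm
    have hr : 0 ≤ 1 / q - 1 := by
      rw [sub_nonneg, le_div_iff₀ hq, one_mul]; exact hq1
    have hp : ∀ z, etaKernel l M' (x - z) * h z ≤ m⁻¹ * (2 ^ (k * d) * I) := by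
      intro z
      have h1 := etaKernel_mul_le_lconvol hkl hM' hh hslow x z
      calc etaKernel l M' (x - z) * h z = m⁻¹ * (etaKernel l M' (x - z) * h z * m) := by
            rw [mul_left_comm, ENNReal.inv_mul_cancel (etaMass_ne_zero _) (etaMass_ne_top hMM),
              mul_one]
        _ ≤ _ := by gcongr
    have hpt : ∀ z, etaKernel l (M' / q) (x - z) * h z ^ (1 / q) ≤
        (2:ℝ≥0∞) ^ ((l:ℝ) * d * (1 - 1 / q)) * (m⁻¹ * (2 ^ (k * d) * I)) ^ (1 / q - 1) *
          (etaKernel l M' (x - z) * h z) := by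
      intro z
      calc etaKernel l (M' / q) (x - z) * h z ^ (1 / q)
          = (2:ℝ≥0∞) ^ ((l:ℝ) * d * (1 - 1 / q)) * (etaKernel l M' (x - z) * h z) ^ (1 / q) := by
            rw [ENNReal.mul_rpow_of_nonneg _ _ (by positivity), ← mul_assoc]
            congr 1
            unfold etaKernel
            rw [ENNReal.mul_rpow_of_nonneg _ _ (by positivity), ← ENNReal.rpow_natCast,
              ← ENNReal.rpow_mul, ← ENNReal.rpow_mul, ← mul_assoc, ← two_rpow_add]
            congr 2
            · push_cast; ring
            · ring
        _ = (2:ℝ≥0∞) ^ ((l:ℝ) * d * (1 - 1 / q)) * ((etaKernel l M' (x - z) * h z) ^ (1 / q - 1) *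
              (etaKernel l M' (x - z) * h z)) := by
            congr 1
            conv_rhs => rw [← ENNReal.rpow_one (etaKernel l M' (x - z) * h z), ← ENNReal.rpow_mul,
              one_mul, ← ENNReal.rpow_add_of_nonneg _ _ hr (by norm_num)]
            congr 1
            ring
        _ ≤ _ := by
            rw [← mul_assoc]
            exact mul_le_mul_left (mul_le_mul_right (ENNReal.rpow_le_rpow (hp z) hr) _) _
    calc lconvol (etaKernel l (M' / q)) (fun y => h y ^ (1 / q)) x
        ≤ ∫⁻ z, (2:ℝ≥0∞) ^ ((l:ℝ) * d * (1 - 1 / q)) * (m⁻¹ * (2 ^ (k * d) * I)) ^ (1 / q - 1) *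
          (etaKernel l M' (x - z) * h z) := lintegral_mono hpt
      _ = (2:ℝ≥0∞) ^ ((l:ℝ) * d * (1 - 1 / q)) * (m⁻¹ * (2 ^ (k * d) * I)) ^ (1 / q - 1) * I := by
          rw [lintegral_const_mul _ (by fun_prop)]; rfl
      _ = m⁻¹ ^ (1 / q - 1) * ((2:ℝ≥0∞) ^ ((l:ℝ) * d * (1 - 1 / q)) *
            (2 ^ (k * d)) ^ (1 / q - 1)) * (I ^ (1 / q - 1) * I ^ (1:ℝ)) := by
          rw [ENNReal.mul_rpow_of_nonneg _ _ hr, ENNReal.mul_rpow_of_nonneg _ _ hr,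
            ENNReal.rpow_one]
          ring
      _ = _ := by
          rw [← ENNReal.rpow_add_of_nonneg _ _ hr (by norm_num), ← ENNReal.rpow_natCast,
            ← ENNReal.rpow_mul, ← two_rpow_add]
          congr 3
          · push_cast; ring
          · ring

/-- Averages at scale `2^{-l}` of `(η_{k,M} ∗ F)^{1/q}`. -/
lemma lconvol_lconvol_rpow_inv_le {q M M' L : ℝ} (hq : 0 < q) (hM' : (d:ℝ) < M')
    (hM : M' + d < M) (hL : M' / min 1 q ≤ L) (hL' : M / q + d < L) :
    ∃ C : ℝ≥0∞, C ≠ ⊤ ∧ ∀ (k l : ℕ) (F : RD d → ℝ≥0∞), Measurable F → ∀ x,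
      lconvol (etaKernel l L) (fun y => lconvol (etaKernel k M) F y ^ (1 / q)) x ≤
      C * (2:ℝ≥0∞) ^ (((d:ℝ) / min 1 q - d) * ((k - l : ℕ) : ℝ)) *
        lconvol (etaKernel (min k l) M') F x ^ (1 / q) := by
  have hd0 : (0:ℝ) ≤ d := Nat.cast_nonneg d
  have hM'0 : 0 ≤ M' := by linarith
  have hM0 : 0 ≤ M := by linarith
  set C₁ := etaMass d M' ^ (1 - 1 / max 1 q) * (etaMass d (M' + M))⁻¹ ^ (1 / min 1 q - 1) *
    etaMass d (M - M') ^ (1 / q) with hC₁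
  have hslow : ∀ (k : ℕ) (F : RD d → ℝ≥0∞) (z z' : RD d), lconvol (etaKernel k M) F z ≤
      scaleWeight k (z - z') ^ M * lconvol (etaKernel k M) F z' := fun k F z z' =>
    lconvol_etaKernel_le k hM0 F z z'
  refine ⟨C₁ + etaMass d (L - M / q), ?_, ?_⟩
  · refine ENNReal.add_ne_top.mpr ⟨ENNReal.mul_ne_top (ENNReal.mul_ne_top ?_ ?_) ?_,
      etaMass_ne_top (by linarith)⟩
    · refine ENNReal.rpow_ne_top_of_nonneg ?_ (etaMass_ne_top hM')
      rw [sub_nonneg, div_le_one (by positivity)]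
      exact le_max_left _ _
    · refine ENNReal.rpow_ne_top_of_nonneg ?_ (by simp [etaMass_ne_zero])
      rw [sub_nonneg, le_div_iff₀ (by positivity), one_mul]
      exact min_le_left _ _
    · exact ENNReal.rpow_ne_top_of_nonneg (by positivity) (etaMass_ne_top (by linarith))
  intro k l F hF x
  have hh := measurable_lconvol (measurable_etaKernel k M) hF
  rcases le_total l k with hkl | hkl
  · rw [min_eq_right hkl, Nat.cast_sub hkl]
    calc lconvol (etaKernel l L) (fun y => lconvol (etaKernel k M) F y ^ (1 / q)) x
        ≤ lconvol (etaKernel l (M' / min 1 q)) (fun y => lconvol (etaKernel k M) F y ^ (1 / q)) x :=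
          lconvol_mono (fun z => etaKernel_anti l hL z) (fun _ => le_rfl) x
      _ ≤ _ := lconvol_rpow_inv_le hq hM'0 (by linarith) hkl hh (hslow k F) x
      _ ≤ (etaMass d M' ^ (1 - 1 / max 1 q) * (etaMass d (M' + M))⁻¹ ^ (1 / min 1 q - 1)) *
          (2:ℝ≥0∞) ^ (((d:ℝ) / min 1 q - d) * ((k:ℝ) - l)) *
          (etaMass d (M - M') * lconvol (etaKernel l M') F x) ^ (1 / q) := by
          gcongr
          exact lconvol_lconvol_etaKernel_le hkl hM'0 hF x
      _ = C₁ * (2:ℝ≥0∞) ^ (((d:ℝ) / min 1 q - d) * ((k:ℝ) - l)) *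
          lconvol (etaKernel l M') F x ^ (1 / q) := by
          rw [ENNReal.mul_rpow_of_nonneg _ _ (by positivity), hC₁]; ring
      _ ≤ _ := by gcongr; exact le_self_add
  · rw [min_eq_left hkl, Nat.sub_eq_zero_of_le hkl, Nat.cast_zero, mul_zero, ENNReal.rpow_zero,
      mul_one]
    calc lconvol (etaKernel l L) (fun y => lconvol (etaKernel k M) F y ^ (1 / q)) x
        ≤ ∫⁻ y, etaKernel l (L - M / q) (x - y) * lconvol (etaKernel k M) F x ^ (1 / q) := by
          refine lintegral_mono fun y => ?_
          rw [← etaKernel_mul_scaleWeight_rpow, mul_assoc]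
          gcongr
          refine (ENNReal.rpow_le_rpow (hslow k F y x) (by positivity : 0 ≤ 1 / q)).trans ?_
          rw [ENNReal.mul_rpow_of_nonneg _ _ (by positivity), ← ENNReal.rpow_mul, mul_one_div,
            scaleWeight_sub_comm]
          gcongr
          exact scaleWeight_mono hkl _
      _ = etaMass d (L - M / q) * lconvol (etaKernel k M) F x ^ (1 / q) := by
          rw [lintegral_mul_const _ (by fun_prop), lintegral_etaKernel_sub]
      _ ≤ (C₁ + etaMass d (L - M / q)) * lconvol (etaKernel k M') F x ^ (1 / q) := by
          gcongr
          · exact le_add_self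
          · exact lconvol_mono (fun z => etaKernel_anti k (by linarith) z) (fun _ => le_rfl) x

end SlowlyVarying

/-! ### Sums over dyadic cubes -/

/-- `∑_{n ∈ ℤ} r^{|n|}`. -/
def geomMass (r : ℝ≥0∞) : ℝ≥0∞ := ∑' z : ℤ, r ^ z.natAbs

lemma geomMass_ne_top {r : ℝ≥0∞} (hr : r < 1) : geomMass r ≠ ⊤ := by
  have h1 : HasSum (fun n : ℕ => r ^ (n : ℤ).natAbs) (∑' n : ℕ, r ^ n) := by
    simpa using (ENNReal.summable (f := fun n : ℕ => r ^ n)).hasSum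
  have h2 : HasSum (fun n : ℕ => r ^ (-(n + 1 : ℤ)).natAbs) (∑' n : ℕ, r ^ (n + 1)) := by
    have e : ∀ n : ℕ, (-(n + 1 : ℤ)).natAbs = n + 1 := fun n => by omega
    simp only [e]
    exact ENNReal.summable.hasSum
  have h : geomMass r = _ := (HasSum.of_nat_of_neg_add_one (f := fun z : ℤ => r ^ z.natAbs) h1 h2).tsum_eq
  rw [h]
  simp_rw [pow_succ, ENNReal.tsum_mul_right, ENNReal.tsum_geometric]
  have : (1 - r)⁻¹ ≠ ⊤ := by
    rw [ENNReal.inv_ne_top]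
    exact (tsub_pos_of_lt hr).ne'
  exact ENNReal.add_ne_top.mpr ⟨this, ENNReal.mul_ne_top this hr.ne_top⟩

lemma tsum_pow_natAbs_le (r : ℝ≥0∞) {ι : Type*} {e : ι → ℤ} (he : Function.Injective e) :
    ∑' i, r ^ (e i).natAbs ≤ geomMass r :=
  ENNReal.tsum_comp_le_tsum_of_injective he (fun z : ℤ => r ^ z.natAbs)

/-- The bounds on a sequence `F` expressed by the `F_∞` norm. -/
structure CubeBound {d : ℕ} (F : ℕ → RD d → ℝ≥0∞) (A : ℝ≥0∞) : Prop where
  measurable : ∀ k, Measurable (F k)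
  zero_le : ∀ x, F 0 x ≤ A
  cube_le : ∀ μ : ℕ, 1 ≤ μ → ∀ n, (2:ℝ≥0∞) ^ ((μ:ℝ) * (d:ℝ)) *
    ∫⁻ x in dyadicCube d μ n, ∑' j, F (μ + j) x ≤ A

section CubeSums

variable {d : ℕ} {F : ℕ → RD d → ℝ≥0∞} {A : ℝ≥0∞}

lemma CubeBound.lconvol_le (h : CubeBound F A) {L : ℝ} (hL : 0 ≤ L) (k : ℕ) (x : RD d) :
    lconvol (etaKernel k L) (F k) x ≤ ENNReal.ofReal (1 + √d) ^ L * etaMass d L * A := by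
  rcases Nat.eq_zero_or_pos k with rfl | hk
  · calc lconvol (etaKernel 0 L) (F 0) x ≤ ∫⁻ y, etaKernel 0 L (x - y) * A := by
          refine lintegral_mono fun y => ?_
          gcongr
          exact h.zero_le y
      _ = 1 * etaMass d L * A := by
          rw [lintegral_mul_const _ (by fun_prop), lintegral_etaKernel_sub, one_mul]
      _ ≤ _ := by
          gcongr
          have : (1:ℝ≥0∞) ≤ ENNReal.ofReal (1 + √d) := by
            rw [ENNReal.one_le_ofReal]
            linarith [Real.sqrt_nonneg (d:ℝ)]
          simpa using ENNReal.rpow_le_rpow this hL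
  · refine lconvol_etaKernel_le_of_cubes k hL (h.measurable k) (fun n => ?_) x
    refine le_trans ?_ (h.cube_le k hk n)
    gcongr with y
    simpa using ENNReal.le_tsum (f := fun j => F (k + j) y) 0

lemma nonempty_dyadicCube (μ : ℕ) (n : Fin d → ℤ) : (dyadicCube d μ n).Nonempty := by
  rw [Set.nonempty_iff_ne_empty]
  intro h
  simpa [h] using volume_dyadicCube μ n

/-- A sequence dominated by almost diagonal averages of `F` inherits the cube bounds of `F`. -/
lemma CubeBound.exists_lintegral_le (d : ℕ) {q L : ℝ} (hq : 0 < q) (hL : (d:ℝ) < L) {r : ℝ≥0∞}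
    (hr : r < 1) : ∃ C : ℝ≥0∞, C ≠ ⊤ ∧ ∀ (F : ℕ → RD d → ℝ≥0∞) (A : ℝ≥0∞), CubeBound F A →
      ∀ (g : ℕ → RD d → ℝ≥0∞) (B : ℝ≥0∞), (∀ l, 1 ≤ l → ∀ x, g l x ≤ B * ∑' k : ℕ,
        r ^ ((k:ℤ) - l).natAbs * lconvol (etaKernel (min k l) (L + L)) (F k) x ^ (1 / q)) →
      ∀ μ : ℕ, 1 ≤ μ → ∀ n, (2:ℝ≥0∞) ^ ((μ:ℝ) * (d:ℝ)) *
        ∫⁻ x in dyadicCube d μ n, ∑' j, g (μ + j) x ^ q ≤ C * B ^ q * A := by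
  have hL0 : 0 ≤ L := (Nat.cast_nonneg d).trans hL.le
  set t := min 1 q with ht
  have ht0 : 0 < t := by positivity
  have htq : t ≤ q := min_le_right _ _
  set ρ := r ^ t with hρ
  have hρ1 : ρ < 1 := ENNReal.rpow_lt_one hr ht0
  set K := ENNReal.ofReal (1 + √d) ^ L * etaMass d L with hK
  set K₂ := ENNReal.ofReal (1 + √d) ^ (L + L) * etaMass d (L + L) with hK₂
  have hsq : ∀ L : ℝ, 0 ≤ L → ENNReal.ofReal (1 + √d) ^ L ≠ ⊤ := fun L hL =>
    ENNReal.rpow_ne_top_of_nonneg hL (by simp)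
  have hKtop : K ≠ ⊤ := ENNReal.mul_ne_top (hsq L hL0) (etaMass_ne_top hL)
  have hK₂top : K₂ ≠ ⊤ := ENNReal.mul_ne_top (hsq _ (by linarith)) (etaMass_ne_top (by linarith))
  set G := geomMass ρ with hG
  have hGtop : G ≠ ⊤ := geomMass_ne_top hρ1
  refine ⟨geomMass r ^ (q - t) * (K₂ * G * G + K * G * K), ?_, ?_⟩
  · refine ENNReal.mul_ne_top (ENNReal.rpow_ne_top_of_nonneg (by linarith) (geomMass_ne_top hr)) ?_
    finiteness
  intro F A hF g B hg μ hμ n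
  obtain ⟨c, hc⟩ := nonempty_dyadicCube μ n
  set V := (2:ℝ≥0∞) ^ ((μ:ℝ) * (d:ℝ)) with hV
  set H : ℕ → ℕ → RD d → ℝ≥0∞ := fun k l x => lconvol (etaKernel (min k l) (L + L)) (F k) x with hH
  have hHm : ∀ k l, Measurable (H k l) := fun k l =>
    measurable_lconvol (measurable_etaKernel _ _) (hF.measurable k)
  have hpow : ∀ l, 1 ≤ l → ∀ x, g l x ^ q ≤
      (B ^ q * geomMass r ^ (q - t)) * ∑' k : ℕ, ρ ^ ((k:ℤ) - l).natAbs * H k l x := by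
    intro l hl x
    refine (ENNReal.rpow_le_rpow (hg l hl x) hq.le).trans ?_
    rw [ENNReal.mul_rpow_of_nonneg _ _ hq.le, mul_assoc]
    gcongr
    refine (tsum_mul_rpow_le hq _ _).trans ?_
    refine mul_le_mul' (ENNReal.rpow_le_rpow (tsum_pow_natAbs_le r (e := fun k : ℕ => (k:ℤ) - l)
      (fun a b hab => by simpa using hab)) (by linarith))
      (ENNReal.tsum_le_tsum fun k => mul_le_mul' (le_of_eq ?_) (le_of_eq ?_))
    · rw [hρ, ← ENNReal.rpow_natCast, ← ENNReal.rpow_natCast, ← ENNReal.rpow_mul,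
        ← ENNReal.rpow_mul, mul_comm]
    · rw [← ENNReal.rpow_mul, one_div_mul_cancel hq.ne', ENNReal.rpow_one]
  have hlow : ∀ k < μ, ∀ j, V * ∫⁻ x in dyadicCube d μ n, H k (μ + j) x ≤ K₂ * A := by
    intro k hk j
    calc V * ∫⁻ x in dyadicCube d μ n, H k (μ + j) x
        ≤ V * ∫⁻ x in dyadicCube d μ n, K₂ * A := by
          gcongr with x
          have : min k (μ + j) = k := by omega
          simp only [hH, this]
          exact hF.lconvol_le (by linarith) k x
      _ = K₂ * A := by
          rw [lintegral_const, Measure.restrict_apply_univ, mul_left_comm, volume_dyadicCube,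
            mul_one]
  have hhigh : ∀ i j, V * ∫⁻ x in dyadicCube d μ n, H (μ + i) (μ + j) x ≤
      K * lconvol (etaKernel μ L) (F (μ + i)) c := fun i j =>
    lintegral_dyadicCube_lconvol_le (by omega) hL0 (hF.measurable _) hc
  have hterm : ∀ j, V * ∫⁻ x in dyadicCube d μ n, ∑' k : ℕ,
      ρ ^ ((k:ℤ) - (μ + j : ℕ)).natAbs * H k (μ + j) x ≤
      ∑ k ∈ Finset.range μ, ρ ^ ((k:ℤ) - μ).natAbs * ρ ^ (j:ℤ).natAbs * (K₂ * A) +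
      ∑' i : ℕ, ρ ^ ((i:ℤ) - j).natAbs * (K * lconvol (etaKernel μ L) (F (μ + i)) c) := by
    intro j
    rw [lintegral_tsum (fun k => ((hHm k _).const_mul _).aemeasurable), ← ENNReal.tsum_mul_left,
      ← (ENNReal.summable).sum_add_tsum_nat_add' (k := μ)]
    refine add_le_add (Finset.sum_le_sum fun k hk => ?_) (ENNReal.tsum_le_tsum fun i => ?_)
    · rw [Finset.mem_range] at hk
      rw [lintegral_const_mul _ (hHm _ _), mul_left_comm, ← pow_add]
      have : ((k:ℤ) - (μ + j : ℕ)).natAbs = ((k:ℤ) - μ).natAbs + (j:ℤ).natAbs := by omega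
      rw [this]
      exact mul_le_mul_right (hlow k hk j) _
    · rw [lintegral_const_mul _ (hHm _ _), mul_left_comm, add_comm i μ]
      have : (((μ + i : ℕ):ℤ) - (μ + j : ℕ)).natAbs = ((i:ℤ) - j).natAbs := by omega
      rw [this]
      exact mul_le_mul_right (hhigh i j) _
  have hsum : ∑' i, lconvol (etaKernel μ L) (F (μ + i)) c ≤ K * A := by
    have : ∑' i, lconvol (etaKernel μ L) (F (μ + i)) c =
        lconvol (etaKernel μ L) (fun y => ∑' i, F (μ + i) y) c := by
      unfold lconvol
      simp_rw [← ENNReal.tsum_mul_left]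
      rw [lintegral_tsum]
      intro i
      have := hF.measurable (μ + i)
      fun_prop
    rw [this]
    exact lconvol_etaKernel_le_of_cubes μ hL0 (Measurable.tsum fun i => hF.measurable _)
      (hF.cube_le μ hμ) c
  have hmeas : ∀ j, Measurable (fun x => ∑' k : ℕ,
      ρ ^ ((k:ℤ) - (μ + j : ℕ)).natAbs * H k (μ + j) x) := fun j =>
    Measurable.tsum fun k => (hHm k _).const_mul _
  calc V * ∫⁻ x in dyadicCube d μ n, ∑' j, g (μ + j) x ^ q
      ≤ V * ∫⁻ x in dyadicCube d μ n, (B ^ q * geomMass r ^ (q - t)) * ∑' j, ∑' k : ℕ,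
          ρ ^ ((k:ℤ) - (μ + j : ℕ)).natAbs * H k (μ + j) x := by
        refine mul_le_mul_right (lintegral_mono fun x => ?_) _
        rw [← ENNReal.tsum_mul_left]
        exact ENNReal.tsum_le_tsum fun j => hpow _ (by omega) x
    _ = (B ^ q * geomMass r ^ (q - t)) * ∑' j, V * ∫⁻ x in dyadicCube d μ n, ∑' k : ℕ,
          ρ ^ ((k:ℤ) - (μ + j : ℕ)).natAbs * H k (μ + j) x := by
        rw [lintegral_const_mul _ (Measurable.tsum hmeas),
          lintegral_tsum fun j => (hmeas j).aemeasurable, ENNReal.tsum_mul_left]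
        ring
    _ ≤ (B ^ q * geomMass r ^ (q - t)) * (K₂ * G * G * A + K * G * K * A) := by
        refine mul_le_mul_right ((ENNReal.tsum_le_tsum hterm).trans ?_) _
        rw [ENNReal.tsum_add]
        gcongr ?_ + ?_
        · calc ∑' j : ℕ, ∑ k ∈ Finset.range μ, ρ ^ ((k:ℤ) - μ).natAbs * ρ ^ (j:ℤ).natAbs * (K₂ * A)
              = (∑ k ∈ Finset.range μ, ρ ^ ((k:ℤ) - μ).natAbs) * (∑' j : ℕ, ρ ^ (j:ℤ).natAbs) *
                (K₂ * A) := by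
                rw [← ENNReal.tsum_mul_left, ← ENNReal.tsum_mul_right]
                refine tsum_congr fun j => ?_
                rw [Finset.sum_mul, Finset.sum_mul]
            _ ≤ G * G * (K₂ * A) := by
                gcongr
                · exact (ENNReal.sum_le_tsum _).trans (tsum_pow_natAbs_le ρ
                    (e := fun k : ℕ => (k:ℤ) - μ) (fun a b hab => by simpa using hab))
                · exact tsum_pow_natAbs_le ρ (e := fun k : ℕ => (k:ℤ))
                    (fun a b hab => by simpa using hab)
            _ = _ := by ring
        · rw [ENNReal.tsum_comm]
          calc ∑' (i : ℕ) (j : ℕ), ρ ^ ((i:ℤ) - j).natAbs *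
                (K * lconvol (etaKernel μ L) (F (μ + i)) c)
              ≤ ∑' i : ℕ, G * (K * lconvol (etaKernel μ L) (F (μ + i)) c) := by
                refine ENNReal.tsum_le_tsum fun i => ?_
                rw [ENNReal.tsum_mul_right]
                gcongr
                exact tsum_pow_natAbs_le ρ (e := fun j : ℕ => (i:ℤ) - j)
                  (fun a b hab => by simpa using hab)
            _ = G * K * ∑' i : ℕ, lconvol (etaKernel μ L) (F (μ + i)) c := by
                rw [← ENNReal.tsum_mul_left]
                simp_rw [mul_assoc]
            _ ≤ G * K * (K * A) := by gcongr
            _ = _ := by ring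
    _ = _ := by ring

end CubeSums

/-! ### Smoothness of parametric integrals -/

/-- Differentiation of all orders under the integral sign. -/
theorem hasFTaylorSeriesUpTo_integral {α E G : Type*} [MeasurableSpace α] {μ : Measure α}
    [NormedAddCommGroup E] [NormedSpace ℝ E] [NormedAddCommGroup G] [NormedSpace ℝ G]
    {f : α → E → G} (hf : ∀ y, ContDiff ℝ ∞ (f y))
    (hm : ∀ n x, AEStronglyMeasurable (fun y => iteratedFDeriv ℝ n (f y) x) μ)
    (hb : ∀ (n : ℕ) (x₀ : E), ∃ b : α → ℝ, Integrable b μ ∧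
      ∀ᶠ x in nhds x₀, ∀ y, ‖iteratedFDeriv ℝ n (f y) x‖ ≤ b y) :
    HasFTaylorSeriesUpTo ∞ (fun x => ∫ y, f y x ∂μ)
      (fun x n => ∫ y, iteratedFDeriv ℝ n (f y) x ∂μ) := by
  have hder : ∀ (n : ℕ) (x : E), HasFDerivAt (fun x => ∫ y, iteratedFDeriv ℝ n (f y) x ∂μ)
      (∫ y, iteratedFDeriv ℝ (n + 1) (f y) x ∂μ).curryLeft x := by
    intro n x₀
    obtain ⟨b, hbi, hb'⟩ := hb (n + 1) x₀
    obtain ⟨b₀, hbi₀, hb₀⟩ := hb n x₀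
    have e : (∫ y, iteratedFDeriv ℝ (n + 1) (f y) x₀ ∂μ).curryLeft
        = ∫ y, (iteratedFDeriv ℝ (n + 1) (f y) x₀).curryLeft ∂μ := by
      let J : (E [×n + 1]→L[ℝ] G) ≃L[ℝ] (E →L[ℝ] E [×n]→L[ℝ] G) :=
        (continuousMultilinearCurryLeftEquiv ℝ (fun _ : Fin (n + 1) => E)
          G).toContinuousLinearEquiv
      exact (ContinuousLinearEquiv.integral_comp_comm (𝕜 := ℝ) (E := E [×n + 1]→L[ℝ] G)
        (F := E →L[ℝ] E [×n]→L[ℝ] G) J (fun y => iteratedFDeriv ℝ (n + 1) (f y) x₀)).symm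
    rw [e]
    refine hasFDerivAt_integral_of_dominated_of_fderiv_le
      (F' := fun x y => (iteratedFDeriv ℝ (n + 1) (f y) x).curryLeft) hb' (.of_forall fun x => hm n x) ?_ ?_
      (.of_forall fun y x hx => ?_) hbi (.of_forall fun y x _ => ?_)
    · exact hbi₀.mono' (hm n x₀) (.of_forall fun y => hb₀.self_of_nhds y)
    · exact (continuousMultilinearCurryLeftEquiv ℝ (fun _ : Fin (n + 1) => E)
        G).continuous.comp_aestronglyMeasurable (hm (n + 1) x₀)
    · simpa only [ContinuousMultilinearMap.curryLeft_norm] using hx y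
    · exact (hf y).ftaylorSeries.fderiv n (by exact_mod_cast ENat.natCast_lt_top n) x
  constructor
  · intro x
    exact ((continuousMultilinearCurryFin0 ℝ E G).toContinuousLinearEquiv.integral_comp_comm _).symm.trans
      (by simp [continuousMultilinearCurryFin0])
  · intro n _ x
    exact hder n x
  · intro n _
    exact continuous_iff_continuousAt.2 fun x => (hder n x).continuousAt

theorem contDiff_integral {α E G : Type*} [MeasurableSpace α] {μ : Measure α}
    [NormedAddCommGroup E] [NormedSpace ℝ E] [NormedAddCommGroup G] [NormedSpace ℝ G]
    {f : α → E → G} (hf : ∀ y, ContDiff ℝ ∞ (f y))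
    (hm : ∀ n x, AEStronglyMeasurable (fun y => iteratedFDeriv ℝ n (f y) x) μ)
    (hb : ∀ (n : ℕ) (x₀ : E), ∃ b : α → ℝ, Integrable b μ ∧
      ∀ᶠ x in nhds x₀, ∀ y, ‖iteratedFDeriv ℝ n (f y) x‖ ≤ b y) :
    ContDiff ℝ ∞ (fun x => ∫ y, f y x ∂μ) :=
  (hasFTaylorSeriesUpTo_integral hf hm hb).contDiff

theorem iteratedFDeriv_integral {α E G : Type*} [MeasurableSpace α] {μ : Measure α}
    [NormedAddCommGroup E] [NormedSpace ℝ E] [NormedAddCommGroup G] [NormedSpace ℝ G]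
    {f : α → E → G} (hf : ∀ y, ContDiff ℝ ∞ (f y))
    (hm : ∀ n x, AEStronglyMeasurable (fun y => iteratedFDeriv ℝ n (f y) x) μ)
    (hb : ∀ (n : ℕ) (x₀ : E), ∃ b : α → ℝ, Integrable b μ ∧
      ∀ᶠ x in nhds x₀, ∀ y, ‖iteratedFDeriv ℝ n (f y) x‖ ≤ b y) (n : ℕ) (x : E) :
    iteratedFDeriv ℝ n (fun x => ∫ y, f y x ∂μ) x = ∫ y, iteratedFDeriv ℝ n (f y) x ∂μ :=
  ((hasFTaylorSeriesUpTo_integral hf hm hb).eq_iteratedFDeriv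
    (by exact_mod_cast le_top) x).symm

/-! ### Exchanging a tempered distribution with an integral -/

/-- Bounded continuous functions with values in a normed group. -/
abbrev BddCont (X G : Type) [TopologicalSpace X] [NormedAddCommGroup G] : Type :=
  BoundedContinuousFunction X G

/-- The map `ψ ↦ ‖x‖ ^ k • D^n ψ(x)` from Schwartz functions to bounded continuous functions. -/
def weightedDerivCLM (d k n : ℕ) :
    𝓢(RD d, ℂ) →L[ℂ] BddCont (RD d) (RD d [×n]→L[ℝ] ℂ) :=
  SchwartzMap.mkCLMtoNormedSpace
    (fun ψ => BoundedContinuousFunction.ofNormedAddCommGroup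
      (fun x => ‖x‖ ^ k • iteratedFDeriv ℝ n ψ x)
      ((continuous_norm.pow k).smul ((ψ.smooth n).continuous_iteratedFDeriv le_rfl))
      (SchwartzMap.seminorm ℂ k n ψ)
      (fun x => by
        rw [norm_smul, norm_pow, norm_norm]
        exact SchwartzMap.le_seminorm ℂ k n ψ x))
    (fun ψ₁ ψ₂ => by
      ext1 x
      have : iteratedFDeriv ℝ n (⇑(ψ₁ + ψ₂)) x
          = iteratedFDeriv ℝ n ψ₁ x + iteratedFDeriv ℝ n ψ₂ x :=
        iteratedFDeriv_add_apply (ψ₁.smooth n).contDiffAt (ψ₂.smooth n).contDiffAt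
      change ‖x‖ ^ k • iteratedFDeriv ℝ n (⇑(ψ₁ + ψ₂)) x
        = ‖x‖ ^ k • iteratedFDeriv ℝ n ψ₁ x + ‖x‖ ^ k • iteratedFDeriv ℝ n ψ₂ x
      rw [this, smul_add])
    (fun c ψ => by
      ext1 x
      have : iteratedFDeriv ℝ n (⇑(c • ψ)) x = c • iteratedFDeriv ℝ n ψ x :=
        iteratedFDeriv_const_smul_apply (ψ.smooth n).contDiffAt
      change ‖x‖ ^ k • iteratedFDeriv ℝ n (⇑(c • ψ)) x
        = c • ‖x‖ ^ k • iteratedFDeriv ℝ n ψ x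
      rw [this, smul_comm])
    ⟨{(k, n)}, 1, zero_le_one, fun ψ => by
      rw [Finset.sup_singleton, one_mul]
      refine (BoundedContinuousFunction.norm_le (apply_nonneg _ _)).2 fun x => ?_
      change ‖‖x‖ ^ k • iteratedFDeriv ℝ n ψ x‖ ≤ _
      rw [norm_smul, norm_pow, norm_norm]
      exact SchwartzMap.le_seminorm ℂ k n ψ x⟩

theorem weightedDerivCLM_apply (d k n : ℕ) (ψ : 𝓢(RD d, ℂ)) (x : RD d) :
    weightedDerivCLM d k n ψ x = ‖x‖ ^ k • iteratedFDeriv ℝ n ψ x := rfl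

theorem norm_weightedDerivCLM (d k n : ℕ) (ψ : 𝓢(RD d, ℂ)) :
    ‖weightedDerivCLM d k n ψ‖ = SchwartzMap.seminorm ℂ k n ψ := by
  refine le_antisymm ?_ ?_
  · refine (BoundedContinuousFunction.norm_le (apply_nonneg _ _)).2 fun x => ?_
    rw [weightedDerivCLM_apply, norm_smul, norm_pow, norm_norm]
    exact SchwartzMap.le_seminorm ℂ k n ψ x
  · refine SchwartzMap.seminorm_le_bound ℂ k n ψ
      (norm_nonneg (weightedDerivCLM d k n ψ)) fun x => ?_
    refine le_trans (le_of_eq ?_) ((weightedDerivCLM d k n ψ).norm_coe_le_norm x)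
    rw [weightedDerivCLM_apply, norm_smul, norm_pow, norm_norm]

/-- A linear functional dominated by the norm of an injective linear map factors through it. -/
theorem exists_strongDual_comp_eq {V W : Type*} [AddCommGroup V] [Module ℂ V]
    [NormedAddCommGroup W] [NormedSpace ℂ W] (ι : V →ₗ[ℂ] W) (hι : Function.Injective ι)
    (u : V →ₗ[ℂ] ℂ) {C : ℝ} (h : ∀ v, ‖u v‖ ≤ C * ‖ι v‖) :
    ∃ w : StrongDual ℂ W, ∀ v, u v = w (ι v) := by
  let e := LinearEquiv.ofInjective ι hι
  let g : StrongDual ℂ (LinearMap.range ι) :=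
    LinearMap.mkContinuous (u.comp e.symm.toLinearMap) C fun z => by
      obtain ⟨v, rfl⟩ := e.surjective z
      simpa [e] using h v
  obtain ⟨w, hw, -⟩ := exists_extension_norm_eq _ g
  refine ⟨w, fun v => ?_⟩
  have := hw (e v)
  simpa [g, e] using this.symm

/-- A linear functional dominated by finitely many vector-valued linear maps commutes with every
integral that these maps commute with. -/
theorem apply_eq_integral_of_le_pi {I V α : Type*} [Fintype I] [AddCommGroup V] [Module ℂ V]
    {W : I → Type*} [∀ i, NormedAddCommGroup (W i)] [∀ i, NormedSpace ℂ (W i)]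
    [∀ i, CompleteSpace (W i)] [MeasurableSpace α] {μ : Measure α} (T : ∀ i, V →ₗ[ℂ] W i)
    (hT : ∀ v, (∀ i, T i v = 0) → v = 0) (u : V →ₗ[ℂ] ℂ) {C : ℝ}
    (hu : ∀ v, ‖u v‖ ≤ C * ‖fun i => T i v‖) {Ψ : α → V} {f : α → ℂ} {ψ : V}
    (hintg : ∀ i, Integrable (fun y => f y • T i (Ψ y)) μ)
    (hψ : ∀ i, T i ψ = ∫ y, f y • T i (Ψ y) ∂μ) :
    u ψ = ∫ y, f y * u (Ψ y) ∂μ := by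
  have hinj : Function.Injective (LinearMap.pi T) := by
    refine (injective_iff_map_eq_zero _).2 fun v hv => hT v fun i => congrFun hv i
  obtain ⟨w, hw⟩ := exists_strongDual_comp_eq (LinearMap.pi T) hinj u hu
  have hI : Integrable (fun y => f y • LinearMap.pi T (Ψ y)) μ := Integrable.of_eval hintg
  have e : LinearMap.pi T ψ = ∫ y, f y • LinearMap.pi T (Ψ y) ∂μ := by
    funext i
    exact (hψ i).trans (eval_integral hintg i).symm
  rw [hw, e, ← w.integral_comp_comm hI]
  refine integral_congr_ae (.of_forall fun y => ?_)
  simp only [map_smul, smul_eq_mul, hw]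

/-- A tempered distribution commutes with an absolutely convergent integral of Schwartz
functions. -/
theorem apply_eq_integral {d : ℕ} (u : TD d) {Ψ : RD d → 𝓢(RD d, ℂ)} (hΨ : Continuous Ψ)
    {f : RD d → ℂ} (hf : Continuous f) {ψ : 𝓢(RD d, ℂ)}
    (hintg : ∀ k n, Integrable (fun y => ‖f y‖ * SchwartzMap.seminorm ℂ k n (Ψ y)))
    (h : ∀ n x, iteratedFDeriv ℝ n ψ x = ∫ y, f y • iteratedFDeriv ℝ n (Ψ y) x) :
    u ψ = ∫ y, f y * u (Ψ y) := by
  obtain ⟨s, C, -, hs⟩ := Seminorm.bound_of_continuous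
    (schwartz_withSeminorms ℂ (RD d) ℂ) ((normSeminorm ℂ ℂ).comp u.toLinearMap)
    (continuous_norm.comp u.continuous)
  have hI : ∀ k n, Integrable (fun y => f y • weightedDerivCLM d k n (Ψ y)) := fun k n => by
    refine Integrable.mono' (hintg k n)
      (hf.smul ((weightedDerivCLM d k n).continuous.comp hΨ)).aestronglyMeasurable
      (.of_forall fun y => ?_)
    rw [norm_smul, norm_weightedDerivCLM]
  refine apply_eq_integral_of_le_pi (I := (insert (0, 0) s : Finset (ℕ × ℕ)))
    (fun i => (weightedDerivCLM d i.1.1 i.1.2).toLinearMap) (fun ψ hψ => ?_)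
    u.toLinearMap (C := C) (fun ψ => ?_) (fun i => hI _ _) (fun i => ?_)
  · ext x
    have h0 := hψ ⟨(0, 0), Finset.mem_insert_self _ _⟩
    have h1 := congrArg (fun g : BddCont (RD d) (RD d [×0]→L[ℝ] ℂ) => g x 0) h0
    simpa [weightedDerivCLM_apply] using h1
  · refine (hs ψ).trans ?_
    change (C : ℝ) * _ ≤ _
    refine mul_le_mul_of_nonneg_left ?_ C.2
    refine Seminorm.finset_sup_apply_le (norm_nonneg _) fun i hi => ?_
    change SchwartzMap.seminorm ℂ i.1 i.2 ψ ≤ _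
    rw [← norm_weightedDerivCLM]
    exact norm_le_pi_norm (fun i : (insert (0, 0) s : Finset (ℕ × ℕ)) =>
      (weightedDerivCLM d i.1.1 i.1.2).toLinearMap ψ) ⟨i, Finset.mem_insert_of_mem hi⟩
  · ext1 x
    have := (BoundedContinuousFunction.evalCLM ℂ x :
      BddCont (RD d) (RD d [×i.1.2]→L[ℝ] ℂ) →L[ℂ] _).integral_comp_comm
        (hI i.1.1 i.1.2)
    refine Eq.trans ?_ this
    change weightedDerivCLM d i.1.1 i.1.2 ψ x = _
    rw [weightedDerivCLM_apply, h, ← integral_smul]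
    refine integral_congr_ae (.of_forall fun y => ?_)
    change _ = f y • weightedDerivCLM d i.1.1 i.1.2 (Ψ y) x
    rw [weightedDerivCLM_apply]
    exact smul_comm _ _ _

/-! ### Translates of Schwartz functions -/

theorem fourierS_eq {d : ℕ} (f : 𝓢(RD d, ℂ)) : fourierS f = FourierTransform.fourier f := rfl

theorem fourierS_apply {d : ℕ} (f : 𝓢(RD d, ℂ)) (ξ : RD d) :
    fourierS f ξ = ∫ v, Complex.exp (-(2 * Real.pi * Complex.I * ((⟪v, ξ⟫ : ℝ) : ℂ))) * f v := by
  rw [fourierS_eq, SchwartzMap.fourier_coe, Real.fourier_eq']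
  refine integral_congr_ae (.of_forall fun v => ?_)
  simp only [smul_eq_mul]
  congr 2
  push_cast
  ring

theorem integral_fourierS_mul {d : ℕ} (f g : 𝓢(RD d, ℂ)) :
    ∫ ξ, fourierS f ξ * g ξ = ∫ x, f x * fourierS g x :=
  SchwartzMap.integral_fourier_mul_eq f g

theorem exists_one_add_norm_pow_mul_iteratedFDeriv_le {d : ℕ} (f : 𝓢(RD d, ℂ)) (k n : ℕ) :
    ∃ C : ℝ, 0 ≤ C ∧ ∀ x, (1 + ‖x‖) ^ k * ‖iteratedFDeriv ℝ n f x‖ ≤ C :=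
  ⟨_, by positivity, fun x =>
    SchwartzMap.one_add_le_sup_seminorm_apply (𝕜 := ℂ) (m := (k, n)) le_rfl le_rfl f x⟩

theorem exists_norm_pow_mul_iteratedFDeriv_sub_le {d : ℕ} (f : 𝓢(RD d, ℂ)) (k n : ℕ) :
    ∃ C : ℝ, 0 ≤ C ∧ ∀ x y, ‖x‖ ^ k * ‖iteratedFDeriv ℝ n f (x - y)‖ ≤ C * (1 + ‖y‖) ^ k := by
  obtain ⟨C, hC, h⟩ := exists_one_add_norm_pow_mul_iteratedFDeriv_le f k n
  refine ⟨C, hC, fun x y => ?_⟩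
  have h1 : ‖x‖ ≤ (1 + ‖x - y‖) * (1 + ‖y‖) := by
    have : ‖x‖ ≤ ‖x - y‖ + ‖y‖ := norm_le_norm_sub_add x y
    nlinarith [norm_nonneg (x - y), norm_nonneg y, mul_nonneg (norm_nonneg (x - y)) (norm_nonneg y)]
  calc ‖x‖ ^ k * ‖iteratedFDeriv ℝ n f (x - y)‖
      ≤ ((1 + ‖x - y‖) * (1 + ‖y‖)) ^ k * ‖iteratedFDeriv ℝ n f (x - y)‖ := by gcongr
    _ = (1 + ‖x - y‖) ^ k * ‖iteratedFDeriv ℝ n f (x - y)‖ * (1 + ‖y‖) ^ k := by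
        rw [mul_pow]; ring
    _ ≤ C * (1 + ‖y‖) ^ k := mul_le_mul_of_nonneg_right (h _) (by positivity)

theorem iteratedFDeriv_compSubConstCLM {d : ℕ} (f : 𝓢(RD d, ℂ)) (y : RD d) (n : ℕ) (x : RD d) :
    iteratedFDeriv ℝ n (f.compSubConstCLM ℂ y) x = iteratedFDeriv ℝ n f (x - y) :=
  iteratedFDeriv_comp_sub n y x

theorem exists_seminorm_compSubConstCLM_le {d : ℕ} (f : 𝓢(RD d, ℂ)) (k n : ℕ) :
    ∃ C : ℝ, 0 ≤ C ∧ ∀ y, SchwartzMap.seminorm ℂ k n (f.compSubConstCLM ℂ y)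
      ≤ C * (1 + ‖y‖) ^ k := by
  obtain ⟨C, hC, h⟩ := exists_norm_pow_mul_iteratedFDeriv_sub_le f k n
  refine ⟨C, hC, fun y => SchwartzMap.seminorm_le_bound ℂ k n _ (by positivity) fun x => ?_⟩
  rw [iteratedFDeriv_compSubConstCLM]
  exact h x y

theorem continuous_compSubConstCLM {d : ℕ} (f : 𝓢(RD d, ℂ)) :
    Continuous fun y : RD d => f.compSubConstCLM ℂ y := by
  refine continuous_iff_continuousAt.2 fun y₀ => ?_
  refine ((schwartz_withSeminorms ℂ (RD d) ℂ).tendsto_nhds _ _).2 ?_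
  rintro ⟨k, n⟩ ε hε
  obtain ⟨C, hC, h⟩ := exists_norm_pow_mul_iteratedFDeriv_sub_le f k (n + 1)
  set K : ℝ := C * (1 + (‖y₀‖ + 1)) ^ k with hK
  have hK0 : 0 ≤ K := by positivity
  have hev : ∀ᶠ y in nhds y₀, ‖y - y₀‖ < min 1 (ε / (K + 1)) := by
    have : Tendsto (fun y => ‖y - y₀‖) (nhds y₀) (nhds 0) := by
      have h0 : Continuous fun y : RD d => ‖y - y₀‖ := by fun_prop
      simpa using h0.tendsto y₀
    exact this.eventually_lt_const (by positivity)
  filter_upwards [hev] with y hy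
  have hy1 : ‖y - y₀‖ < 1 := hy.trans_le (min_le_left _ _)
  have hy2 : ‖y - y₀‖ < ε / (K + 1) := hy.trans_le (min_le_right _ _)
  change SchwartzMap.seminorm ℂ k n _ < ε
  refine lt_of_le_of_lt (SchwartzMap.seminorm_le_bound ℂ k n _
    (M := K * ‖y - y₀‖) (by positivity) fun x => ?_) ?_
  · have e : iteratedFDeriv ℝ n (⇑(f.compSubConstCLM ℂ y - f.compSubConstCLM ℂ y₀)) x
        = iteratedFDeriv ℝ n f (x - y) - iteratedFDeriv ℝ n f (x - y₀) := by
      rw [← iteratedFDeriv_compSubConstCLM, ← iteratedFDeriv_compSubConstCLM]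
      exact iteratedFDeriv_sub_apply ((f.compSubConstCLM ℂ y).smooth n).contDiffAt
        ((f.compSubConstCLM ℂ y₀).smooth n).contDiffAt
    rw [e]
    have hd : ∀ z, HasFDerivAt (fun z => ‖x‖ ^ k • iteratedFDeriv ℝ n f (x - z))
        (‖x‖ ^ k • (fderiv ℝ (iteratedFDeriv ℝ n f) (x - z)).comp
          (-ContinuousLinearMap.id ℝ (RD d))) z := by
      intro z
      have h1 : HasFDerivAt (iteratedFDeriv ℝ n f) (fderiv ℝ (iteratedFDeriv ℝ n f) (x - z))
          (x - z) :=
        ((f.smooth (n + 1)).differentiable_iteratedFDeriv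
          (by exact_mod_cast Nat.lt_succ_self n) _).hasFDerivAt
      exact (h1.comp z ((hasFDerivAt_id z).const_sub x)).const_smul (‖x‖ ^ k)
    have := (convex_ball y₀ 1).norm_image_sub_le_of_norm_hasFDerivWithin_le (C := K)
      (fun z _ => (hd z).hasFDerivWithinAt) (fun z hz => ?_) (Metric.mem_ball_self one_pos)
      (mem_ball_iff_norm.2 hy1)
    · rwa [← smul_sub, norm_smul, norm_pow, norm_norm] at this
    · rw [norm_smul, norm_pow, norm_norm, ContinuousLinearMap.comp_neg,
        ContinuousLinearMap.comp_id, norm_neg, norm_fderiv_iteratedFDeriv]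
      refine (h x z).trans ?_
      have : ‖z‖ ≤ ‖y₀‖ + 1 := by
        have h1 : ‖z - y₀‖ < 1 := mem_ball_iff_norm.1 hz
        linarith [norm_le_norm_sub_add z y₀]
      rw [hK]
      gcongr
  · have h1 : (K + 1) * ‖y - y₀‖ < ε := by
      rwa [lt_div_iff₀ (by positivity), mul_comm] at hy2
    nlinarith [norm_nonneg (y - y₀)]

/-- The Schwartz function `x ↦ h (y - x)`. -/
def reflShift {d : ℕ} (h : 𝓢(RD d, ℂ)) (y : RD d) : 𝓢(RD d, ℂ) :=
  (SchwartzMap.compCLMOfContinuousLinearEquiv ℂ (ContinuousLinearEquiv.neg ℝ) h).compSubConstCLM ℂ y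

@[simp] theorem reflShift_apply {d : ℕ} (h : 𝓢(RD d, ℂ)) (y x : RD d) :
    reflShift h y x = h (y - x) := by
  simp [reflShift]

theorem continuous_reflShift {d : ℕ} (h : 𝓢(RD d, ℂ)) : Continuous (reflShift h) :=
  continuous_compSubConstCLM _

theorem fourierS_compSubConstCLM {d : ℕ} (h : 𝓢(RD d, ℂ)) (x ξ : RD d) :
    fourierS (h.compSubConstCLM ℂ x) ξ
      = Complex.exp (-(2 * Real.pi * Complex.I * ((⟪x, ξ⟫ : ℝ) : ℂ))) * fourierS h ξ := by
  rw [fourierS_apply, fourierS_apply, ← integral_const_mul]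
  refine Eq.trans ?_ (integral_sub_right_eq_self (μ := volume) _ x)
  refine integral_congr_ae (.of_forall fun v => ?_)
  simp only [SchwartzMap.compSubConstCLM_apply]
  rw [← mul_assoc, ← Complex.exp_add]
  congr 2
  rw [inner_sub_left]
  push_cast
  ring

theorem fourierS_mul_fourierS_apply {d : ℕ} {G h P : 𝓢(RD d, ℂ)}
    (hP : ∀ ξ, P ξ = G ξ * fourierS h ξ) (x : RD d) :
    fourierS P x = ∫ y, fourierS G y * h (y - x) := by
  have := integral_fourierS_mul (h.compSubConstCLM ℂ x) G
  simp only [fourierS_compSubConstCLM, SchwartzMap.compSubConstCLM_apply] at this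
  rw [fourierS_apply]
  simp only [hP]
  rw [integral_congr_ae (.of_forall fun y => mul_comm (fourierS G y) (h (y - x))), ← this]
  refine integral_congr_ae (.of_forall fun v => ?_)
  simp only [real_inner_comm]
  ring

theorem integrable_norm_mul_one_add_norm_pow {d : ℕ} (G : 𝓢(RD d, ℂ)) (k : ℕ) :
    Integrable fun y => ‖G y‖ * (1 + ‖y‖) ^ k := by
  obtain ⟨C, hC, h⟩ := exists_one_add_norm_pow_mul_iteratedFDeriv_le G (k + (d + 1)) 0
  have hr : (Module.finrank ℝ (RD d) : ℝ) < ((d + 1 : ℕ) : ℝ) := by simp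
  have hI := (integrable_one_add_norm (E := RD d) (μ := volume) hr).const_mul C
  refine hI.mono' (by fun_prop) (.of_forall fun y => ?_)
  have hy := h y
  rw [norm_iteratedFDeriv_zero] at hy
  have hpos : 0 < 1 + ‖y‖ := by positivity
  rw [Real.norm_of_nonneg (by positivity), Real.rpow_neg hpos.le, Real.rpow_natCast,
    ← div_eq_mul_inv, le_div_iff₀ (by positivity)]
  calc ‖G y‖ * (1 + ‖y‖) ^ k * (1 + ‖y‖) ^ (d + 1) = (1 + ‖y‖) ^ (k + (d + 1)) * ‖G y‖ := by
        rw [pow_add]; ring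
    _ ≤ C := hy

/-- If `P = G ĥ` then `u(P̂) = ∫ Ĝ(y) u(h(y - ·)) dy`. -/
theorem apply_fourierS_eq_integral {d : ℕ} (u : TD d) {G h P : 𝓢(RD d, ℂ)}
    (hP : ∀ ξ, P ξ = G ξ * fourierS h ξ) :
    u (fourierS P) = ∫ y, fourierS G y * u (reflShift h y) := by
  refine apply_eq_integral u (continuous_reflShift h) (fourierS G).continuous (fun k n => ?_)
    (fun n x => ?_)
  · obtain ⟨C, hC, hb⟩ := exists_seminorm_compSubConstCLM_le
      (SchwartzMap.compCLMOfContinuousLinearEquiv ℂ (ContinuousLinearEquiv.neg ℝ) h) k n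
    refine ((integrable_norm_mul_one_add_norm_pow (fourierS G) k).const_mul C).mono' ?_
      (.of_forall fun y => ?_)
    · have : Continuous fun y => SchwartzMap.seminorm ℂ k n (reflShift h y) :=
        ((schwartz_withSeminorms ℂ (RD d) ℂ).continuous_seminorm (k, n)).comp
          (continuous_reflShift h)
      exact ((fourierS G).continuous.norm.mul this).aestronglyMeasurable
    · rw [Real.norm_of_nonneg (by positivity)]
      calc _ ≤ ‖fourierS G y‖ * (C * (1 + ‖y‖) ^ k) := by gcongr; exact hb y
        _ = _ := by ring
  · set H : 𝓢(RD d, ℂ) :=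
      SchwartzMap.compCLMOfContinuousLinearEquiv ℂ (ContinuousLinearEquiv.neg ℝ) h with hH
    have e1 : ∀ (n : ℕ) (y x : RD d),
        iteratedFDeriv ℝ n (fun x => fourierS G y • reflShift h y x) x
          = fourierS G y • iteratedFDeriv ℝ n (reflShift h y) x := fun n y x =>
      iteratedFDeriv_const_smul_apply (a := fourierS G y) (f := reflShift h y)
        ((reflShift h y).smooth n).contDiffAt
    have e2 : ∀ (n : ℕ) (y x : RD d), iteratedFDeriv ℝ n (reflShift h y) x
        = iteratedFDeriv ℝ n H (x - y) := fun n y x => iteratedFDeriv_compSubConstCLM H y n x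
    have e0 : (⇑(fourierS P) : RD d → ℂ) = fun x => ∫ y, fourierS G y • reflShift h y x := by
      funext x
      rw [fourierS_mul_fourierS_apply hP]
      simp
    rw [e0, iteratedFDeriv_integral]
    · simp only [e1]
    · intro y
      exact ((reflShift h y).smooth').const_smul (fourierS G y)
    · intro n x
      simp only [e1, e2]
      refine Continuous.aestronglyMeasurable ?_
      exact (fourierS G).continuous.smul (((H.smooth n).continuous_iteratedFDeriv le_rfl).comp
        (continuous_const.sub continuous_id))
    · intro n x₀
      obtain ⟨C, hC, hb⟩ := exists_one_add_norm_pow_mul_iteratedFDeriv_le H 0 n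
      refine ⟨fun y => ‖fourierS G y‖ * C, (fourierS G).integrable.norm.mul_const C,
        .of_forall fun x y => ?_⟩
      rw [e1, e2, norm_smul]
      exact mul_le_mul_of_nonneg_left (by simpa using hb (x - y)) (norm_nonneg _)

/-! ### Littlewood–Paley kernels as Schwartz functions -/

theorem pairing_eq {d : ℕ} (u : TD d) {g : RD d → ℂ} (ψ : 𝓢(RD d, ℂ)) (h : ∀ x, ψ x = g x) :
    pairing u g = u ψ := by
  have hex : ∃ ψ : 𝓢(RD d, ℂ), ⇑ψ = g := ⟨ψ, funext h⟩
  rw [show _root_.pairing u g = u hex.choose from dif_pos hex]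
  congr 1
  exact DFunLike.coe_injective (hex.choose_spec.trans (funext h).symm)

/-- The `L¹`-normalized dilation `x ↦ 2^{kd} f(2^k x)`. -/
def dil {d : ℕ} (k : ℕ) (f : 𝓢(RD d, ℂ)) : 𝓢(RD d, ℂ) :=
  (((2:ℝ) ^ (k * d) : ℝ) : ℂ) • SchwartzMap.compCLMOfContinuousLinearEquiv ℂ
    (ContinuousLinearEquiv.smulLeft (Units.mk0 ((2:ℝ) ^ k) (by positivity))) f

theorem dil_apply {d : ℕ} (k : ℕ) (f : 𝓢(RD d, ℂ)) (x : RD d) :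
    dil k f x = (((2:ℝ) ^ (k * d) : ℝ) : ℂ) * f ((2:ℝ) ^ k • x) := rfl

theorem norm_dil_apply {d : ℕ} (k : ℕ) (f : 𝓢(RD d, ℂ)) (x : RD d) :
    ‖dil k f x‖ = (2:ℝ) ^ (k * d) * ‖f ((2:ℝ) ^ k • x)‖ := by
  rw [dil_apply, norm_mul, Complex.norm_of_nonneg (by positivity)]

theorem integral_dil_comp {d : ℕ} {E : Type*} [NormedAddCommGroup E] [NormedSpace ℝ E] (k : ℕ)
    (g : RD d → E) : ∫ x, (2:ℝ) ^ (k * d) • g ((2:ℝ) ^ k • x) = ∫ x, g x := by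
  rw [integral_smul, Measure.integral_comp_smul, smul_smul]
  have : (2:ℝ) ^ (k * d) * |(((2:ℝ) ^ k) ^ Module.finrank ℝ (RD d))⁻¹| = 1 := by
    rw [finrank_euclideanSpace_fin, abs_of_pos (by positivity), ← pow_mul]
    exact mul_inv_cancel₀ (by positivity)
  rw [this, one_smul]

theorem fourierS_dil {d : ℕ} (k : ℕ) (f : 𝓢(RD d, ℂ)) (ξ : RD d) :
    fourierS (dil k f) ξ = fourierS f (((2:ℝ) ^ k)⁻¹ • ξ) := by
  rw [fourierS_apply, fourierS_apply]
  refine Eq.trans ?_ (integral_dil_comp k _)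
  refine integral_congr_ae (.of_forall fun v => ?_)
  simp only [dil_apply, Complex.real_smul]
  rw [real_inner_smul_left, real_inner_smul_right, ← mul_assoc ((2:ℝ) ^ k),
    mul_inv_cancel₀ (by positivity), one_mul]
  ring

theorem fourierS_injective {d : ℕ} : Function.Injective (fourierS (d := d)) := by
  intro f g h
  have := congrArg (FourierTransformInv.fourierInv) h
  simpa [fourierS_eq] using this

/-- The profile of the `k`-th Littlewood–Paley kernel: `Φ` for `k = 0`, otherwise `φ`. -/
def LPprofile {d : ℕ} (D : LPData d) : ℕ → 𝓢(RD d, ℂ)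
  | 0 => D.Φ
  | _ + 1 => D.φ

/-- The `k`-th Littlewood–Paley kernel as a Schwartz function. -/
def LPS {d : ℕ} (D : LPData d) (k : ℕ) : 𝓢(RD d, ℂ) := dil k (LPprofile D k)

theorem LPS_apply {d : ℕ} (D : LPData d) (k : ℕ) (x : RD d) : LPS D k x = LPkernel D k x := by
  cases k <;> simp [LPS, LPprofile, LPkernel, dil_apply]

theorem fourierS_LPS {d : ℕ} (D : LPData d) (k : ℕ) (ξ : RD d) :
    fourierS (LPS D k) ξ = LPhat D k ξ := by
  cases k <;> simp [LPS, LPprofile, LPhat, fourierS_dil]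

theorem LPdist_eq {d : ℕ} (D : LPData d) (k : ℕ) (u : TD d) (x : RD d) :
    LPdist D k u x = u (reflShift (LPS D k) x) :=
  pairing_eq u _ fun y => by simp [LPS_apply]

theorem continuous_LPdist {d : ℕ} (D : LPData d) (k : ℕ) (u : TD d) :
    Continuous (LPdist D k u) := by
  have : LPdist D k u = fun x => u (reflShift (LPS D k) x) := funext (LPdist_eq D k u)
  rw [this]
  exact u.continuous.comp (continuous_reflShift _)

theorem exists_norm_LPdist_le {d : ℕ} (D : LPData d) (k : ℕ) (u : TD d) :
    ∃ C : ℝ, ∃ n : ℕ, 0 ≤ C ∧ ∀ x, ‖LPdist D k u x‖ ≤ C * (1 + ‖x‖) ^ n := by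
  obtain ⟨s, C, -, hs⟩ := Seminorm.bound_of_continuous
    (schwartz_withSeminorms ℂ (RD d) ℂ) ((normSeminorm ℂ ℂ).comp u.toLinearMap)
    (continuous_norm.comp u.continuous)
  choose B hB0 hB using exists_seminorm_compSubConstCLM_le
    (SchwartzMap.compCLMOfContinuousLinearEquiv ℂ (ContinuousLinearEquiv.neg ℝ) (LPS D k))
  let n := s.sup Prod.fst
  have hsum : 0 ≤ ∑ i ∈ s, B i.1 i.2 := Finset.sum_nonneg fun i _ => hB0 _ _
  refine ⟨C * ∑ i ∈ s, B i.1 i.2, n, mul_nonneg C.2 hsum, fun x => ?_⟩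
  rw [LPdist_eq]
  refine (hs _).trans ?_
  change (C : ℝ) * _ ≤ _
  rw [mul_assoc]
  refine mul_le_mul_of_nonneg_left (Seminorm.finset_sup_apply_le
    (mul_nonneg hsum (by positivity)) fun i hi => ?_) C.2
  refine (hB i.1 i.2 x).trans ?_
  refine mul_le_mul (Finset.single_le_sum (f := fun i : ℕ × ℕ => B i.1 i.2)
    (fun i _ => hB0 _ _) hi) ?_ (by positivity) hsum
  exact pow_le_pow_right₀ (by linarith [norm_nonneg x]) (Finset.le_sup (f := Prod.fst) hi)

/-! ### Fourier supports and telescoping -/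

theorem fourierS_φ_eq_zero {d : ℕ} (D : LPData d) {ξ : RD d} (h : ‖ξ‖ < 1 / 2 ∨ 2 < ‖ξ‖) :
    fourierS D.φ ξ = 0 := by
  by_contra h0
  have := D.supp_φ ξ h0
  rcases h with h | h <;> linarith [this.1, this.2]

theorem fourierS_φ_inv_two_pow_eq_zero {d : ℕ} (D : LPData d) {ξ : RD d} {k : ℕ}
    (h : 2 * ‖ξ‖ < 2 ^ k ∨ 2 * 2 ^ k < ‖ξ‖) : fourierS D.φ (((2:ℝ) ^ k)⁻¹ • ξ) = 0 := by
  apply fourierS_φ_eq_zero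
  rw [norm_smul, Real.norm_of_nonneg (by positivity), ← div_eq_inv_mul]
  have : (0:ℝ) < 2 ^ k := by positivity
  rcases h with h | h
  · left; rw [div_lt_iff₀ this]; linarith
  · right; rw [lt_div_iff₀ this]; linarith

theorem summable_fourierS_φ {d : ℕ} (D : LPData d) (ξ : RD d) (i : ℕ) :
    Summable fun k : ℕ => fourierS D.φ (((2:ℝ) ^ (k + i))⁻¹ • ξ) := by
  obtain ⟨N, hN⟩ := pow_unbounded_of_one_lt (2 * ‖ξ‖) (one_lt_two (α := ℝ))
  refine summable_of_ne_finset_zero (s := Finset.range N) fun k hk => ?_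
  refine fourierS_φ_inv_two_pow_eq_zero D (Or.inl (hN.trans_le ?_))
  exact pow_le_pow_right₀ one_le_two (by simp at hk; omega)

theorem fourierS_Φ_half {d : ℕ} (D : LPData d) (ξ : RD d) :
    fourierS D.Φ ((2:ℝ)⁻¹ • ξ) = fourierS D.Φ ξ + fourierS D.φ ((2:ℝ)⁻¹ • ξ) := by
  rw [D.Φ_def, D.Φ_def, (summable_fourierS_φ D ξ 1).tsum_eq_zero_add]
  have : ∀ k : ℕ, ((2:ℝ) ^ (k + 1))⁻¹ • (2:ℝ)⁻¹ • ξ = ((2:ℝ) ^ (k + 1 + 1))⁻¹ • ξ := fun k => by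
    rw [smul_smul, pow_succ _ (k + 1), mul_inv]
  simp only [this]
  simp
  ring

theorem sum_LPhat {d : ℕ} (D : LPData d) (n : ℕ) (ξ : RD d) :
    ∑ j ∈ Finset.range (n + 1), LPhat D j ξ = fourierS D.Φ (((2:ℝ) ^ n)⁻¹ • ξ) := by
  induction n with
  | zero => simp [LPhat]
  | succ n ih =>
    rw [Finset.sum_range_succ, ih, pow_succ, mul_inv, mul_comm, ← smul_smul, fourierS_Φ_half]
    simp only [LPhat, smul_smul, pow_succ, mul_inv]
    rw [mul_comm (2:ℝ)⁻¹]

theorem sum_LPkernel {d : ℕ} (D : LPData d) (n : ℕ) (x : RD d) :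
    ∑ j ∈ Finset.range (n + 1), LPkernel D j x = dil n D.Φ x := by
  have h : ∑ j ∈ Finset.range (n + 1), LPS D j = dil n D.Φ := by
    refine fourierS_injective ?_
    ext ξ
    have h1 : fourierS (∑ j ∈ Finset.range (n + 1), LPS D j) ξ
        = ∑ j ∈ Finset.range (n + 1), fourierS (LPS D j) ξ := by
      simp [fourierS, map_sum]
    rw [h1, fourierS_dil, ← sum_LPhat]
    simp only [fourierS_LPS]
  rw [← h, sum_apply]
  simp only [LPS_apply]

theorem fourierS_Φ_eq_zero {d : ℕ} (D : LPData d) {ξ : RD d} (h : 2 < ‖ξ‖) :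
    fourierS D.Φ ξ = 0 := by
  have hξ : ξ ≠ 0 := by
    rintro rfl
    simp only [norm_zero] at h
    linarith
  have hs := D.sum_φ ξ hξ
  have hinj : Function.Injective fun k : ℕ => ((k : ℤ) + 1) := fun a b hab => by simpa using hab
  rw [← hinj.hasSum_iff] at hs
  · rw [D.Φ_def, sub_eq_zero, ← hs.tsum_eq]
    refine tsum_congr fun k => ?_
    simp only [Function.comp]
    congr 2
  · intro k hk
    have hk0 : k ≤ 0 := by
      by_contra h0
      exact hk ⟨(k - 1).toNat, by simp; omega⟩
    refine fourierS_φ_eq_zero D (Or.inr ?_)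
    rw [norm_smul, Real.norm_of_nonneg (by positivity)]
    have : (1:ℝ) ≤ 2 ^ (-k) := one_le_zpow₀ one_le_two (by omega)
    nlinarith [norm_nonneg ξ]

theorem LPhat_eq_zero_of_lt {d : ℕ} (D : LPData d) {k : ℕ} {ξ : RD d} (h : 2 * 2 ^ k < ‖ξ‖) :
    LPhat D k ξ = 0 := by
  cases k with
  | zero => exact fourierS_Φ_eq_zero D (by simpa using h)
  | succ k => exact fourierS_φ_inv_two_pow_eq_zero D (Or.inr h)

theorem LPhat_eq_zero_of_gt {d : ℕ} (D : LPData d) {k : ℕ} (hk : k ≠ 0) {ξ : RD d}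
    (h : 2 * ‖ξ‖ < 2 ^ k) : LPhat D k ξ = 0 := by
  cases k with
  | zero => exact absurd rfl hk
  | succ k => exact fourierS_φ_inv_two_pow_eq_zero D (Or.inl h)

/-! ### Frequency cutoffs and kernel estimates -/

/-- A Schwartz cutoff equal to `1` near the support of the Fourier transform of `LPprofile D k`. -/
def cutoffProfile {d : ℕ} (D : LPData d) (k : ℕ) : 𝓢(RD d, ℂ) :=
  fourierS (dil 2 D.Φ) - if k = 0 then 0 else SchwartzMap.compCLMOfContinuousLinearEquiv ℂ
    (ContinuousLinearEquiv.smulLeft (Units.mk0 ((2:ℝ) ^ 3) (by positivity))) (fourierS D.Φ)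

/-- A Schwartz cutoff equal to `1` on the support of `LPhat D k`. -/
def cutoff {d : ℕ} (D : LPData d) (k : ℕ) : 𝓢(RD d, ℂ) :=
  SchwartzMap.compCLMOfContinuousLinearEquiv ℂ
    (ContinuousLinearEquiv.smulLeft (Units.mk0 ((2:ℝ) ^ k)⁻¹ (by positivity))) (cutoffProfile D k)

theorem cutoff_apply {d : ℕ} (D : LPData d) (k : ℕ) (ξ : RD d) :
    cutoff D k ξ = cutoffProfile D k (((2:ℝ) ^ k)⁻¹ • ξ) := rfl

theorem cutoffProfile_apply {d : ℕ} (D : LPData d) (k : ℕ) (ξ : RD d) :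
    cutoffProfile D k ξ = fourierS D.Φ (((2:ℝ) ^ 2)⁻¹ • ξ)
      - if k = 0 then 0 else fourierS D.Φ ((2:ℝ) ^ 3 • ξ) := by
  rw [cutoffProfile, sub_apply, fourierS_dil]
  split_ifs <;> rfl

theorem fourierS_Φ_eq_one {d : ℕ} (D : LPData d) {ξ : RD d} (h : ‖ξ‖ < 1) :
    fourierS D.Φ ξ = 1 := by
  rw [D.Φ_def]
  have : ∀ k : ℕ, fourierS D.φ (((2:ℝ) ^ (k + 1))⁻¹ • ξ) = 0 := fun k => by
    refine fourierS_φ_inv_two_pow_eq_zero D (Or.inl ?_)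
    have : (1:ℝ) ≤ 2 ^ k := one_le_pow₀ one_le_two
    rw [pow_succ]
    linarith
  simp [this]

theorem cutoffProfile_eq_one {d : ℕ} (D : LPData d) {k : ℕ} {ξ : RD d} (h1 : ‖ξ‖ < 4)
    (h2 : k ≠ 0 → 1 / 4 < ‖ξ‖) : cutoffProfile D k ξ = 1 := by
  rw [cutoffProfile_apply, fourierS_Φ_eq_one D]
  · split_ifs with hk
    · simp
    · rw [fourierS_Φ_eq_zero D, sub_zero]
      rw [norm_smul, Real.norm_of_nonneg (by positivity)]
      linarith [h2 hk]
  · rw [norm_smul, Real.norm_of_nonneg (by positivity)]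
    linarith

theorem tsupport_cutoffProfile_subset {d : ℕ} (D : LPData d) (k : ℕ) :
    tsupport (cutoffProfile D k) ⊆ {ξ | ‖ξ‖ ≤ 8 ∧ (k ≠ 0 → 1 / 8 ≤ ‖ξ‖)} := by
  refine closure_minimal (fun ξ hξ => ?_) ?_
  · rw [Function.mem_support, cutoffProfile_apply] at hξ
    constructor
    · by_contra! h
      rw [fourierS_Φ_eq_zero D, fourierS_Φ_eq_zero D] at hξ
      · simp at hξ
      · rw [norm_smul, Real.norm_of_nonneg (by positivity)]
        linarith
      · rw [norm_smul, Real.norm_of_nonneg (by positivity)]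
        linarith
    · intro hk
      by_contra! h
      rw [fourierS_Φ_eq_one D, fourierS_Φ_eq_one D] at hξ
      · simp [hk] at hξ
      · rw [norm_smul, Real.norm_of_nonneg (by positivity)]
        linarith
      · rw [norm_smul, Real.norm_of_nonneg (by positivity)]
        linarith
  · by_cases hk : k = 0
    · simpa [hk] using isClosed_le continuous_norm continuous_const
    · simp only [ne_eq, hk, not_false_eq_true, forall_const]
      exact (isClosed_le continuous_norm continuous_const).inter
        (isClosed_le continuous_const continuous_norm)

theorem cutoff_mul_LPhat {d : ℕ} (D : LPData d) (k : ℕ) (ξ : RD d) :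
    cutoff D k ξ * LPhat D k ξ = LPhat D k ξ := by
  have hpos : (0:ℝ) < 2 ^ k := by positivity
  by_cases h : LPhat D k ξ = 0
  · simp [h]
  rw [cutoff_apply, cutoffProfile_eq_one, one_mul]
  · rw [norm_smul, Real.norm_of_nonneg (by positivity), inv_mul_lt_iff₀ hpos]
    by_contra! h1
    exact h (LPhat_eq_zero_of_lt D (by linarith))
  · intro hk
    rw [norm_smul, Real.norm_of_nonneg (by positivity), lt_inv_mul_iff₀ hpos]
    by_contra! h1
    exact h (LPhat_eq_zero_of_gt D hk (by linarith))

theorem cutoff_eq_zero {d : ℕ} (D : LPData d) {k : ℕ} {ξ : RD d} (h : 8 * 2 ^ k < ‖ξ‖) :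
    cutoff D k ξ = 0 := by
  by_contra h0
  have : ‖((2:ℝ) ^ k)⁻¹ • ξ‖ ≤ 8 := (tsupport_cutoffProfile_subset D k (subset_tsupport _ h0)).1
  rw [norm_smul, Real.norm_of_nonneg (by positivity), inv_mul_le_iff₀ (by positivity)] at this
  linarith

theorem hasCompactSupport_cutoff {d : ℕ} (D : LPData d) (k : ℕ) :
    HasCompactSupport (cutoff D k) := by
  refine HasCompactSupport.intro (isCompact_closedBall (0 : RD d) (8 * 2 ^ k)) fun ξ hξ => ?_
  exact cutoff_eq_zero D (by simpa using hξ)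

theorem one_add_pow_le {t : ℝ} (ht : 0 ≤ t) (L : ℕ) : (1 + t) ^ L ≤ 2 ^ L * (1 + t ^ L) := by
  refine (add_pow_le zero_le_one ht L).trans ?_
  rw [one_pow]
  gcongr
  · exact one_le_two
  · omega

theorem exists_norm_fourierS_le (L : ℕ) : ∃ C : ℝ, 0 ≤ C ∧ ∀ (d : ℕ) (G : 𝓢(RD d, ℂ)) (y : RD d),
    (1 + ‖y‖) ^ L * ‖fourierS G y‖
      ≤ C * ∑ i ∈ Finset.range (L + 1), ∫ v, ‖iteratedFDeriv ℝ i G v‖ := by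
  refine ⟨2 ^ L * (1 + 2 ^ L), by positivity, fun d G y => ?_⟩
  set S := ∑ i ∈ Finset.range (L + 1), ∫ v, ‖iteratedFDeriv ℝ i G v‖ with hS
  have key : ∀ n ≤ L, ‖y‖ ^ n * ‖fourierS G y‖ ≤ 2 ^ n * S := by
    intro n hn
    have := Real.pow_mul_norm_iteratedFDeriv_fourier_le (K := ⊤) (N := ⊤) (G.smooth ⊤)
      (fun k n _ _ => G.integrable_pow_mul_iteratedFDeriv volume k n) (k := 0) (n := n)
      le_top le_top y
    rw [norm_iteratedFDeriv_zero, ← SchwartzMap.fourier_coe, ← fourierS_eq] at this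
    refine this.trans ?_
    simp only [pow_zero, one_mul, Nat.cast_zero, mul_zero, zero_add, Finset.range_one,
      Finset.singleton_product, Finset.sum_map, Function.Embedding.coeFn_mk]
    gcongr
    exact Finset.sum_le_sum_of_subset_of_nonneg (Finset.range_subset_range.2 (by omega))
      fun i _ _ => integral_nonneg fun v => norm_nonneg _
  have h0 := key 0 (Nat.zero_le _)
  have h1 := key L le_rfl
  calc (1 + ‖y‖) ^ L * ‖fourierS G y‖ ≤ 2 ^ L * (1 + ‖y‖ ^ L) * ‖fourierS G y‖ := by
        gcongr
        exact one_add_pow_le (norm_nonneg y) L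
    _ = 2 ^ L * (‖y‖ ^ 0 * ‖fourierS G y‖ + ‖y‖ ^ L * ‖fourierS G y‖) := by ring
    _ ≤ 2 ^ L * (2 ^ 0 * S + 2 ^ L * S) := by gcongr
    _ = _ := by ring

theorem one_add_two_pow_mul_rpow_le (k : ℕ) {t r : ℝ} (ht : 0 ≤ t) (h8 : t ≤ 8)
    (hk : k ≠ 0 → 1 / 8 ≤ t) : (1 + 2 ^ k * t) ^ r ≤ (9:ℝ) ^ |r| * (2:ℝ) ^ (k * r) := by
  have hpos : (1:ℝ) ≤ 2 ^ k := one_le_pow₀ one_le_two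
  have hup : 1 + 2 ^ k * t ≤ 9 * 2 ^ k := by nlinarith
  have hlo : 2 ^ k / 9 ≤ 1 + 2 ^ k * t := by
    by_cases h : k = 0
    · subst h
      norm_num
      linarith
    · nlinarith [hk h]
  rw [Real.rpow_mul zero_le_two, Real.rpow_natCast]
  rcases le_total 0 r with hr | hr
  · rw [abs_of_nonneg hr, ← Real.mul_rpow (by norm_num) (by positivity)]
    exact Real.rpow_le_rpow (by positivity) hup hr
  · rw [abs_of_nonpos hr]
    refine (Real.rpow_le_rpow_of_nonpos (by positivity) hlo hr).trans_eq ?_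
    rw [Real.div_rpow (by positivity) (by norm_num), Real.rpow_neg (by norm_num)]
    field_simp

/-- Kernel bound for a symbol localized to frequencies of size `2^k`. -/
theorem exists_norm_fourierS_mul_cutoff_le {d : ℕ} (D : LPData d) (m : ℝ) (L : ℕ) :
    ∃ C : ℝ, 0 ≤ C ∧ ∀ (k : ℕ) (b : RD d → ℂ) (B : ℝ), ContDiff ℝ ∞ b → 0 ≤ B →
      (∀ α ≤ L, ∀ ξ, ‖iteratedFDeriv ℝ α b ξ‖ ≤ B * (1 + ‖ξ‖) ^ (m - α)) →
      ∀ P : 𝓢(RD d, ℂ), (∀ ξ, P ξ = b ξ * cutoff D k ξ) →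
      ∀ y, (1 + 2 ^ k * ‖y‖) ^ L * ‖fourierS P y‖ ≤ C * B * 2 ^ (k * m) * 2 ^ (k * d) := by
  obtain ⟨C, hC, hF⟩ := exists_norm_fourierS_le L
  let I : ℕ → ℝ := fun k => ∑ n ∈ Finset.range (L + 1), ∑ i ∈ Finset.range (n + 1),
    (n.choose i : ℝ) * ∫ v, ‖iteratedFDeriv ℝ (n - i) (cutoffProfile D k) v‖
  have hI : ∀ k, 0 ≤ I k := fun k => Finset.sum_nonneg fun n _ => Finset.sum_nonneg fun i _ =>
    mul_nonneg (Nat.cast_nonneg _) (integral_nonneg fun _ => norm_nonneg _)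
  have hI1 : ∀ k, I k ≤ I 0 + I 1 := fun k => by
    cases k with
    | zero => linarith [hI 1]
    | succ k =>
      have : I (k + 1) = I 1 := rfl
      linarith [hI 0]
  refine ⟨C * ((9:ℝ) ^ (|m| + L) * (I 0 + I 1)), by have := hI 0; have := hI 1; positivity,
    fun k b B hb hB hbd P hP y => ?_⟩
  have e1 : fourierS P y = fourierS (dil k P) ((2:ℝ) ^ k • y) := by
    rw [fourierS_dil, inv_smul_smul₀ (by positivity)]
  have e2 : ‖(2:ℝ) ^ k • y‖ = 2 ^ k * ‖y‖ := by
    rw [norm_smul, Real.norm_of_nonneg (by positivity)]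
  have h := hF d (dil k P) ((2:ℝ) ^ k • y)
  rw [← e1, e2] at h
  refine h.trans ?_
  set c : ℝ := (9:ℝ) ^ (|m| + L) * (B * 2 ^ (k * m) * 2 ^ (k * d)) with hc
  have hc0 : 0 ≤ c := by positivity
  have e3 : (⇑(dil k P) : RD d → ℂ) = fun ξ => (((2:ℝ) ^ (k * d) : ℝ) : ℂ) •
      (b ((2:ℝ) ^ k • ξ) * cutoffProfile D k ξ) := by
    funext ξ
    rw [dil_apply, hP, cutoff_apply, inv_smul_smul₀ (by positivity), smul_eq_mul]
  have hbs : ContDiff ℝ ∞ fun ξ => b ((2:ℝ) ^ k • ξ) := hb.comp (contDiff_const_smul _)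
  have hθ : ContDiff ℝ ∞ (⇑(cutoffProfile D k)) := (cutoffProfile D k).smooth'
  have hpt : ∀ n ≤ L, ∀ ξ, ‖iteratedFDeriv ℝ n (dil k P) ξ‖ ≤ c * ∑ i ∈ Finset.range (n + 1),
      (n.choose i : ℝ) * ‖iteratedFDeriv ℝ (n - i) (cutoffProfile D k) ξ‖ := by
    intro n hn ξ
    have hn' : ((n : ℕ) : WithTop ℕ∞) ≤ ((⊤ : ℕ∞) : WithTop ℕ∞) := by exact_mod_cast le_top
    have hsm : ContDiff ℝ n fun ξ => b ((2:ℝ) ^ k • ξ) * cutoffProfile D k ξ :=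
      (hbs.mul hθ).of_le hn'
    rw [e3, iteratedFDeriv_const_smul_apply' hsm.contDiffAt, norm_smul, Complex.norm_of_nonneg (by positivity)]
    refine (mul_le_mul_of_nonneg_left (norm_iteratedFDeriv_mul_le hbs hθ ξ hn') (by positivity)).trans ?_
    rw [Finset.mul_sum, Finset.mul_sum]
    refine Finset.sum_le_sum fun i hi => ?_
    have hin : i ≤ n := by simp at hi; omega
    by_cases h0 : iteratedFDeriv ℝ (n - i) (cutoffProfile D k) ξ = 0
    · simp [h0]
    have hξ := tsupport_cutoffProfile_subset D k (support_iteratedFDeriv_subset (𝕜 := ℝ) _ h0)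
    have e4 : ‖iteratedFDeriv ℝ i (fun ξ => b ((2:ℝ) ^ k • ξ)) ξ‖
        ≤ 9 ^ (|m| + L) * (B * 2 ^ (k * m)) := by
      rw [iteratedFDeriv_comp_const_smul _ (hb.of_le (by exact_mod_cast le_top)), norm_smul,
        norm_pow, Real.norm_of_nonneg (by positivity)]
      refine (mul_le_mul_of_nonneg_left (hbd i (hin.trans hn) _) (by positivity)).trans ?_
      rw [norm_smul, Real.norm_of_nonneg (by positivity)]
      have h9 : (9:ℝ) ^ |m - i| ≤ 9 ^ (|m| + L) := by
        refine Real.rpow_le_rpow_of_exponent_le (by norm_num) ((abs_sub _ _).trans ?_)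
        rw [Nat.abs_cast]
        have : (i : ℝ) ≤ L := by exact_mod_cast hin.trans hn
        linarith
      calc ((2:ℝ) ^ k) ^ i * (B * (1 + 2 ^ k * ‖ξ‖) ^ (m - i))
          ≤ ((2:ℝ) ^ k) ^ i * (B * (9 ^ (|m| + L) * 2 ^ (k * (m - i)))) := by
            gcongr
            refine (one_add_two_pow_mul_rpow_le k (norm_nonneg ξ) hξ.1 hξ.2).trans ?_
            gcongr
        _ = 9 ^ (|m| + L) * (B * ((2:ℝ) ^ (((k * i : ℕ)) : ℝ) * 2 ^ (k * (m - i)))) := by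
            rw [Real.rpow_natCast, pow_mul]; ring
        _ = _ := by
            rw [← Real.rpow_add two_pos]
            congr 4
            push_cast
            ring
    calc (2:ℝ) ^ (k * d) * ((n.choose i : ℝ) * ‖iteratedFDeriv ℝ i (fun ξ => b ((2:ℝ) ^ k • ξ)) ξ‖ *
          ‖iteratedFDeriv ℝ (n - i) (cutoffProfile D k) ξ‖)
        ≤ (2:ℝ) ^ (k * d) * ((n.choose i : ℝ) * (9 ^ (|m| + L) * (B * 2 ^ (k * m))) *
          ‖iteratedFDeriv ℝ (n - i) (cutoffProfile D k) ξ‖) := by gcongr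
      _ = _ := by rw [hc]; ring
  have hintg : ∀ n, Integrable fun ξ => ‖iteratedFDeriv ℝ n (cutoffProfile D k) ξ‖ := fun n => by
    simpa using (cutoffProfile D k).integrable_pow_mul_iteratedFDeriv volume 0 n
  have hsum : ∑ n ∈ Finset.range (L + 1), ∫ v, ‖iteratedFDeriv ℝ n (dil k P) v‖ ≤ c * I k := by
    rw [Finset.mul_sum]
    refine Finset.sum_le_sum fun n hn => ?_
    calc ∫ v, ‖iteratedFDeriv ℝ n (dil k P) v‖
        ≤ ∫ v, c * ∑ i ∈ Finset.range (n + 1),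
          (n.choose i : ℝ) * ‖iteratedFDeriv ℝ (n - i) (cutoffProfile D k) v‖ := by
          refine integral_mono_of_nonneg (.of_forall fun v => norm_nonneg _) ?_
            (.of_forall fun v => hpt n (by simp at hn; omega) v)
          exact (integrable_finsetSum _ fun i _ => (hintg _).const_mul _).const_mul _
      _ = _ := by
          rw [integral_const_mul, integral_finsetSum _ fun i _ => (hintg _).const_mul _]
          simp only [integral_const_mul]
  calc C * ∑ n ∈ Finset.range (L + 1), ∫ v, ‖iteratedFDeriv ℝ n (dil k P) v‖
      ≤ C * (c * I k) := by gcongr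
    _ ≤ C * (c * (I 0 + I 1)) := by gcongr; exact hI1 k
    _ = _ := by rw [hc]; ring

/-! ### Frequency-localized pieces as integrals of Littlewood–Paley pieces -/

/-- A smooth function times the cutoff, as a Schwartz function. -/
theorem exists_schwartz_mul_cutoff {d : ℕ} (D : LPData d) (k : ℕ) {b : RD d → ℂ}
    (hb : ContDiff ℝ ∞ b) : ∃ P : 𝓢(RD d, ℂ), ∀ ξ, P ξ = b ξ * cutoff D k ξ :=
  ⟨HasCompactSupport.toSchwartzMap (f := fun ξ => b ξ * cutoff D k ξ)
    (hasCompactSupport_cutoff D k).mul_left (hb.mul (cutoff D k).smooth'), fun _ => rfl⟩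

theorem contDiff_character {d : ℕ} (x : RD d) :
    ContDiff ℝ ∞ fun ξ : RD d => Complex.exp (2 * Real.pi * Complex.I * ((⟪x, ξ⟫ : ℝ) : ℂ)) := by
  refine ContDiff.cexp (contDiff_const.mul ?_)
  exact Complex.ofRealCLM.contDiff.comp (contDiff_const.inner ℝ contDiff_id)

theorem norm_character {d : ℕ} (x ξ : RD d) :
    ‖Complex.exp (2 * Real.pi * Complex.I * ((⟪x, ξ⟫ : ℝ) : ℂ))‖ = 1 := by
  have : (2 * Real.pi * Complex.I * ((⟪x, ξ⟫ : ℝ) : ℂ))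
      = ((2 * Real.pi * ⟪x, ξ⟫ : ℝ) : ℂ) * Complex.I := by push_cast; ring
  rw [this, Complex.norm_exp_ofReal_mul_I]

/-- Pairing `û` with `b φ̂_k e^{2πi⟨x,·⟩}` is integration of the kernel of `b` against `Π_k u`. -/
theorem pairing_fourierTD_eq_integral {d : ℕ} (D : LPData d) (k : ℕ) {b : RD d → ℂ}
    (hb : ContDiff ℝ ∞ b) {P : 𝓢(RD d, ℂ)} (hP : ∀ ξ, P ξ = b ξ * cutoff D k ξ) (u : TD d)
    (x : RD d) :
    pairing (fourierTD u) (fun ξ => b ξ * LPhat D k ξ *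
        Complex.exp (2 * Real.pi * Complex.I * ((⟪x, ξ⟫ : ℝ) : ℂ)))
      = ∫ y, fourierS P (y - x) * LPdist D k u y := by
  obtain ⟨G, hG⟩ := exists_schwartz_mul_cutoff D k (hb.mul (contDiff_character x))
  obtain ⟨Q, hQ⟩ : ∃ Q : 𝓢(RD d, ℂ), ∀ ξ, Q ξ = G ξ * fourierS (LPS D k) ξ :=
    ⟨HasCompactSupport.toSchwartzMap (f := fun ξ => (b ξ *
        Complex.exp (2 * Real.pi * Complex.I * ((⟪x, ξ⟫ : ℝ) : ℂ)) * cutoff D k ξ) *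
          fourierS (LPS D k) ξ) (hasCompactSupport_cutoff D k).mul_left.mul_right
        (((hb.mul (contDiff_character x)).mul (cutoff D k).smooth').mul
          (fourierS (LPS D k)).smooth'), fun ξ => by rw [hG]; rfl⟩
  rw [pairing_eq (fourierTD u) Q]
  · refine (apply_fourierS_eq_integral u hQ).trans
      (integral_congr_ae (.of_forall fun y => ?_))
    simp only [LPdist_eq]
    congr 1
    rw [fourierS_apply, fourierS_apply]
    refine integral_congr_ae (.of_forall fun v => ?_)
    simp only [hG, hP]
    rw [real_inner_comm v x, inner_sub_right]
    have : Complex.exp (-(2 * Real.pi * Complex.I * ((⟪v, y⟫ - ⟪v, x⟫ : ℝ) : ℂ)))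
        = Complex.exp (-(2 * Real.pi * Complex.I * ((⟪v, y⟫ : ℝ) : ℂ))) *
          Complex.exp (2 * Real.pi * Complex.I * ((⟪v, x⟫ : ℝ) : ℂ)) := by
      rw [← Complex.exp_add]
      congr 1
      push_cast
      ring
    rw [this]
    ring
  · intro ξ
    rw [hQ, hG, fourierS_LPS]
    calc _ = b ξ * (cutoff D k ξ * LPhat D k ξ) *
          Complex.exp (2 * Real.pi * Complex.I * ((⟪x, ξ⟫ : ℝ) : ℂ)) := by ring
      _ = _ := by rw [cutoff_mul_LPhat]

theorem enorm_le_etaKernel {d : ℕ} {k L : ℕ} {y : RD d} {z : ℂ} {B : ℝ} (hB : 0 ≤ B)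
    (h : (1 + 2 ^ k * ‖y‖) ^ L * ‖z‖ ≤ B * 2 ^ (k * d)) :
    ‖z‖ₑ ≤ ENNReal.ofReal B * etaKernel k L y := by
  have hpos : 0 < 1 + 2 ^ k * ‖y‖ := by positivity
  have e : etaKernel (d := d) k L y
      = ENNReal.ofReal (2 ^ (k * d) * ((1 + 2 ^ k * ‖y‖) ^ L)⁻¹) := by
    rw [etaKernel, scaleWeight, ENNReal.ofReal_mul (by positivity), ENNReal.ofReal_rpow_of_pos hpos,
      Real.rpow_neg hpos.le, Real.rpow_natCast, ENNReal.ofReal_pow zero_le_two]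
    simp
  rw [e, ← ENNReal.ofReal_mul hB, ← ofReal_norm]
  refine ENNReal.ofReal_le_ofReal ?_
  rw [← mul_assoc, ← div_eq_mul_inv, le_div_iff₀ (by positivity)]
  linarith

/-- Pointwise bound for a frequency-localized piece with symbol `b`. -/
theorem exists_enorm_pairing_le {d : ℕ} (D : LPData d) (m : ℝ) (L : ℕ) :
    ∃ C : ℝ≥0∞, C ≠ ⊤ ∧ ∀ (k : ℕ) (b : RD d → ℂ) (B : ℝ), ContDiff ℝ ∞ b → 0 ≤ B →
      (∀ α ≤ L, ∀ ξ, ‖iteratedFDeriv ℝ α b ξ‖ ≤ B * (1 + ‖ξ‖) ^ (m - α)) → ∀ (u : TD d) (x : RD d),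
      ‖pairing (fourierTD u) (fun ξ => b ξ * LPhat D k ξ *
        Complex.exp (2 * Real.pi * Complex.I * ((⟪x, ξ⟫ : ℝ) : ℂ)))‖ₑ
      ≤ C * ENNReal.ofReal B * 2 ^ (k * m) *
        lconvol (etaKernel k L) (fun y => ‖LPdist D k u y‖ₑ) x := by
  obtain ⟨C, hC, h⟩ := exists_norm_fourierS_mul_cutoff_le D m L
  refine ⟨ENNReal.ofReal C, ENNReal.ofReal_ne_top, fun k b B hb hB hbd u x => ?_⟩
  obtain ⟨P, hP⟩ := exists_schwartz_mul_cutoff D k hb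
  rw [pairing_fourierTD_eq_integral D k hb hP]
  refine (enorm_integral_le_lintegral_enorm _).trans ?_
  have e : ENNReal.ofReal C * ENNReal.ofReal B * 2 ^ (k * m) = ENNReal.ofReal (C * B * 2 ^ (k * m)) := by
    rw [ENNReal.ofReal_mul (by positivity), ENNReal.ofReal_mul hC,
      ← ENNReal.ofReal_rpow_of_pos two_pos]
    simp
  rw [e, lconvol, ← lintegral_const_mul' _ _ ENNReal.ofReal_ne_top]
  refine lintegral_mono fun y => ?_
  rw [enorm_mul, ← mul_assoc]
  refine mul_le_mul_left (enorm_le_etaKernel (by positivity) ?_) _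
  rw [norm_sub_rev x y]
  exact h k b B hb hB hbd P hP (y - x)

theorem fourierInv_reflShift_LPS {d : ℕ} (D : LPData d) (k : ℕ) (x ξ : RD d) :
    (FourierTransformInv.fourierInv (reflShift (LPS D k) x) : 𝓢(RD d, ℂ)) ξ = LPhat D k ξ *
        Complex.exp (2 * Real.pi * Complex.I * ((⟪x, ξ⟫ : ℝ) : ℂ)) := by
  rw [SchwartzMap.fourierInv_coe, Real.fourierInv_eq', ← fourierS_LPS, fourierS_apply,
    ← integral_mul_const]
  refine Eq.trans ?_ (integral_sub_left_eq_self (μ := volume) _ x)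
  refine integral_congr_ae (.of_forall fun v => ?_)
  simp only [smul_eq_mul, reflShift_apply]
  rw [mul_right_comm (Complex.exp (-_)), ← Complex.exp_add]
  congr 2
  rw [inner_sub_left]
  push_cast
  ring

theorem LPdist_eq_pairing {d : ℕ} (D : LPData d) (k : ℕ) (u : TD d) (x : RD d) :
    LPdist D k u x = pairing (fourierTD u) (fun ξ => 1 * LPhat D k ξ *
        Complex.exp (2 * Real.pi * Complex.I * ((⟪x, ξ⟫ : ℝ) : ℂ))) := by
  rw [pairing_eq (fourierTD u) (FourierTransformInv.fourierInv (reflShift (LPS D k) x)), LPdist_eq]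
  · change _ = u (fourierS _)
    rw [fourierS_eq]
    simp
  · intro ξ
    rw [one_mul, fourierInv_reflShift_LPS]

/-- The reproducing inequality for Littlewood–Paley pieces. -/
theorem exists_enorm_LPdist_le {d : ℕ} (D : LPData d) (L : ℝ) :
    ∃ C : ℝ≥0∞, C ≠ ⊤ ∧ ∀ (k : ℕ) (u : TD d) (x : RD d), ‖LPdist D k u x‖ₑ
      ≤ C * lconvol (etaKernel k L) (fun y => ‖LPdist D k u y‖ₑ) x := by
  obtain ⟨C, hC, h⟩ := exists_enorm_pairing_le D 0 ⌈L⌉₊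
  refine ⟨C, hC, fun k u x => ?_⟩
  rw [LPdist_eq_pairing]
  refine (h k (fun _ => 1) 1 contDiff_const zero_le_one (fun α _ ξ => ?_) u x).trans ?_
  · rcases eq_or_ne α 0 with rfl | hα
    · simp
    · rw [iteratedFDeriv_const_of_ne hα]
      simp only [Pi.zero_apply, norm_zero]
      positivity
  · simp only [ENNReal.ofReal_one, mul_one, mul_zero, ENNReal.rpow_zero]
    exact mul_le_mul_right ((lconvol_mono (etaKernel_anti k (Nat.le_ceil L)) fun _ => le_rfl) x) _

/-! ### Symbols mollified in the space variable -/

/-- Partial derivatives of all orders of a jointly smooth function are jointly smooth. -/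
theorem contDiff_iteratedFDeriv_partial {E F G : Type*} [NormedAddCommGroup E] [NormedSpace ℝ E]
    [NormedAddCommGroup F] [NormedSpace ℝ F] [NormedAddCommGroup G] [NormedSpace ℝ G]
    {f : E → F → G} (hf : ContDiff ℝ ∞ (Function.uncurry f)) (n : ℕ) :
    ContDiff ℝ ∞ fun p : E × F => iteratedFDeriv ℝ n (f p.1) p.2 := by
  induction n with
  | zero =>
    exact (continuousMultilinearCurryFin0 ℝ F G).symm.contDiff.comp hf
  | succ n ih =>
    refine (continuousMultilinearCurryLeftEquiv ℝ (fun _ : Fin (n + 1) => F) G).symm.contDiff.comp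
      (ContDiff.fderiv (n := ∞) (m := ∞) (f := fun p : E × F => iteratedFDeriv ℝ n (f p.1)) ?_
        contDiff_snd (by simp))
    exact ih.comp ((contDiff_fst.comp contDiff_fst).prodMk contDiff_snd)

theorem norm_iteratedFDeriv_clm_comp_le {E F G : Type*} [NormedAddCommGroup E] [NormedSpace ℝ E]
    [NormedAddCommGroup F] [NormedSpace ℝ F] [NormedAddCommGroup G] [NormedSpace ℝ G]
    (J : F →L[ℝ] G) {f : E → F} (hf : ContDiff ℝ ∞ f) (n : ℕ) (x : E) :
    ‖iteratedFDeriv ℝ n (fun y => J (f y)) x‖ ≤ ‖J‖ * ‖iteratedFDeriv ℝ n f x‖ := by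
  have := J.iteratedFDeriv_comp_left (hf.contDiffAt (x := x)) (i := n) (by exact_mod_cast le_top)
  rw [show (fun y => J (f y)) = J ∘ f from rfl, this]
  exact J.norm_compContinuousMultilinearMap_le _

namespace IsSymbolS11

variable {d : ℕ} {m : ℝ} {a : RD d → RD d → ℂ}

theorem contDiff_left (ha : IsSymbolS11 d m a) (ξ : RD d) : ContDiff ℝ ∞ fun x => a x ξ :=
  ha.1.comp (contDiff_id.prodMk contDiff_const)

theorem contDiff_right (ha : IsSymbolS11 d m a) (x : RD d) : ContDiff ℝ ∞ (a x) :=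
  ha.1.comp (contDiff_const.prodMk contDiff_id)

theorem contDiff_iteratedFDeriv_left (ha : IsSymbolS11 d m a) (n : ℕ) :
    ContDiff ℝ ∞ fun p : RD d × RD d => iteratedFDeriv ℝ n (fun x' => a x' p.2) p.1 :=
  (contDiff_iteratedFDeriv_partial (f := fun ξ x => a x ξ)
    (ha.1.comp (contDiff_snd.prodMk contDiff_fst)) n).comp (contDiff_snd.prodMk contDiff_fst)

theorem contDiff_iteratedFDeriv_right (ha : IsSymbolS11 d m a) (n : ℕ) :
    ContDiff ℝ ∞ fun p : RD d × RD d => iteratedFDeriv ℝ n (a p.1) p.2 :=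
  contDiff_iteratedFDeriv_partial (f := a) ha.1 n

/-- Space derivatives raise the order of a symbol by one. -/
theorem fderiv_left (ha : IsSymbolS11 d m a) (v : RD d) :
    IsSymbolS11 d (m + 1) fun x ξ => fderiv ℝ (fun x' => a x' ξ) x v := by
  refine ⟨?_, fun α β => ?_⟩
  · refine ContDiff.clm_apply ?_ contDiff_const
    exact ContDiff.fderiv (m := ∞) (f := fun (p : RD d × RD d) x' => a x' p.2)
      (ha.1.comp (contDiff_snd.prodMk (contDiff_snd.comp contDiff_fst))) contDiff_fst le_rfl
  · obtain ⟨c, hc⟩ := ha.2 α (β + 1)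
    let J : (RD d [×β + 1]→L[ℝ] ℂ) →L[ℝ] (RD d [×β]→L[ℝ] ℂ) :=
      (ContinuousLinearMap.compContinuousMultilinearMapL ℝ (fun _ : Fin β => RD d)
        (RD d →L[ℝ] ℂ) ℂ (ContinuousLinearMap.apply ℝ ℂ v)).comp
        (continuousMultilinearCurryRightEquiv' ℝ β (RD d) ℂ).toContinuousLinearEquiv.toContinuousLinearMap
    refine ⟨‖J‖ * c, fun x ξ => ?_⟩
    have e : (fun ξ' => iteratedFDeriv ℝ β (fun x' => fderiv ℝ (fun x'' => a x'' ξ') x' v) x)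
        = fun ξ' => J (iteratedFDeriv ℝ (β + 1) (fun x' => a x' ξ') x) := by
      funext ξ'
      have h1 : ContDiff ℝ ∞ fun y => fderiv ℝ (fun x' => a x' ξ') y :=
        (ha.contDiff_left ξ').fderiv_right (m := ∞) (by simp)
      have := (ContinuousLinearMap.apply ℝ ℂ v).iteratedFDeriv_comp_left
        (h1.contDiffAt (x := x)) (i := β) (by exact_mod_cast le_top)
      refine Eq.trans this ?_
      rw [iteratedFDeriv_succ_eq_comp_right]
      exact congrArg (ContinuousLinearMap.compContinuousMultilinearMapL ℝ (fun _ : Fin β => RD d)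
        (RD d →L[ℝ] ℂ) ℂ (ContinuousLinearMap.apply ℝ ℂ v))
        ((continuousMultilinearCurryRightEquiv' ℝ β (RD d) ℂ).apply_symm_apply _).symm
    rw [e]
    refine (norm_iteratedFDeriv_clm_comp_le J ((ha.contDiff_iteratedFDeriv_left (β + 1)).comp
      (contDiff_const.prodMk contDiff_id)) α ξ).trans ?_
    rw [mul_assoc]
    refine mul_le_mul_of_nonneg_left ((hc x ξ).trans_eq ?_) (norm_nonneg _)
    push_cast
    ring_nf

/-- Pointwise bounds for the frequency derivatives of a symbol. -/
theorem exists_norm_iteratedFDeriv_right_le (ha : IsSymbolS11 d m a) (α : ℕ) :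
    ∃ c : ℝ, 0 ≤ c ∧ ∀ x ξ, ‖iteratedFDeriv ℝ α (a x) ξ‖ ≤ c * (1 + ‖ξ‖) ^ (m - α) := by
  obtain ⟨c, hc⟩ := ha.2 α 0
  refine ⟨c, ?_, fun x ξ => ?_⟩
  · have := (norm_nonneg _).trans (hc 0 0)
    simpa using this
  · have e : (fun ξ' => iteratedFDeriv ℝ 0 (fun x' => a x' ξ') x)
        = (continuousMultilinearCurryFin0 ℝ (RD d) ℂ).symm ∘ a x := by
      funext ξ'
      ext
      simp
    have := hc x ξ
    rw [e, LinearIsometryEquiv.norm_iteratedFDeriv_comp_left] at this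
    simpa using this

theorem exists_norm_le (ha : IsSymbolS11 d m a) (ξ : RD d) : ∃ c : ℝ, ∀ x, ‖a x ξ‖ ≤ c := by
  obtain ⟨c, -, hc⟩ := ha.exists_norm_iteratedFDeriv_right_le 0
  refine ⟨c * (1 + ‖ξ‖) ^ m, fun x => ?_⟩
  simpa using hc x ξ

end IsSymbolS11

/-- The symbol `a` convolved with `h` in the space variable. -/
def smear {d : ℕ} (h : 𝓢(RD d, ℂ)) (a : RD d → RD d → ℂ) (x ξ : RD d) : ℂ :=
  ∫ y, h y * a (x - y) ξ

theorem integral_norm_dil {d : ℕ} (k : ℕ) (f : 𝓢(RD d, ℂ)) : ∫ x, ‖dil k f x‖ = ∫ x, ‖f x‖ := by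
  refine Eq.trans ?_ (integral_dil_comp k _)
  exact integral_congr_ae (.of_forall fun x => norm_dil_apply k f x)

theorem eventually_one_add_norm_rpow_le {d : ℕ} (r : ℝ) (ξ₀ : RD d) :
    ∃ C : ℝ, ∀ᶠ ξ in nhds ξ₀, (1 + ‖ξ‖) ^ r ≤ C := by
  have hc : ContinuousAt (fun ξ : RD d => (1 + ‖ξ‖) ^ r) ξ₀ :=
    ((continuous_const.add continuous_norm).continuousAt).rpow_const
      (Or.inl (show 1 + ‖ξ₀‖ ≠ 0 by positivity))
  refine ⟨(1 + ‖ξ₀‖) ^ r + 1, (hc.eventually (gt_mem_nhds (lt_add_one _))).mono fun ξ h => h.le⟩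

namespace IsSymbolS11

variable {d : ℕ} {m : ℝ} {a : RD d → RD d → ℂ}

theorem iteratedFDeriv_const_mul_right (ha : IsSymbolS11 d m a) (z : ℂ) (x ξ : RD d) (n : ℕ) :
    iteratedFDeriv ℝ n (fun ξ => z * a x ξ) ξ = z • iteratedFDeriv ℝ n (a x) ξ :=
  iteratedFDeriv_const_smul_apply (a := z) ((ha.contDiff_right x).contDiffAt.of_le
    (by exact_mod_cast le_top))

theorem continuous_iteratedFDeriv_sub (ha : IsSymbolS11 d m a) (x ξ : RD d) (n : ℕ) :
    Continuous fun y => iteratedFDeriv ℝ n (a (x - y)) ξ :=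
  (ha.contDiff_iteratedFDeriv_right n).continuous.comp
    ((continuous_const.sub continuous_id).prodMk continuous_const)

theorem aestronglyMeasurable_smear (ha : IsSymbolS11 d m a) (h : 𝓢(RD d, ℂ)) (x : RD d)
    (n : ℕ) (ξ : RD d) : AEStronglyMeasurable
      (fun y => iteratedFDeriv ℝ n (fun ξ => h y * a (x - y) ξ) ξ) volume := by
  simp_rw [ha.iteratedFDeriv_const_mul_right]
  exact (h.continuous.smul (ha.continuous_iteratedFDeriv_sub x ξ n)).aestronglyMeasurable

theorem exists_integrable_smear (ha : IsSymbolS11 d m a) (h : 𝓢(RD d, ℂ)) (x : RD d)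
    (n : ℕ) (ξ₀ : RD d) : ∃ b : RD d → ℝ, Integrable b ∧ ∀ᶠ ξ in nhds ξ₀, ∀ y,
      ‖iteratedFDeriv ℝ n (fun ξ => h y * a (x - y) ξ) ξ‖ ≤ b y := by
  obtain ⟨c, hc0, hc⟩ := ha.exists_norm_iteratedFDeriv_right_le n
  obtain ⟨C, hC⟩ := eventually_one_add_norm_rpow_le (m - n) ξ₀
  refine ⟨fun y => ‖h y‖ * (c * C), h.integrable.norm.mul_const _, hC.mono fun ξ hξ y => ?_⟩
  rw [ha.iteratedFDeriv_const_mul_right, norm_smul]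
  exact mul_le_mul_of_nonneg_left ((hc _ _).trans (mul_le_mul_of_nonneg_left hξ hc0))
    (norm_nonneg _)

theorem contDiff_smear (ha : IsSymbolS11 d m a) (h : 𝓢(RD d, ℂ)) (x : RD d) :
    ContDiff ℝ ∞ (smear h a x) :=
  contDiff_integral (f := fun y ξ => h y * a (x - y) ξ)
    (fun _ => contDiff_const.mul (ha.contDiff_right _)) (ha.aestronglyMeasurable_smear h x)
    (ha.exists_integrable_smear h x)

theorem exists_norm_iteratedFDeriv_smear_le (ha : IsSymbolS11 d m a) (α : ℕ) :
    ∃ c : ℝ, 0 ≤ c ∧ ∀ (h : 𝓢(RD d, ℂ)) x ξ,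
      ‖iteratedFDeriv ℝ α (smear h a x) ξ‖ ≤ c * (∫ y, ‖h y‖) * (1 + ‖ξ‖) ^ (m - α) := by
  obtain ⟨c, hc0, hc⟩ := ha.exists_norm_iteratedFDeriv_right_le α
  refine ⟨c, hc0, fun h x ξ => ?_⟩
  rw [show smear h a x = fun ξ => ∫ y, h y * a (x - y) ξ from rfl,
    iteratedFDeriv_integral (f := fun y ξ => h y * a (x - y) ξ)
    (fun _ => contDiff_const.mul (ha.contDiff_right _)) (ha.aestronglyMeasurable_smear h x)
    (ha.exists_integrable_smear h x)]
  rw [mul_right_comm, mul_comm, ← integral_mul_const]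
  refine norm_integral_le_of_norm_le (h.integrable.norm.mul_const _) (.of_forall fun y => ?_)
  rw [ha.iteratedFDeriv_const_mul_right, norm_smul]
  exact mul_le_mul_of_nonneg_left (hc _ _) (norm_nonneg _)

end IsSymbolS11

/-- A Schwartz function with Fourier support in an annulus is a sum of first derivatives of
functions of the same kind. -/
theorem exists_eq_sum_fderiv {d : ℕ} {h : 𝓢(RD d, ℂ)}
    (hh : ∀ ξ, fourierS h ξ ≠ 0 → 1 / 2 ≤ ‖ξ‖ ∧ ‖ξ‖ ≤ 2) :
    ∃ g : Fin d → 𝓢(RD d, ℂ), (∀ i ξ, fourierS (g i) ξ ≠ 0 → 1 / 2 ≤ ‖ξ‖ ∧ ‖ξ‖ ≤ 2) ∧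
      ∀ x, h x = ∑ i, fderiv ℝ (g i) x (EuclideanSpace.single i 1) := by
  have hsm : ∀ i : Fin d, ContDiff ℝ ∞ fun ξ : RD d =>
      fourierS h ξ * (((ξ i / ‖ξ‖ ^ 2 : ℝ) : ℂ) / (2 * Real.pi * Complex.I)) := by
    intro i
    refine contDiff_iff_contDiffAt.2 fun ξ => ?_
    by_cases hξ : ξ = 0
    · subst hξ
      refine (contDiffAt_const (c := (0:ℂ))).congr_of_eventuallyEq ?_
      filter_upwards [Metric.ball_mem_nhds (0 : RD d) (by norm_num : (0:ℝ) < 1 / 2)] with η hη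
      have : fourierS h η = 0 := by
        by_contra hne
        exact absurd (hh η hne).1 (not_le.2 (by simpa using hη))
      simp [this]
    · refine (fourierS h).smooth'.contDiffAt.mul ?_
      refine ContDiffAt.div_const ?_ _
      refine Complex.ofRealCLM.contDiff.contDiffAt.comp ξ ?_
      refine ContDiffAt.div ?_ (contDiff_norm_sq ℝ).contDiffAt (by simpa using hξ)
      exact (EuclideanSpace.proj (𝕜 := ℝ) i).contDiff.contDiffAt
  have hcs : HasCompactSupport (fourierS h) := by
    refine HasCompactSupport.intro (isCompact_closedBall (0 : RD d) 2) fun ξ hξ => ?_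
    by_contra hne
    exact hξ (by simpa using (hh ξ hne).2)
  let G : Fin d → 𝓢(RD d, ℂ) := fun i => HasCompactSupport.toSchwartzMap hcs.mul_right (hsm i)
  have hG : ∀ i ξ, G i ξ = fourierS h ξ * (((ξ i / ‖ξ‖ ^ 2 : ℝ) : ℂ) / (2 * Real.pi * Complex.I)) :=
    fun _ _ => rfl
  have hF : ∀ i, fourierS (FourierTransformInv.fourierInv (G i)) = G i := fun i => by
    simp [fourierS_eq]
  refine ⟨fun i => FourierTransformInv.fourierInv (G i), fun i ξ hne => ?_, ?_⟩
  · rw [hF, hG] at hne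
    exact hh ξ (left_ne_zero_of_mul hne)
  · have key : h = ∑ i, LineDeriv.lineDerivOp (EuclideanSpace.single i (1:ℝ) : RD d)
        (FourierTransformInv.fourierInv (G i)) := by
      apply fourierS_injective
      ext ξ
      have hsum : fourierS (∑ i, LineDeriv.lineDerivOp (EuclideanSpace.single i (1:ℝ) : RD d)
          (FourierTransformInv.fourierInv (G i))) = ∑ i, fourierS (LineDeriv.lineDerivOp
            (EuclideanSpace.single i (1:ℝ) : RD d) (FourierTransformInv.fourierInv (G i))) :=
        map_sum (SchwartzMap.fourierTransformCLM ℂ) _ _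
      have hterm : ∀ i, fourierS (LineDeriv.lineDerivOp
            (EuclideanSpace.single i (1:ℝ) : RD d) (FourierTransformInv.fourierInv (G i))) ξ
          = 2 * Real.pi * Complex.I * (ξ i * G i ξ) := by
        intro i
        rw [fourierS_eq, SchwartzMap.fourier_lineDerivOp_eq, ← fourierS_eq, hF]
        have : (fun y : RD d => (inner ℝ y (EuclideanSpace.single i (1:ℝ) : RD d))).HasTemperateGrowth := by
          fun_prop
        rw [smul_apply, SchwartzMap.smulLeftCLM_apply_apply this]
        simp only [EuclideanSpace.inner_single_right]
        simp
      rw [hsum, sum_apply]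
      simp_rw [hterm, hG]
      by_cases hne : fourierS h ξ = 0
      · simp [hne]
      have h0 : ‖ξ‖ ^ 2 ≠ 0 := by
        have := (hh ξ hne).1
        positivity
      have hpi : (2 * Real.pi * Complex.I : ℂ) ≠ 0 := by simp [Real.pi_ne_zero]
      have : ∀ i, 2 * Real.pi * Complex.I * ((ξ i : ℂ) * (fourierS h ξ *
          (((ξ i / ‖ξ‖ ^ 2 : ℝ) : ℂ) / (2 * Real.pi * Complex.I))))
          = fourierS h ξ * ((ξ i ^ 2 / ‖ξ‖ ^ 2 : ℝ) : ℂ) := by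
        intro i
        push_cast
        field_simp
      simp_rw [this]
      rw [← Finset.mul_sum, ← Complex.ofReal_sum, ← Finset.sum_div]
      have : ∑ i, ξ i ^ 2 = ‖ξ‖ ^ 2 := by
        rw [EuclideanSpace.norm_sq_eq]
        simp
      rw [this, div_self h0]
      simp
    intro x
    conv_lhs => rw [key]
    rw [sum_apply]
    rfl

theorem fderiv_dil {d : ℕ} (k : ℕ) (f : 𝓢(RD d, ℂ)) (x v : RD d) :
    fderiv ℝ (dil k f) x v = (((2:ℝ) ^ (k * d) : ℝ) : ℂ) * ((2:ℂ) ^ k * fderiv ℝ f ((2:ℝ) ^ k • x) v) := by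
  have h1 : HasFDerivAt (fun x : RD d => (2:ℝ) ^ k • x)
      ((2:ℝ) ^ k • ContinuousLinearMap.id ℝ (RD d)) x :=
    (hasFDerivAt_id x).const_smul ((2:ℝ) ^ k)
  have h2 : HasFDerivAt f (fderiv ℝ f ((2:ℝ) ^ k • x)) ((2:ℝ) ^ k • x) :=
    f.differentiableAt.hasFDerivAt
  have h3 := (h2.comp x h1).const_mul (((2:ℝ) ^ (k * d) : ℝ) : ℂ)
  have h4 : HasFDerivAt (dil k f) _ x := h3
  rw [h4.fderiv]
  simp

/-- Moving one derivative from the dilated kernel to the function. -/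
theorem integral_dil_mul_eq {d : ℕ} {h : 𝓢(RD d, ℂ)} {g : Fin d → 𝓢(RD d, ℂ)}
    (hg : ∀ x, h x = ∑ i, fderiv ℝ (g i) x (EuclideanSpace.single i 1)) (j : ℕ)
    {c : RD d → ℂ} (hc : ContDiff ℝ ∞ c) {B : ℝ} (hB : ∀ x, ‖c x‖ ≤ B) {B' : ℝ}
    (hB' : ∀ i x, ‖fderiv ℝ c x (EuclideanSpace.single i 1)‖ ≤ B') (x : RD d) :
    ∫ y, dil j h y * c (x - y) = ((2:ℂ) ^ j)⁻¹ * ∑ i,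
      ∫ y, dil j (g i) y * fderiv ℝ c (x - y) (EuclideanSpace.single i 1) := by
  have hcx : ContDiff ℝ ∞ fun y => c (x - y) := hc.comp (contDiff_const.sub contDiff_id)
  have hd : ∀ y v, fderiv ℝ (fun y => c (x - y)) y v = - fderiv ℝ c (x - y) v := by
    intro y v
    have h1 : HasFDerivAt (fun y : RD d => x - y) (-ContinuousLinearMap.id ℝ (RD d)) y := by
      simpa using (hasFDerivAt_id y).const_sub x
    have h2 : HasFDerivAt c (fderiv ℝ c (x - y)) (x - y) :=
      (hc.differentiable (by simp)).differentiableAt.hasFDerivAt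
    have h3 : HasFDerivAt (fun y => c (x - y)) _ y := h2.comp y h1
    rw [h3.fderiv]
    simp
  have hdc : ∀ v, Continuous fun y => fderiv ℝ c (x - y) v := fun v =>
    ((hc.continuous_fderiv (by simp)).comp (continuous_const.sub continuous_id)).clm_apply
      continuous_const
  have hpt : ∀ y, dil j h y = ∑ i, ((2:ℂ) ^ j)⁻¹ *
      LineDeriv.lineDerivOp (EuclideanSpace.single i (1:ℝ) : RD d) (dil j (g i)) y := by
    intro y
    simp only [SchwartzMap.lineDerivOp_apply_eq_fderiv, fderiv_dil]
    rw [dil_apply, hg, Finset.mul_sum]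
    refine Finset.sum_congr rfl fun i _ => ?_
    field_simp
  have hintg : ∀ f : 𝓢(RD d, ℂ), Integrable fun y => f y * c (x - y) := fun f =>
    f.integrable.mul_bdd (c := B) hcx.continuous.aestronglyMeasurable (.of_forall fun y => hB _)
  simp_rw [hpt, Finset.sum_mul, mul_assoc]
  rw [integral_finsetSum _ fun i _ => (hintg _).const_mul _, Finset.mul_sum]
  refine Finset.sum_congr rfl fun i _ => ?_
  rw [integral_const_mul]
  congr 1
  have hpart := integral_mul_fderiv_eq_neg_fderiv_mul_of_integrable (μ := (volume : Measure (RD d)))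
    (f := dil j (g i)) (g := fun y => c (x - y)) (v := EuclideanSpace.single i 1)
    (hintg (LineDeriv.lineDerivOp (EuclideanSpace.single i (1:ℝ) : RD d) (dil j (g i)))) ?_
    (hintg _) (fun y _ => (dil j (g i)).differentiableAt)
    (fun y _ => (hcx.differentiable (by simp)).differentiableAt)
  · simp_rw [hd, mul_neg, integral_neg] at hpart
    exact (neg_injective hpart).symm
  · simp_rw [hd, mul_neg]
    exact ((dil j (g i)).integrable.mul_bdd (c := B') (hdc _).aestronglyMeasurable
      (.of_forall fun y => hB' _ _)).neg

/-- Convolving a symbol with a dilated annular kernel gains arbitrary negative powers of the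
dilation, at the expense of the order. -/
theorem IsSymbolS11.exists_norm_iteratedFDeriv_smear_dil_le {d : ℕ} (N α : ℕ) :
    ∀ {m : ℝ} {a : RD d → RD d → ℂ}, IsSymbolS11 d m a → ∀ {h : 𝓢(RD d, ℂ)},
      (∀ ξ, fourierS h ξ ≠ 0 → 1 / 2 ≤ ‖ξ‖ ∧ ‖ξ‖ ≤ 2) →
      ∃ c : ℝ, 0 ≤ c ∧ ∀ (j : ℕ) x ξ, ‖iteratedFDeriv ℝ α (smear (dil j h) a x) ξ‖
        ≤ c * ((2:ℝ) ^ (N * j))⁻¹ * (1 + ‖ξ‖) ^ (m + N - α) := by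
  induction N with
  | zero =>
    intro m a ha h _
    obtain ⟨c, hc0, hc⟩ := ha.exists_norm_iteratedFDeriv_smear_le α
    refine ⟨c * ∫ y, ‖h y‖, mul_nonneg hc0 (integral_nonneg fun _ => norm_nonneg _),
      fun j x ξ => ?_⟩
    have := hc (dil j h) x ξ
    rw [integral_norm_dil] at this
    simpa using this
  | succ N ih =>
    intro m a ha h hh
    obtain ⟨g, hgs, hg⟩ := exists_eq_sum_fderiv hh
    choose c hc0 hc using fun i => ih (ha.fderiv_left (EuclideanSpace.single i 1)) (hgs i)
    refine ⟨∑ i, c i, Finset.sum_nonneg fun i _ => hc0 i, fun j x ξ => ?_⟩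
    have e : smear (dil j h) a x = fun ξ => ∑ i, ((2:ℂ) ^ j)⁻¹ • smear (dil j (g i))
        (fun x ξ => fderiv ℝ (fun x' => a x' ξ) x (EuclideanSpace.single i 1)) x ξ := by
      funext ξ
      obtain ⟨B, hB⟩ := ha.exists_norm_le ξ
      choose B' hB' using fun i : Fin d =>
        (ha.fderiv_left (EuclideanSpace.single i 1)).exists_norm_le ξ
      rw [← Finset.smul_sum, smul_eq_mul]
      exact integral_dil_mul_eq hg j (ha.contDiff_left ξ) hB (B' := ∑ i, |B' i|)
        (fun i x => (hB' i x).trans ((le_abs_self _).trans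
          (Finset.single_le_sum (f := fun i => |B' i|) (fun i _ => abs_nonneg _)
            (Finset.mem_univ i)))) x
    have hsm : ∀ i, ContDiff ℝ ∞ (smear (dil j (g i))
        (fun x ξ => fderiv ℝ (fun x' => a x' ξ) x (EuclideanSpace.single i 1)) x) := fun i =>
      (ha.fderiv_left _).contDiff_smear _ _
    have hsm' : ∀ i ∈ Finset.univ, ContDiffAt ℝ α (fun ξ => ((2:ℂ) ^ j)⁻¹ • smear (dil j (g i))
        (fun x ξ => fderiv ℝ (fun x' => a x' ξ) x (EuclideanSpace.single i 1)) x ξ) ξ := fun i _ =>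
      ((hsm i).const_smul (((2:ℂ) ^ j)⁻¹)).contDiffAt.of_le (by exact_mod_cast le_top)
    rw [e, iteratedFDeriv_fun_sum_apply hsm', Finset.sum_mul, Finset.sum_mul]
    refine (norm_sum_le _ _).trans (Finset.sum_le_sum fun i _ => ?_)
    have hα : ContDiffAt ℝ α (smear (dil j (g i))
        (fun x ξ => fderiv ℝ (fun x' => a x' ξ) x (EuclideanSpace.single i 1)) x) ξ :=
      (hsm i).contDiffAt.of_le (by exact_mod_cast le_top)
    have := iteratedFDeriv_const_smul_apply (a := ((2:ℂ) ^ j)⁻¹) hα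
    rw [show (fun ξ => ((2:ℂ) ^ j)⁻¹ • smear (dil j (g i)) (fun x ξ => fderiv ℝ
      (fun x' => a x' ξ) x (EuclideanSpace.single i 1)) x ξ) = ((2:ℂ) ^ j)⁻¹ • smear (dil j (g i))
      (fun x ξ => fderiv ℝ (fun x' => a x' ξ) x (EuclideanSpace.single i 1)) x from rfl, this,
      norm_smul]
    refine (mul_le_mul_of_nonneg_left (hc i j x ξ) (norm_nonneg _)).trans_eq ?_
    rw [norm_inv, norm_pow, Complex.norm_ofNat, add_mul, pow_add, one_mul, mul_inv]
    push_cast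
    rw [show m + 1 + N - α = m + (N + 1) - (α:ℝ) by ring]
    ring

/-! ### Blocks of the paradifferential decomposition -/

/-- The operator with symbol `(h * a)(x, ξ) φ̂_k(ξ)` applied to `u`. -/
def smearPiece {d : ℕ} (D : LPData d) (a : RD d → RD d → ℂ) (h : 𝓢(RD d, ℂ)) (k : ℕ) (u : TD d)
    (x : RD d) : ℂ :=
  pairing (fourierTD u) (fun ξ => smear h a x ξ * LPhat D k ξ *
    Complex.exp (2 * Real.pi * Complex.I * ((⟪x, ξ⟫ : ℝ) : ℂ)))

theorem pdoPieceD_eq {d : ℕ} (D : LPData d) (a : RD d → RD d → ℂ) (j k : ℕ) (u : TD d) (x : RD d) :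
    pdoPieceD D a j k u x = smearPiece D a (LPS D j) k u x := by
  simp only [pdoPieceD, smearPiece, symbolPiece, smear, LPS_apply]

/-- The `n`-th block: the part of the double sum over `max j k = n`. -/
def block {d : ℕ} (D : LPData d) (a : RD d → RD d → ℂ) (n : ℕ) (u : TD d) (x : RD d) : ℂ :=
  ∑ k ∈ Finset.range n, smearPiece D a (LPS D n) k u x + smearPiece D a (dil n D.Φ) n u x

theorem exists_schwartz_mul_LPhat {d : ℕ} (D : LPData d) (k : ℕ) {b : RD d → ℂ}
    (hb : ContDiff ℝ ∞ b) (x : RD d) : ∃ P : 𝓢(RD d, ℂ), ∀ ξ, P ξ = b ξ * LPhat D k ξ *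
      Complex.exp (2 * Real.pi * Complex.I * ((⟪x, ξ⟫ : ℝ) : ℂ)) := by
  refine ⟨HasCompactSupport.toSchwartzMap (f := fun ξ => b ξ * (cutoff D k ξ *
    fourierS (LPS D k) ξ) * Complex.exp (2 * Real.pi * Complex.I * ((⟪x, ξ⟫ : ℝ) : ℂ)))
    (hasCompactSupport_cutoff D k).mul_right.mul_left.mul_right
    ((hb.mul ((cutoff D k).smooth'.mul (fourierS (LPS D k)).smooth')).mul (contDiff_character x)),
    fun ξ => ?_⟩
  rw [← cutoff_mul_LPhat, ← fourierS_LPS]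
  rfl

theorem dil_succ_Φ {d : ℕ} (D : LPData d) (n : ℕ) :
    dil (n + 1) D.Φ = dil n D.Φ + LPS D (n + 1) := by
  ext x
  rw [add_apply, ← sum_LPkernel, ← sum_LPkernel, Finset.sum_range_succ, LPS_apply]

namespace IsSymbolS11

variable {d : ℕ} {m : ℝ} {a : RD d → RD d → ℂ}

theorem integrable_smear (ha : IsSymbolS11 d m a) (h : 𝓢(RD d, ℂ)) (x ξ : RD d) :
    Integrable fun y => h y * a (x - y) ξ := by
  obtain ⟨c, hc⟩ := ha.exists_norm_le ξ
  exact h.integrable.mul_bdd (c := c) ((ha.contDiff_left ξ).continuous.comp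
    (continuous_const.sub continuous_id)).aestronglyMeasurable (.of_forall fun y => hc _)

theorem smear_add (ha : IsSymbolS11 d m a) (h h' : 𝓢(RD d, ℂ)) (x ξ : RD d) :
    smear (h + h') a x ξ = smear h a x ξ + smear h' a x ξ := by
  rw [smear, smear, smear, ← integral_add (ha.integrable_smear h x ξ) (ha.integrable_smear h' x ξ)]
  simp_rw [add_apply, add_mul]

theorem smearPiece_add (ha : IsSymbolS11 d m a) (D : LPData d) (h h' : 𝓢(RD d, ℂ)) (k : ℕ)
    (u : TD d) (x : RD d) :
    smearPiece D a (h + h') k u x = smearPiece D a h k u x + smearPiece D a h' k u x := by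
  obtain ⟨P, hP⟩ := exists_schwartz_mul_LPhat D k (ha.contDiff_smear h x) x
  obtain ⟨P', hP'⟩ := exists_schwartz_mul_LPhat D k (ha.contDiff_smear h' x) x
  rw [smearPiece, smearPiece, smearPiece, pairing_eq _ P hP, pairing_eq _ P' hP',
    pairing_eq _ (P + P'), map_add]
  intro ξ
  rw [add_apply, hP, hP', ha.smear_add]
  ring

theorem sum_pdoPieceD (ha : IsSymbolS11 d m a) (D : LPData d) (n k : ℕ) (u : TD d) (x : RD d) :
    ∑ j ∈ Finset.range (n + 1), pdoPieceD D a j k u x = smearPiece D a (dil n D.Φ) k u x := by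
  induction n with
  | zero =>
    rw [zero_add, Finset.sum_range_one, pdoPieceD_eq]
    rfl
  | succ n ih => rw [Finset.sum_range_succ, ih, dil_succ_Φ, ha.smearPiece_add, pdoPieceD_eq]

theorem pdoPartial_eq (ha : IsSymbolS11 d m a) (D : LPData d) (n : ℕ) (u : TD d) (x : RD d) :
    pdoPartial D a n u x = ∑ k ∈ Finset.range (n + 1), smearPiece D a (dil n D.Φ) k u x := by
  rw [pdoPartial, Finset.sum_comm]
  exact Finset.sum_congr rfl fun k _ => ha.sum_pdoPieceD D n k u x

theorem pdoPartial_eq_sum_block (ha : IsSymbolS11 d m a) (D : LPData d) (n : ℕ) (u : TD d)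
    (x : RD d) : pdoPartial D a n u x = ∑ i ∈ Finset.range (n + 1), block D a i u x := by
  induction n with
  | zero => simp [ha.pdoPartial_eq, block]
  | succ n ih =>
    rw [Finset.sum_range_succ, ← ih, ha.pdoPartial_eq, ha.pdoPartial_eq, Finset.sum_range_succ,
      block, ← add_assoc, ← Finset.sum_add_distrib]
    congr 1
    refine Finset.sum_congr rfl fun k _ => ?_
    rw [dil_succ_Φ, ha.smearPiece_add]

theorem exists_enorm_smearPiece_LPS_le (ha : IsSymbolS11 d m a) (D : LPData d) (N L : ℕ) :
    ∃ C : ℝ≥0∞, C ≠ ⊤ ∧ ∀ (n k : ℕ) (u : TD d) x, k < n → ‖smearPiece D a (LPS D n) k u x‖ₑ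
      ≤ C * 2 ^ (k * m) * (2 ^ (N * (n - k)))⁻¹ *
        lconvol (etaKernel k L) (fun y => ‖LPdist D k u y‖ₑ) x := by
  obtain ⟨C, hC, h⟩ := exists_enorm_pairing_le D (m + N) L
  choose c hc0 hc using fun α => exists_norm_iteratedFDeriv_smear_dil_le N α ha D.supp_φ
  set S := ∑ α ∈ Finset.range (L + 1), c α with hS
  have hS0 : 0 ≤ S := Finset.sum_nonneg fun α _ => hc0 α
  refine ⟨C * ENNReal.ofReal S, ENNReal.mul_ne_top hC ENNReal.ofReal_ne_top,
    fun n k u x hkn => ?_⟩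
  have hn : LPS D n = dil n D.φ := by
    cases n with
    | zero => exact absurd hkn (Nat.not_lt_zero _)
    | succ n => rfl
  refine (h k (smear (LPS D n) a x) (S * ((2:ℝ) ^ (N * n))⁻¹) (ha.contDiff_smear _ _)
    (by positivity) (fun α hα ξ => ?_) u x).trans_eq ?_
  · rw [hn]
    refine (hc α n x ξ).trans ?_
    gcongr
    exact Finset.single_le_sum (f := c) (fun α _ => hc0 α)
      (Finset.mem_range.2 (Nat.lt_succ_of_le hα))
  · congr 1
    rw [ENNReal.ofReal_mul hS0, ← mul_assoc, mul_assoc (C * ENNReal.ofReal S),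
      mul_assoc (C * ENNReal.ofReal S)]
    congr 1
    rw [ENNReal.ofReal_inv_of_pos (by positivity), ENNReal.ofReal_pow zero_le_two,
      ENNReal.ofReal_ofNat, ← ENNReal.rpow_natCast, ← ENNReal.rpow_natCast, ← ENNReal.rpow_neg,
      ← ENNReal.rpow_neg, ← two_rpow_add, ← two_rpow_add]
    congr 1
    push_cast [Nat.cast_sub hkn.le]
    ring

theorem exists_enorm_smearPiece_Φ_le (ha : IsSymbolS11 d m a) (D : LPData d) (L : ℕ) :
    ∃ C : ℝ≥0∞, C ≠ ⊤ ∧ ∀ (n k : ℕ) (u : TD d) x, ‖smearPiece D a (dil n D.Φ) k u x‖ₑ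
      ≤ C * 2 ^ (k * m) * lconvol (etaKernel k L) (fun y => ‖LPdist D k u y‖ₑ) x := by
  obtain ⟨C, hC, h⟩ := exists_enorm_pairing_le D m L
  choose c hc0 hc using fun α => ha.exists_norm_iteratedFDeriv_smear_le α
  have hI : 0 ≤ ∫ y, ‖D.Φ y‖ := integral_nonneg fun _ => norm_nonneg _
  set S := ∑ α ∈ Finset.range (L + 1), c α with hS
  have hS0 : 0 ≤ S := Finset.sum_nonneg fun α _ => hc0 α
  refine ⟨C * ENNReal.ofReal (S * ∫ y, ‖D.Φ y‖), ENNReal.mul_ne_top hC ENNReal.ofReal_ne_top,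
    fun n k u x => h k (smear (dil n D.Φ) a x) (S * ∫ y, ‖D.Φ y‖) (ha.contDiff_smear _ _)
    (by positivity) (fun α hα ξ => ?_) u x⟩
  refine (hc α _ x ξ).trans ?_
  rw [integral_norm_dil]
  gcongr
  exact Finset.single_le_sum (f := c) (fun α _ => hc0 α)
    (Finset.mem_range.2 (Nat.lt_succ_of_le hα))

theorem exists_enorm_block_le (ha : IsSymbolS11 d m a) (D : LPData d) (N L : ℕ) :
    ∃ C : ℝ≥0∞, C ≠ ⊤ ∧ ∀ (n : ℕ) (u : TD d) x, ‖block D a n u x‖ₑ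
      ≤ C * ∑ k ∈ Finset.range (n + 1), 2 ^ (k * m) * (2 ^ (N * (n - k)))⁻¹ *
        lconvol (etaKernel k L) (fun y => ‖LPdist D k u y‖ₑ) x := by
  obtain ⟨C, hC, h⟩ := ha.exists_enorm_smearPiece_LPS_le D N L
  obtain ⟨C', hC', h'⟩ := ha.exists_enorm_smearPiece_Φ_le D L
  refine ⟨C + C', ENNReal.add_ne_top.2 ⟨hC, hC'⟩, fun n u x => ?_⟩
  rw [Finset.sum_range_succ, mul_add]
  refine (enorm_add_le _ _).trans (add_le_add ((enorm_sum_le _ _).trans ?_) ?_)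
  · rw [Finset.mul_sum]
    refine Finset.sum_le_sum fun k hk => (h n k u x (Finset.mem_range.1 hk)).trans ?_
    rw [mul_assoc C, mul_assoc C]
    exact mul_le_mul_left le_self_add _
  · refine (h' n n u x).trans ?_
    rw [Nat.sub_self, mul_zero, pow_zero, inv_one, mul_one, mul_assoc]
    exact mul_le_mul_left le_add_self _

end IsSymbolS11

/-! ### Integral kernels of the pieces -/

/-- The kernel of the operator with symbol `(h * a)(x, ξ) φ̂_k(ξ)` relative to `Π_k u`. -/
def pieceKernel {d : ℕ} (D : LPData d) (a : RD d → RD d → ℂ) (h : 𝓢(RD d, ℂ)) (k : ℕ)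
    (x y : RD d) : ℂ :=
  ∫ v, Complex.exp (-(2 * Real.pi * Complex.I * ((⟪v, y⟫ : ℝ) : ℂ))) *
    (smear h a x v * cutoff D k v)

theorem pieceKernel_eq {d : ℕ} {D : LPData d} {a : RD d → RD d → ℂ} {h P : 𝓢(RD d, ℂ)} {k : ℕ}
    {x : RD d} (hP : ∀ v, P v = smear h a x v * cutoff D k v) (y : RD d) :
    pieceKernel D a h k x y = fourierS P y := by
  simp only [fourierS_apply, hP, pieceKernel]

theorem norm_cexp_neg_inner {d : ℕ} (x ξ : RD d) :
    ‖Complex.exp (-(2 * Real.pi * Complex.I * ((⟪x, ξ⟫ : ℝ) : ℂ)))‖ = 1 := by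
  rw [show -(2 * Real.pi * Complex.I * ((⟪x, ξ⟫ : ℝ) : ℂ))
    = ((-(2 * Real.pi * ⟪x, ξ⟫) : ℝ) : ℂ) * Complex.I by push_cast; ring]
  exact Complex.norm_exp_ofReal_mul_I _

theorem integrable_one_add_norm_rpow_mul_cutoff {d : ℕ} (D : LPData d) (k : ℕ) (m : ℝ) :
    Integrable fun v : RD d => (1 + ‖v‖) ^ m * ‖cutoff D k v‖ := by
  refine Continuous.integrable_of_hasCompactSupport ?_ (hasCompactSupport_cutoff D k).norm.mul_left
  refine Continuous.mul ?_ (cutoff D k).continuous.norm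
  exact (continuous_const.add continuous_norm).rpow_const fun v => Or.inl
    (show 1 + ‖v‖ ≠ 0 by positivity)

namespace IsSymbolS11

variable {d : ℕ} {m : ℝ} {a : RD d → RD d → ℂ}

theorem exists_norm_le_rpow (ha : IsSymbolS11 d m a) :
    ∃ c : ℝ, 0 ≤ c ∧ ∀ x ξ, ‖a x ξ‖ ≤ c * (1 + ‖ξ‖) ^ m := by
  obtain ⟨c, hc0, hc⟩ := ha.exists_norm_iteratedFDeriv_right_le 0
  exact ⟨c, hc0, fun x ξ => by simpa using hc x ξ⟩

theorem exists_norm_smear_le (ha : IsSymbolS11 d m a) (h : 𝓢(RD d, ℂ)) :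
    ∃ c : ℝ, 0 ≤ c ∧ ∀ x ξ, ‖smear h a x ξ‖ ≤ c * (1 + ‖ξ‖) ^ m := by
  obtain ⟨c, hc0, hc⟩ := ha.exists_norm_iteratedFDeriv_smear_le 0
  exact ⟨c * ∫ y, ‖h y‖, mul_nonneg hc0 (integral_nonneg fun _ => norm_nonneg _),
    fun x ξ => by simpa using hc h x ξ⟩

theorem continuous_smear (ha : IsSymbolS11 d m a) (h : 𝓢(RD d, ℂ)) :
    Continuous fun p : RD d × RD d => smear h a p.1 p.2 := by
  refine continuous_iff_continuousAt.2 fun p₀ => ?_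
  obtain ⟨c, hc0, hc⟩ := ha.exists_norm_le_rpow
  obtain ⟨C, hC⟩ := eventually_one_add_norm_rpow_le m p₀.2
  have hcont : Continuous fun p : (RD d × RD d) × RD d => a (p.1.1 - p.2) p.1.2 :=
    ha.1.continuous.comp (((continuous_fst.comp continuous_fst).sub continuous_snd).prodMk
      (continuous_snd.comp continuous_fst))
  refine continuousAt_of_dominated (bound := fun y => ‖h y‖ * (c * C)) (.of_forall fun p => ?_) ?_
    (h.integrable.norm.mul_const _) (.of_forall fun y => ?_)
  · exact (h.continuous.mul
      (hcont.comp (continuous_const.prodMk continuous_id))).aestronglyMeasurable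
  · filter_upwards [continuousAt_snd.eventually hC] with p hp
    refine .of_forall fun y => ?_
    rw [norm_mul]
    exact mul_le_mul_of_nonneg_left ((hc _ _).trans (mul_le_mul_of_nonneg_left hp hc0))
      (norm_nonneg _)
  · exact (continuous_const.mul
      (hcont.comp (continuous_id.prodMk continuous_const))).continuousAt

theorem smearPiece_eq_integral (ha : IsSymbolS11 d m a) (D : LPData d) (h : 𝓢(RD d, ℂ)) (k : ℕ)
    (u : TD d) (x : RD d) :
    smearPiece D a h k u x = ∫ y, pieceKernel D a h k x (y - x) * LPdist D k u y := by
  obtain ⟨P, hP⟩ := exists_schwartz_mul_cutoff D k (ha.contDiff_smear h x)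
  simp_rw [pieceKernel_eq hP]
  exact pairing_fourierTD_eq_integral D k (ha.contDiff_smear h x) hP u x

theorem continuous_pieceKernel (ha : IsSymbolS11 d m a) (D : LPData d) (h : 𝓢(RD d, ℂ)) (k : ℕ) :
    Continuous fun p : RD d × RD d => pieceKernel D a h k p.1 p.2 := by
  obtain ⟨c, hc0, hc⟩ := ha.exists_norm_smear_le h
  have hintg := (integrable_one_add_norm_rpow_mul_cutoff D k m).const_mul c
  have hcont : Continuous fun p : (RD d × RD d) × RD d =>
      Complex.exp (-(2 * Real.pi * Complex.I * ((⟪p.2, p.1.2⟫ : ℝ) : ℂ))) *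
        (smear h a p.1.1 p.2 * cutoff D k p.2) := by
    refine Continuous.mul (by fun_prop) (Continuous.mul ?_ ((cutoff D k).continuous.comp
      continuous_snd))
    exact (ha.continuous_smear h).comp
      ((continuous_fst.comp continuous_fst).prodMk continuous_snd)
  refine continuous_of_dominated (fun p => ?_) (fun p => .of_forall fun v => ?_) hintg
    (.of_forall fun v => ?_)
  · exact (hcont.comp (continuous_const.prodMk continuous_id)).aestronglyMeasurable
  · rw [norm_mul, norm_mul, norm_cexp_neg_inner, one_mul, ← mul_assoc]
    exact mul_le_mul_of_nonneg_right (hc _ _) (norm_nonneg _)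
  · have hv : Continuous fun p : RD d × RD d => (p, v) := Continuous.prodMk_left v
    simpa only [Function.comp_def] using hcont.comp hv

theorem exists_norm_pieceKernel_le (ha : IsSymbolS11 d m a) (D : LPData d) (h : 𝓢(RD d, ℂ))
    (k L : ℕ) : ∃ C : ℝ, 0 ≤ C ∧ ∀ x y, (1 + ‖y‖) ^ L * ‖pieceKernel D a h k x y‖ ≤ C := by
  obtain ⟨C, hC0, hC⟩ := exists_norm_fourierS_mul_cutoff_le D m L
  choose c hc0 hc using fun α => ha.exists_norm_iteratedFDeriv_smear_le α
  set S := ∑ α ∈ Finset.range (L + 1), c α * ∫ y, ‖h y‖ with hS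
  have hI : 0 ≤ ∫ y, ‖h y‖ := integral_nonneg fun _ => norm_nonneg _
  have hS0 : 0 ≤ S := Finset.sum_nonneg fun α _ => mul_nonneg (hc0 α) hI
  refine ⟨C * S * 2 ^ (k * m) * 2 ^ (k * d), by positivity, fun x y => ?_⟩
  obtain ⟨P, hP⟩ := exists_schwartz_mul_cutoff D k (ha.contDiff_smear h x)
  rw [pieceKernel_eq hP]
  refine le_trans ?_ (hC k (smear h a x) S (ha.contDiff_smear h x) hS0 (fun α hα ξ => ?_) P hP y)
  · gcongr
    exact le_mul_of_one_le_left (norm_nonneg _) (one_le_pow₀ one_le_two)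
  · refine (hc α h x ξ).trans ?_
    gcongr
    exact Finset.single_le_sum (f := fun α => c α * ∫ y, ‖h y‖)
      (fun α _ => mul_nonneg (hc0 α) hI) (Finset.mem_range.2 (Nat.lt_succ_of_le hα))

theorem exists_norm_pieceKernel_sub_le (ha : IsSymbolS11 d m a) (D : LPData d) (h : 𝓢(RD d, ℂ))
    (k L : ℕ) : ∃ C : ℝ, 0 ≤ C ∧ ∀ x y,
      ‖pieceKernel D a h k x (y - x)‖ ≤ C * (1 + ‖x‖) ^ L * ((1 + ‖y‖) ^ L)⁻¹ := by
  obtain ⟨C, hC0, hC⟩ := ha.exists_norm_pieceKernel_le D h k L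
  refine ⟨C, hC0, fun x y => ?_⟩
  rw [le_mul_inv_iff₀ (by positivity)]
  have h1 : 1 + ‖y‖ ≤ (1 + ‖x‖) * (1 + ‖y - x‖) := by
    have := norm_add_le x (y - x)
    rw [add_sub_cancel] at this
    nlinarith [norm_nonneg x, norm_nonneg (y - x)]
  calc ‖pieceKernel D a h k x (y - x)‖ * (1 + ‖y‖) ^ L
      ≤ ‖pieceKernel D a h k x (y - x)‖ * ((1 + ‖x‖) * (1 + ‖y - x‖)) ^ L := by gcongr
    _ = (1 + ‖y - x‖) ^ L * ‖pieceKernel D a h k x (y - x)‖ * (1 + ‖x‖) ^ L := by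
        rw [mul_pow]; ring
    _ ≤ C * (1 + ‖x‖) ^ L := by
        gcongr
        exact hC _ _

end IsSymbolS11

/-- A Littlewood–Paley piece is integrable against a sufficiently high negative power. -/
theorem exists_integrable_LPdist_mul {d : ℕ} (D : LPData d) (k : ℕ) (u : TD d) :
    ∃ L : ℕ, Integrable fun y => ((1 + ‖y‖) ^ L)⁻¹ * ‖LPdist D k u y‖ := by
  obtain ⟨C, n, hC0, hC⟩ := exists_norm_LPdist_le D k u
  have hintg : Integrable fun y : RD d => (1 + ‖y‖) ^ (-((d + 1 : ℕ) : ℝ)) :=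
    integrable_one_add_norm (by simp)
  refine ⟨n + (d + 1), (hintg.const_mul C).mono' ?_ (.of_forall fun y => ?_)⟩
  · refine Continuous.aestronglyMeasurable (Continuous.mul (Continuous.inv₀ (by fun_prop)
      fun y => by positivity) (continuous_LPdist D k u).norm)
  · rw [Real.norm_of_nonneg (by positivity), Real.rpow_neg (by positivity), Real.rpow_natCast,
      pow_add, mul_inv]
    calc ((1 + ‖y‖) ^ n)⁻¹ * ((1 + ‖y‖) ^ (d + 1))⁻¹ * ‖LPdist D k u y‖
        ≤ ((1 + ‖y‖) ^ n)⁻¹ * ((1 + ‖y‖) ^ (d + 1))⁻¹ * (C * (1 + ‖y‖) ^ n) := by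
          gcongr
          exact hC y
      _ = C * ((1 + ‖y‖) ^ (d + 1))⁻¹ := by
          field_simp

namespace IsSymbolS11

variable {d : ℕ} {m : ℝ} {a : RD d → RD d → ℂ}

theorem continuous_smearPiece (ha : IsSymbolS11 d m a) (D : LPData d) (h : 𝓢(RD d, ℂ)) (k : ℕ)
    (u : TD d) : Continuous (smearPiece D a h k u) := by
  obtain ⟨L, hL⟩ := exists_integrable_LPdist_mul D k u
  obtain ⟨C, hC0, hC⟩ := ha.exists_norm_pieceKernel_sub_le D h k L
  have hcont : Continuous fun p : RD d × RD d =>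
      pieceKernel D a h k p.1 (p.2 - p.1) * LPdist D k u p.2 :=
    ((ha.continuous_pieceKernel D h k).comp (continuous_fst.prodMk
      (continuous_snd.sub continuous_fst))).mul ((continuous_LPdist D k u).comp continuous_snd)
  rw [show smearPiece D a h k u = fun x => _ from funext fun x =>
    ha.smearPiece_eq_integral D h k u x]
  refine continuous_iff_continuousAt.2 fun x₀ => ?_
  refine continuousAt_of_dominated (bound := fun y => C * (1 + (‖x₀‖ + 1)) ^ L *
    (((1 + ‖y‖) ^ L)⁻¹ * ‖LPdist D k u y‖)) (.of_forall fun x => ?_) ?_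
    (hL.const_mul _) (.of_forall fun y => ?_)
  · exact (hcont.comp (continuous_const.prodMk continuous_id)).aestronglyMeasurable
  · filter_upwards [continuous_norm.continuousAt.eventually (gt_mem_nhds (lt_add_one ‖x₀‖))]
      with x hx
    refine .of_forall fun y => ?_
    rw [norm_mul, ← mul_assoc]
    refine mul_le_mul_of_nonneg_right ((hC x y).trans ?_) (norm_nonneg _)
    gcongr
  · exact (hcont.comp (continuous_id.prodMk continuous_const)).continuousAt

theorem continuous_block (ha : IsSymbolS11 d m a) (D : LPData d) (n : ℕ) (u : TD d) :
    Continuous (block D a n u) :=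
  (continuous_finsetSum _ fun k _ => ha.continuous_smearPiece D _ k u).add
    (ha.continuous_smearPiece D _ n u)

end IsSymbolS11

/-! ### Frequency localisation of the partial sums -/

theorem integral_reflShift_LPS_mul_eq_zero {d : ℕ} (D : LPData d) {h : 𝓢(RD d, ℂ)} {n l : ℕ}
    (hh : ∀ ξ, 2 * 2 ^ n < ‖ξ‖ → fourierS h ξ = 0) (hl : n + 5 ≤ l) {v : RD d}
    (hv : ‖v‖ ≤ 8 * 2 ^ n) (x w : RD d) :
    ∫ z, reflShift (LPS D l) x z *
      Complex.exp (2 * Real.pi * Complex.I * ((⟪v, z⟫ : ℝ) : ℂ)) * h (z - w) = 0 := by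
  set g : 𝓢(RD d, ℂ) := FourierTransformInv.fourierInv (reflShift (LPS D l) x) with hg
  have hgF : fourierS g = reflShift (LPS D l) x := by simp [fourierS_eq, hg]
  have h1 : ∀ z, reflShift (LPS D l) x z *
      Complex.exp (2 * Real.pi * Complex.I * ((⟪v, z⟫ : ℝ) : ℂ)) * h (z - w)
      = fourierS (g.compSubConstCLM ℂ (-v)) z * h.compSubConstCLM ℂ w z := fun z => by
    rw [fourierS_compSubConstCLM, hgF, SchwartzMap.compSubConstCLM_apply, inner_neg_left]
    push_cast
    rw [mul_neg, neg_neg]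
    ring
  simp_rw [h1]
  rw [integral_fourierS_mul]
  refine integral_eq_zero_of_ae (.of_forall fun ξ => ?_)
  simp only [Pi.zero_apply]
  rw [fourierS_compSubConstCLM, SchwartzMap.compSubConstCLM_apply, sub_neg_eq_add, hg,
    fourierInv_reflShift_LPS]
  by_cases hξ : 2 * 2 ^ n < ‖ξ‖
  · simp [hh ξ hξ]
  · rw [LPhat_eq_zero_of_gt D (by omega)]
    · simp
    · have h2 : (2:ℝ) ^ (n + 5) ≤ 2 ^ l := pow_le_pow_right₀ one_le_two hl
      have h3 := norm_add_le ξ v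
      have h4 : (0:ℝ) < 2 ^ n := by positivity
      rw [pow_add] at h2
      linarith

namespace IsSymbolS11

variable {d : ℕ} {m : ℝ} {a : RD d → RD d → ℂ}

theorem integral_reflShift_LPS_mul_smear_eq_zero (ha : IsSymbolS11 d m a) (D : LPData d)
    {h : 𝓢(RD d, ℂ)} {n l : ℕ} (hh : ∀ ξ, 2 * 2 ^ n < ‖ξ‖ → fourierS h ξ = 0) (hl : n + 5 ≤ l)
    {v : RD d} (hv : ‖v‖ ≤ 8 * 2 ^ n) (x : RD d) :
    ∫ z, reflShift (LPS D l) x z *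
      Complex.exp (2 * Real.pi * Complex.I * ((⟪v, z⟫ : ℝ) : ℂ)) * smear h a z v = 0 := by
  set f : RD d → ℂ := fun z => reflShift (LPS D l) x z *
      Complex.exp (2 * Real.pi * Complex.I * ((⟪v, z⟫ : ℝ) : ℂ)) with hf
  have hfi : Integrable f :=
    (reflShift (LPS D l) x).integrable.mul_bdd (c := 1)
      (contDiff_character v).continuous.aestronglyMeasurable
      (.of_forall fun z => (norm_character v z).le)
  have hgi : Integrable fun t => h (-t) := h.integrable.comp_neg
  obtain ⟨c, hc⟩ := ha.exists_norm_le v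
  have hprod : Integrable (fun p : RD d × RD d => f p.2 * h (p.2 - p.1) * a p.1 v)
      (volume.prod volume) := by
    have h1 := hfi.convolution_integrand (ContinuousLinearMap.mul ℂ ℂ) hgi
    simp only [ContinuousLinearMap.mul_apply', neg_sub] at h1
    exact h1.mul_bdd (c := c) ((ha.contDiff_left v).continuous.comp
      continuous_fst).aestronglyMeasurable (.of_forall fun p => hc _)
  have hs : ∀ z, f z * smear h a z v = ∫ w, f z * h (z - w) * a w v := fun z => by
    simp_rw [mul_assoc (f z)]
    rw [integral_const_mul]
    congr 1
    refine Eq.trans ?_ (integral_sub_left_eq_self (μ := volume) _ z)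
    simp [smear]
  rw [integral_congr_ae (.of_forall hs),
    ← integral_integral_swap (f := fun w z => f z * h (z - w) * a w v) hprod]
  refine integral_eq_zero_of_ae (.of_forall fun w => ?_)
  simp only [Pi.zero_apply]
  rw [integral_mul_const, hf, integral_reflShift_LPS_mul_eq_zero D hh hl hv, zero_mul]

theorem integral_reflShift_LPS_mul_pieceKernel_eq_zero (ha : IsSymbolS11 d m a) (D : LPData d)
    {h : 𝓢(RD d, ℂ)} {n k l : ℕ} (hh : ∀ ξ, 2 * 2 ^ n < ‖ξ‖ → fourierS h ξ = 0) (hk : k ≤ n)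
    (hl : n + 5 ≤ l) (x y : RD d) :
    ∫ z, reflShift (LPS D l) x z * pieceKernel D a h k z (y - z) = 0 := by
  set ψ := reflShift (LPS D l) x with hψ
  obtain ⟨c, hc0, hc⟩ := ha.exists_norm_smear_le h
  have hintg := (integrable_one_add_norm_rpow_mul_cutoff D k m).const_mul c
  have hcont : Continuous fun p : RD d × RD d => ψ p.1 *
      (Complex.exp (-(2 * Real.pi * Complex.I * ((⟪p.2, y - p.1⟫ : ℝ) : ℂ))) *
        (smear h a p.1 p.2 * cutoff D k p.2)) :=
    (ψ.continuous.comp continuous_fst).mul (Continuous.mul (by fun_prop)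
      ((ha.continuous_smear h).mul ((cutoff D k).continuous.comp continuous_snd)))
  have hprod : Integrable (fun p : RD d × RD d => ψ p.1 *
      (Complex.exp (-(2 * Real.pi * Complex.I * ((⟪p.2, y - p.1⟫ : ℝ) : ℂ))) *
        (smear h a p.1 p.2 * cutoff D k p.2))) (volume.prod volume) := by
    refine (ψ.integrable.norm.mul_prod hintg).mono' hcont.aestronglyMeasurable
      (.of_forall fun p => ?_)
    rw [norm_mul, norm_mul, norm_mul, norm_cexp_neg_inner, one_mul, ← mul_assoc c]
    exact mul_le_mul_of_nonneg_left
      (mul_le_mul_of_nonneg_right (hc _ _) (norm_nonneg _)) (norm_nonneg _)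
  simp_rw [pieceKernel, ← integral_const_mul]
  rw [integral_integral_swap hprod]
  refine integral_eq_zero_of_ae (.of_forall fun v => ?_)
  simp only [Pi.zero_apply]
  by_cases hv : ‖v‖ ≤ 8 * 2 ^ k
  · have h1 : ∀ z, ψ z * (Complex.exp (-(2 * Real.pi * Complex.I * ((⟪v, y - z⟫ : ℝ) : ℂ))) *
        (smear h a z v * cutoff D k v))
        = Complex.exp (-(2 * Real.pi * Complex.I * ((⟪v, y⟫ : ℝ) : ℂ))) * cutoff D k v *
          (ψ z * Complex.exp (2 * Real.pi * Complex.I * ((⟪v, z⟫ : ℝ) : ℂ)) * smear h a z v) := by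
      intro z
      rw [show Complex.exp (-(2 * Real.pi * Complex.I * ((⟪v, y - z⟫ : ℝ) : ℂ)))
        = Complex.exp (-(2 * Real.pi * Complex.I * ((⟪v, y⟫ : ℝ) : ℂ))) *
          Complex.exp (2 * Real.pi * Complex.I * ((⟪v, z⟫ : ℝ) : ℂ)) by
        rw [← Complex.exp_add, inner_sub_right]
        congr 1
        push_cast
        ring]
      ring
    simp_rw [h1]
    rw [integral_const_mul, hψ, ha.integral_reflShift_LPS_mul_smear_eq_zero D hh hl
      (hv.trans (by gcongr; exact one_le_two)), mul_zero]
  · simp [cutoff_eq_zero D (not_le.1 hv)]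

theorem integral_reflShift_LPS_mul_smearPiece (ha : IsSymbolS11 d m a) (D : LPData d)
    {h : 𝓢(RD d, ℂ)} {n k l : ℕ} (hh : ∀ ξ, 2 * 2 ^ n < ‖ξ‖ → fourierS h ξ = 0) (hk : k ≤ n)
    (hl : n + 5 ≤ l) (u : TD d) (x : RD d) :
    Integrable (fun z => reflShift (LPS D l) x z * smearPiece D a h k u z) ∧
      ∫ z, reflShift (LPS D l) x z * smearPiece D a h k u z = 0 := by
  set ψ := reflShift (LPS D l) x with hψ
  obtain ⟨L, hL⟩ := exists_integrable_LPdist_mul D k u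
  obtain ⟨C, hC0, hC⟩ := ha.exists_norm_pieceKernel_sub_le D h k L
  have hcont : Continuous fun p : RD d × RD d =>
      ψ p.1 * (pieceKernel D a h k p.1 (p.2 - p.1) * LPdist D k u p.2) :=
    (ψ.continuous.comp continuous_fst).mul (((ha.continuous_pieceKernel D h k).comp
      (continuous_fst.prodMk (continuous_snd.sub continuous_fst))).mul
      ((continuous_LPdist D k u).comp continuous_snd))
  have hprod : Integrable (fun p : RD d × RD d =>
      ψ p.1 * (pieceKernel D a h k p.1 (p.2 - p.1) * LPdist D k u p.2))
      (volume.prod volume) := by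
    refine (((integrable_norm_mul_one_add_norm_pow ψ L).const_mul C).mul_prod hL).mono'
      hcont.aestronglyMeasurable (.of_forall fun p => ?_)
    rw [norm_mul, norm_mul]
    calc ‖ψ p.1‖ * (‖pieceKernel D a h k p.1 (p.2 - p.1)‖ * ‖LPdist D k u p.2‖)
        ≤ ‖ψ p.1‖ * (C * (1 + ‖p.1‖) ^ L * ((1 + ‖p.2‖) ^ L)⁻¹ * ‖LPdist D k u p.2‖) := by
          gcongr
          exact hC _ _
      _ = _ := by ring
  simp_rw [ha.smearPiece_eq_integral, ← integral_const_mul]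
  refine ⟨hprod.integral_prod_left, ?_⟩
  rw [integral_integral_swap hprod]
  refine integral_eq_zero_of_ae (.of_forall fun y => ?_)
  simp only [Pi.zero_apply, ← mul_assoc]
  rw [integral_mul_const, hψ, ha.integral_reflShift_LPS_mul_pieceKernel_eq_zero D hh hk hl,
    zero_mul]

/-- The partial sum of order `n` has no frequencies beyond `2 ^ (n + 4)`. -/
theorem integral_pdoPartial_mul_eq_zero (ha : IsSymbolS11 d m a) (D : LPData d) {n l : ℕ}
    (hl : n + 5 ≤ l) (u : TD d) (x : RD d) :
    ∫ z, pdoPartial D a n u z * reflShift (LPS D l) x z = 0 := by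
  have hh : ∀ ξ, 2 * 2 ^ n < ‖ξ‖ → fourierS (dil n D.Φ) ξ = 0 := fun ξ hξ => by
    rw [fourierS_dil]
    refine fourierS_Φ_eq_zero D ?_
    rw [norm_smul, norm_inv, norm_pow, Real.norm_ofNat, lt_inv_mul_iff₀ (by positivity)]
    linarith
  simp_rw [ha.pdoPartial_eq, mul_comm _ (reflShift (LPS D l) x _), Finset.mul_sum]
  have := fun k (hk : k ∈ Finset.range (n + 1)) => ha.integral_reflShift_LPS_mul_smearPiece D hh
    (Nat.lt_succ_iff.1 (Finset.mem_range.1 hk)) hl u x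
  rw [integral_finsetSum _ fun k hk => (this k hk).1]
  exact Finset.sum_eq_zero fun k hk => (this k hk).2

end IsSymbolS11

/-! ### Envelopes of the Littlewood–Paley pieces -/

/-- The summand `2^{σkq} |Π_k u|^q` of the `F_∞^{σ,q}` norm. -/
def LPpow {d : ℕ} (D : LPData d) (σ q : ℝ) (u : TD d) (k : ℕ) (x : RD d) : ℝ≥0∞ :=
  2 ^ (σ * k * q) * ‖LPdist D k u x‖ₑ ^ q

theorem measurable_enorm_LPdist {d : ℕ} (D : LPData d) (u : TD d) (k : ℕ) :
    Measurable fun x => ‖LPdist D k u x‖ₑ :=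
  (continuous_LPdist D k u).measurable.enorm

theorem measurable_LPpow {d : ℕ} (D : LPData d) (σ q : ℝ) (u : TD d) (k : ℕ) :
    Measurable (LPpow D σ q u k) :=
  ((measurable_enorm_LPdist D u k).pow_const q).const_mul _

theorem cubePiece_rpow {d : ℕ} (D : LPData d) (σ : ℝ) {q : ℝ} (hq : 0 < q) (u : TD d) (μ : ℕ)
    (n : Fin d → ℤ) : cubePiece d μ n μ σ q (fun k x => LPdist D k u x) ^ q =
      (2:ℝ≥0∞) ^ ((μ:ℝ) * (d:ℝ)) * ∫⁻ x in dyadicCube d μ n, ∑' j, LPpow D σ q u (μ + j) x := by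
  rw [cubePiece, ← ENNReal.rpow_mul, one_div, inv_mul_cancel₀ hq.ne', ENNReal.rpow_one]
  simp only [LPpow, Nat.cast_add]
  rfl

theorem cubeBound_LPpow {d : ℕ} (D : LPData d) (σ : ℝ) {q : ℝ} (hq : 0 < q) (u : TD d) :
    CubeBound (LPpow D σ q u) (FinftyNormDist D σ q u ^ q) where
  measurable := measurable_LPpow D σ q u
  zero_le x := by
    simp only [LPpow, Nat.cast_zero, mul_zero, zero_mul, ENNReal.rpow_zero, one_mul]
    refine ENNReal.rpow_le_rpow (le_trans ?_ le_self_add) hq.le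
    exact le_iSup (fun x : RD d => (‖LPdist D 0 u x‖₊ : ℝ≥0∞)) x
  cube_le μ hμ n := by
    rw [← cubePiece_rpow D σ hq]
    refine ENNReal.rpow_le_rpow (le_trans ?_ le_add_self) hq.le
    exact le_iSup_of_le μ (le_iSup_of_le hμ (le_iSup_of_le n le_rfl))

theorem lconvol_const_mul {d : ℕ} {w f : RD d → ℝ≥0∞} {c : ℝ≥0∞} (hc : c ≠ ⊤) (x : RD d) :
    lconvol w (fun y => c * f y) x = c * lconvol w f x := by
  simp only [lconvol]
  rw [← lintegral_const_mul' _ _ hc]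
  simp only [mul_left_comm]

/-- The majorant `(η_{k,M} * 2^{σkq} |Π_k u|^q)^{1/q}` of `2^{σk} |Π_k u|`. -/
def LPenv {d : ℕ} (D : LPData d) (σ q M : ℝ) (u : TD d) (k : ℕ) (x : RD d) : ℝ≥0∞ :=
  lconvol (etaKernel k M) (LPpow D σ q u k) x ^ (1 / q)

theorem measurable_LPenv {d : ℕ} (D : LPData d) (σ q M : ℝ) (u : TD d) (k : ℕ) :
    Measurable (LPenv D σ q M u k) :=
  (measurable_lconvol (measurable_etaKernel k M) (measurable_LPpow D σ q u k)).pow_const _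

theorem exists_LPenv_le {d : ℕ} (D : LPData d) (σ : ℝ) {q M : ℝ} (hq : 0 < q)
    (hM : (d:ℝ) < M) : ∃ C : ℝ≥0∞, C ≠ ⊤ ∧ ∀ (u : TD d) k x,
      LPenv D σ q M u k x ≤ C * FinftyNormDist D σ q u := by
  have hM0 : 0 ≤ M := (Nat.cast_nonneg d).trans hM.le
  refine ⟨(ENNReal.ofReal (1 + √d) ^ M * etaMass d M) ^ (1 / q),
    ENNReal.rpow_ne_top_of_nonneg (by positivity) (ENNReal.mul_ne_top
      (ENNReal.rpow_ne_top_of_nonneg hM0 ENNReal.ofReal_ne_top) (etaMass_ne_top hM)),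
    fun u k x => ?_⟩
  refine (ENNReal.rpow_le_rpow ((cubeBound_LPpow D σ hq u).lconvol_le hM0 k x)
    (by positivity)).trans_eq ?_
  rw [ENNReal.mul_rpow_of_nonneg _ _ (by positivity), ← ENNReal.rpow_mul, mul_one_div_cancel hq.ne',
    ENNReal.rpow_one]

theorem exists_enorm_LPdist_le_LPenv {d : ℕ} (D : LPData d) (σ : ℝ) {q M : ℝ} (hq : 0 < q)
    (hM : (d:ℝ) < M) : ∃ C : ℝ≥0∞, C ≠ ⊤ ∧ ∀ u : TD d, FinftyNormDist D σ q u ≠ ⊤ → ∀ (k : ℕ) x,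
      2 ^ (σ * k) * ‖LPdist D k u x‖ₑ ≤ C * LPenv D σ q M u k x := by
  have hM0 : 0 ≤ M := (Nat.cast_nonneg d).trans hM.le
  obtain ⟨C, hC, hrep⟩ := exists_enorm_LPdist_le D (M / min 1 q)
  set K := C ^ max 1 q * etaMass d M ^ (max 1 q - 1) with hK
  have hKt : K ≠ ⊤ := ENNReal.mul_ne_top (ENNReal.rpow_ne_top_of_nonneg (by positivity) hC)
    (ENNReal.rpow_ne_top_of_nonneg (sub_nonneg.2 (le_max_left _ _)) (etaMass_ne_top hM))
  refine ⟨K ^ (1 / q), ENNReal.rpow_ne_top_of_nonneg (by positivity) hKt, fun u hu k x => ?_⟩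
  have hconv : ∀ x, lconvol (etaKernel k M) (LPpow D σ q u k) x =
      2 ^ (σ * k * q) * lconvol (etaKernel k M) (fun y => ‖LPdist D k u y‖ₑ ^ q) x :=
    fun x => lconvol_const_mul (two_rpow_ne_top _) x
  have hbd : ∀ x, lconvol (etaKernel k M) (fun y => ‖LPdist D k u y‖ₑ ^ q) x ≤
      2 ^ (-(σ * k * q)) * (ENNReal.ofReal (1 + √d) ^ M * etaMass d M *
        FinftyNormDist D σ q u ^ q) := fun x => by
    have := (cubeBound_LPpow D σ hq u).lconvol_le hM0 k x
    rw [hconv] at this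
    refine le_trans (le_of_eq ?_) (mul_le_mul_right this _)
    rw [← mul_assoc, ← two_rpow_add, neg_add_cancel, ENNReal.rpow_zero, one_mul]
  have hBt : (2:ℝ≥0∞) ^ (-(σ * k * q)) * (ENNReal.ofReal (1 + √d) ^ M * etaMass d M *
      FinftyNormDist D σ q u ^ q) ≠ ⊤ :=
    ENNReal.mul_ne_top (two_rpow_ne_top _) (ENNReal.mul_ne_top (ENNReal.mul_ne_top
      (ENNReal.rpow_ne_top_of_nonneg hM0 ENNReal.ofReal_ne_top) (etaMass_ne_top hM))
      (ENNReal.rpow_ne_top_of_nonneg hq.le hu))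
  have hgrowth : ∃ C : ℝ≥0∞, ∃ K : ℝ, C ≠ ⊤ ∧ 0 ≤ K ∧ ∀ x, ‖LPdist D k u x‖ₑ ≤
      C * scaleWeight k x ^ K := by
    obtain ⟨c, n, hc0, hc⟩ := exists_norm_LPdist_le D k u
    refine ⟨ENNReal.ofReal c, n, ENNReal.ofReal_ne_top, Nat.cast_nonneg n, fun x => ?_⟩
    rw [← ofReal_norm, scaleWeight, ENNReal.rpow_natCast, ← ENNReal.ofReal_pow (by positivity),
      ← ENNReal.ofReal_mul hc0]
    refine ENNReal.ofReal_le_ofReal ((hc x).trans ?_)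
    gcongr
    exact le_mul_of_one_le_left (norm_nonneg _) (one_le_pow₀ one_le_two)
  have hmain := rpow_le_lconvol k hq hM0 (measurable_enorm_LPdist D u k)
    (fun L => (exists_enorm_LPdist_le D L).imp fun _ h => ⟨h.1, h.2 k u⟩) hgrowth hBt hbd
    (hrep k u) x
  rw [LPenv, hconv, ← ENNReal.mul_rpow_of_nonneg _ _ (by positivity : 0 ≤ 1 / q), one_div,
    ENNReal.le_rpow_inv_iff hq, ENNReal.mul_rpow_of_nonneg _ _ hq.le, ← ENNReal.rpow_mul,
    mul_left_comm]
  exact mul_le_mul_right hmain _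

theorem lconvol_LPenv_le {d : ℕ} (D : LPData d) (σ : ℝ) {q M L : ℝ} (hq : 0 < q)
    (hM : 0 ≤ M) (u : TD d) (k : ℕ) (x : RD d) :
    lconvol (etaKernel k L) (LPenv D σ q M u k) x ≤
      etaMass d (L - M / q) * LPenv D σ q M u k x := by
  rw [← lintegral_etaKernel_sub k (L - M / q) x, ← lintegral_mul_const _ (by fun_prop)]
  refine lintegral_mono fun y => ?_
  have h1 : LPenv D σ q M u k y ≤ scaleWeight k (x - y) ^ (M / q) * LPenv D σ q M u k x := by
    have := lconvol_etaKernel_le k hM (LPpow D σ q u k) y x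
    refine (ENNReal.rpow_le_rpow this (by positivity : 0 ≤ 1 / q)).trans_eq ?_
    rw [ENNReal.mul_rpow_of_nonneg _ _ (by positivity), ← ENNReal.rpow_mul, mul_one_div,
      scaleWeight_sub_comm]
    rfl
  refine (mul_le_mul_right h1 _).trans_eq ?_
  rw [← mul_assoc, etaKernel_mul_scaleWeight_rpow]

theorem exists_lconvol_LPdist_le {d : ℕ} (D : LPData d) (σ : ℝ) {q M L : ℝ} (hq : 0 < q)
    (hM : (d:ℝ) < M) (hL : M / q + d < L) :
    ∃ C : ℝ≥0∞, C ≠ ⊤ ∧ ∀ u : TD d, FinftyNormDist D σ q u ≠ ⊤ → ∀ (k : ℕ) x,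
      2 ^ (σ * k) * lconvol (etaKernel k L) (fun y => ‖LPdist D k u y‖ₑ) x ≤
        C * LPenv D σ q M u k x := by
  obtain ⟨C, hC, h⟩ := exists_enorm_LPdist_le_LPenv D σ hq hM
  refine ⟨C * etaMass d (L - M / q), ENNReal.mul_ne_top hC (etaMass_ne_top (by linarith)),
    fun u hu k x => ?_⟩
  rw [← lconvol_const_mul (two_rpow_ne_top _)]
  refine (lconvol_mono (fun _ => le_rfl) (h u hu k) x).trans ?_
  rw [lconvol_const_mul hC, mul_assoc]
  exact mul_le_mul_right
    (lconvol_LPenv_le D σ hq ((Nat.cast_nonneg d).trans hM.le) u k x) _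

/-- The Littlewood–Paley kernels are dominated by the model kernels. -/
theorem exists_enorm_LPS_le {d : ℕ} (D : LPData d) (L : ℕ) :
    ∃ C : ℝ≥0∞, C ≠ ⊤ ∧ ∀ k x, ‖LPS D k x‖ₑ ≤ C * etaKernel k L x := by
  obtain ⟨c, hc0, hc⟩ := exists_one_add_norm_pow_mul_iteratedFDeriv_le D.φ L 0
  obtain ⟨c', hc0', hc'⟩ := exists_one_add_norm_pow_mul_iteratedFDeriv_le D.Φ L 0
  simp only [norm_iteratedFDeriv_zero] at hc hc'
  refine ⟨ENNReal.ofReal (c + c'), ENNReal.ofReal_ne_top, fun k x => ?_⟩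
  refine enorm_le_etaKernel (by positivity) ?_
  have hx : (1 + 2 ^ k * ‖x‖) = 1 + ‖(2:ℝ) ^ k • x‖ := by
    rw [norm_smul, norm_pow, Real.norm_ofNat]
  cases k with
  | zero =>
    have : ‖LPS D 0 x‖ = ‖D.Φ x‖ := by rw [LPS_apply]; rfl
    rw [this]
    simpa using (hc' x).trans (le_add_of_nonneg_left hc0)
  | succ k =>
    rw [hx, LPS_apply, LPkernel, norm_mul, Complex.norm_real, Real.norm_of_nonneg (by positivity),
      mul_left_comm, mul_comm]
    gcongr
    exact (hc _).trans (le_add_of_nonneg_right hc0')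

/-! ### Summation of the blocks -/

/-- A bounded measurable function defines a tempered distribution. -/
theorem exists_TD_eq_integral {d : ℕ} {g : RD d → ℂ} {B : ℝ} (hg : AEStronglyMeasurable g volume)
    (hB : ∀ x, ‖g x‖ ≤ B) : ∃ T : TD d, ∀ ψ, T ψ = ∫ x, g x * ψ x := by
  have hL : MemLp g ⊤ volume := memLp_top_of_bound hg B (.of_forall hB)
  refine ⟨(Lp.toTemperedDistribution hL.toLp : 𝓢'(RD d, ℂ)), fun ψ => ?_⟩
  refine (Lp.toTemperedDistribution_apply hL.toLp ψ).trans (integral_congr_ae ?_)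
  filter_upwards [hL.coeFn_toLp] with x hx
  rw [hx, smul_eq_mul, mul_comm]

theorem inv_two_pow_mul_le {N k l n : ℕ} (hl : l - k ≤ 4 + (n - k)) :
    ((2:ℝ≥0∞) ^ ((N + 1) * (n - k)))⁻¹ ≤
      2 ^ (4 * N) * (2 ^ (N * (l - k)))⁻¹ * (2⁻¹) ^ (n - k) := by
  have h1 : ((2:ℝ≥0∞) ^ (4 * N) * 2 ^ (N * (n - k)))⁻¹ ≤ (2 ^ (N * (l - k)))⁻¹ := by
    rw [← pow_add]
    refine ENNReal.inv_le_inv.2 (pow_le_pow_right₀ one_le_two ?_)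
    nlinarith
  have h2 : (2:ℝ≥0∞) ^ (4 * N) * (2 ^ (4 * N) * 2 ^ (N * (n - k)))⁻¹ = (2 ^ (N * (n - k)))⁻¹ := by
    rw [ENNReal.mul_inv (by simp) (by simp), ← mul_assoc, ENNReal.mul_inv_cancel (by simp)
      (by simp), one_mul]
  rw [add_mul, one_mul, pow_add, ENNReal.mul_inv (by simp) (by simp), ENNReal.inv_pow (n := n - k)]
  refine mul_le_mul_left ?_ _
  rw [← h2]
  exact mul_le_mul_right h1 _

theorem tsum_two_rpow_neg_ne_top {s : ℝ} (hs : 0 < s) :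
    ∑' k : ℕ, (2:ℝ≥0∞) ^ (-(s * k)) ≠ ⊤ := by
  have h1 : ∀ k : ℕ, (2:ℝ≥0∞) ^ (-(s * k)) = ((2:ℝ≥0∞) ^ (-s)) ^ k := fun k => by
    rw [← ENNReal.rpow_natCast, ← ENNReal.rpow_mul, neg_mul]
  simp_rw [h1]
  rw [ENNReal.tsum_geometric]
  refine ENNReal.inv_ne_top.2 (tsub_pos_of_lt ?_).ne'
  rw [ENNReal.rpow_neg, ENNReal.inv_lt_one]
  exact ENNReal.one_lt_rpow (by norm_num) hs

namespace IsSymbolS11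

variable {d : ℕ} {m : ℝ} {a : RD d → RD d → ℂ}

theorem exists_enorm_block_le_LPenv (ha : IsSymbolS11 d m a) (D : LPData d) (s : ℝ) {q M : ℝ}
    (hq : 0 < q) (hM : (d:ℝ) < M) (N : ℕ) :
    ∃ C : ℝ≥0∞, C ≠ ⊤ ∧ ∀ u : TD d, FinftyNormDist D (s + m) q u ≠ ⊤ → ∀ (n : ℕ) x,
      ‖block D a n u x‖ₑ ≤ C * ∑ k ∈ Finset.range (n + 1), 2 ^ (-(s * k)) *
        (2 ^ (N * (n - k)))⁻¹ * LPenv D (s + m) q M u k x := by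
  obtain ⟨L, hL⟩ := exists_nat_gt (M / q + d)
  obtain ⟨C₁, hC₁, h₁⟩ := ha.exists_enorm_block_le D N L
  obtain ⟨C₂, hC₂, h₂⟩ := exists_lconvol_LPdist_le D (s + m) hq hM hL
  refine ⟨C₁ * C₂, ENNReal.mul_ne_top hC₁ hC₂, fun u hu n x => (h₁ n u x).trans ?_⟩
  rw [mul_assoc, Finset.mul_sum _ _ C₂]
  refine mul_le_mul_right (Finset.sum_le_sum fun k _ => ?_) _
  have h3 : (2:ℝ≥0∞) ^ (k * m) = 2 ^ (-(s * k)) * 2 ^ ((s + m) * k) := by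
    rw [← two_rpow_add]
    congr 1
    ring
  calc (2:ℝ≥0∞) ^ (k * m) * (2 ^ (N * (n - k)))⁻¹ *
        lconvol (etaKernel k L) (fun y => ‖LPdist D k u y‖ₑ) x
      = 2 ^ (-(s * k)) * (2 ^ (N * (n - k)))⁻¹ * (2 ^ ((s + m) * k) *
        lconvol (etaKernel k L) (fun y => ‖LPdist D k u y‖ₑ) x) := by
        rw [h3]; ring
    _ ≤ 2 ^ (-(s * k)) * (2 ^ (N * (n - k)))⁻¹ * (C₂ * LPenv D (s + m) q M u k x) :=
        mul_le_mul_right (h₂ u hu k x) _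
    _ = _ := by ring

theorem exists_tsum_enorm_block_le (ha : IsSymbolS11 d m a) (D : LPData d) (s : ℝ) {q M : ℝ}
    (hq : 0 < q) (hM : (d:ℝ) < M) (N : ℕ) :
    ∃ C : ℝ≥0∞, C ≠ ⊤ ∧ ∀ u : TD d, FinftyNormDist D (s + m) q u ≠ ⊤ → ∀ (l : ℕ) x,
      ∑' i, ‖block D a (l - 4 + i) u x‖ₑ ≤ C * ∑' k : ℕ, 2 ^ (-(s * k)) *
        (2 ^ (N * (l - k)))⁻¹ * LPenv D (s + m) q M u k x := by
  obtain ⟨C, hC, h⟩ := ha.exists_enorm_block_le_LPenv D s hq hM (N + 1)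
  refine ⟨C * (2 ^ (4 * N) * geomMass 2⁻¹), ENNReal.mul_ne_top hC (ENNReal.mul_ne_top (by simp)
    (geomMass_ne_top (by simp [ENNReal.inv_lt_one]))), fun u hu l x => ?_⟩
  set c : ℕ → ℝ≥0∞ := fun k => 2 ^ (-(s * k)) * (2 ^ (N * (l - k)))⁻¹ *
    LPenv D (s + m) q M u k x with hc
  have h1 : ∀ i, ‖block D a (l - 4 + i) u x‖ₑ ≤ C * ∑' k : ℕ, 2 ^ (4 * N) * c k *
      2⁻¹ ^ (((l - 4 : ℕ) + (i:ℤ)) - k).natAbs := fun i => by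
    refine (h u hu _ x).trans (mul_le_mul_right (le_trans (Finset.sum_le_sum fun k hk => ?_)
      (ENNReal.sum_le_tsum _)) _)
    have hk' := Finset.mem_range.1 hk
    have habs : (((l - 4 : ℕ) + (i:ℤ)) - k).natAbs = l - 4 + i - k := by omega
    have h2 := inv_two_pow_mul_le (N := N) (k := k) (l := l) (n := l - 4 + i) (by omega)
    rw [habs, hc]
    calc (2:ℝ≥0∞) ^ (-(s * k)) * (2 ^ ((N + 1) * (l - 4 + i - k)))⁻¹ * LPenv D (s + m) q M u k x
        ≤ 2 ^ (-(s * k)) * (2 ^ (4 * N) * (2 ^ (N * (l - k)))⁻¹ * 2⁻¹ ^ (l - 4 + i - k)) *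
          LPenv D (s + m) q M u k x := mul_le_mul_left (mul_le_mul_right h2 _) _
      _ = _ := by ring
  calc ∑' i, ‖block D a (l - 4 + i) u x‖ₑ
      ≤ ∑' i : ℕ, C * ∑' k : ℕ, 2 ^ (4 * N) * c k *
        2⁻¹ ^ (((l - 4 : ℕ) + (i:ℤ)) - k).natAbs := ENNReal.tsum_le_tsum h1
    _ = C * ∑' k : ℕ, 2 ^ (4 * N) * c k *
        ∑' i : ℕ, 2⁻¹ ^ (((l - 4 : ℕ) + (i:ℤ)) - k).natAbs := by
        rw [ENNReal.tsum_mul_left, ENNReal.tsum_comm]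
        simp_rw [ENNReal.tsum_mul_left]
    _ ≤ C * ∑' k : ℕ, 2 ^ (4 * N) * c k * geomMass 2⁻¹ := by
        refine mul_le_mul_right (ENNReal.tsum_le_tsum fun k => mul_le_mul_right ?_ _) _
        refine tsum_pow_natAbs_le _ (e := fun i : ℕ => ((l - 4 : ℕ) + (i:ℤ)) - k) fun i j hij => ?_
        simp only at hij
        omega
    _ = _ := by
        rw [ENNReal.tsum_mul_right, ENNReal.tsum_mul_left]
        ring

theorem exists_tsum_enorm_block_le_norm (ha : IsSymbolS11 d m a) (D : LPData d) {s q : ℝ}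
    (hs : 0 < s) (hq : 0 < q) :
    ∃ C : ℝ≥0∞, C ≠ ⊤ ∧ ∀ u : TD d, FinftyNormDist D (s + m) q u ≠ ⊤ → ∀ x,
      ∑' i, ‖block D a i u x‖ₑ ≤ C * FinftyNormDist D (s + m) q u := by
  have hM : (d:ℝ) < d + 1 := lt_add_one _
  obtain ⟨C₁, hC₁, h₁⟩ := ha.exists_tsum_enorm_block_le D s hq hM 0
  obtain ⟨C₂, hC₂, h₂⟩ := exists_LPenv_le D (s + m) hq hM
  refine ⟨C₁ * ((∑' k : ℕ, (2:ℝ≥0∞) ^ (-(s * k))) * C₂), ENNReal.mul_ne_top hC₁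
    (ENNReal.mul_ne_top (tsum_two_rpow_neg_ne_top hs) hC₂), fun u hu x => ?_⟩
  have h3 := h₁ u hu 0 x
  simp only [zero_tsub, zero_add, zero_mul, pow_zero, inv_one, mul_one] at h3
  refine h3.trans ?_
  rw [mul_assoc, mul_assoc (∑' k : ℕ, _), ← ENNReal.tsum_mul_right]
  exact mul_le_mul_right (ENNReal.tsum_le_tsum fun k => mul_le_mul_right (h₂ u k x) _) _

end IsSymbolS11

/-! ### Boundedness -/

theorem summable_of_tsum_enorm_le {f : ℕ → ℂ} {B : ℝ≥0∞} (hB : B ≠ ⊤) (h : ∑' i, ‖f i‖ₑ ≤ B) :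
    Summable f :=
  Summable.of_enorm (ne_top_of_le_ne_top hB h)

theorem norm_sum_le_of_tsum_enorm_le {f : ℕ → ℂ} {B : ℝ≥0∞} (hB : B ≠ ⊤) (h : ∑' i, ‖f i‖ₑ ≤ B)
    (s : Finset ℕ) : ‖∑ i ∈ s, f i‖ ≤ B.toReal := by
  rw [← toReal_enorm]
  exact ENNReal.toReal_mono hB ((enorm_sum_le _ _).trans ((ENNReal.sum_le_tsum _).trans h))

namespace IsSymbolS11

variable {d : ℕ} {m : ℝ} {a : RD d → RD d → ℂ}

section

variable {u : TD d} {B : ℝ≥0∞}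

theorem aestronglyMeasurable_tsum_block (ha : IsSymbolS11 d m a) (D : LPData d) (hB : B ≠ ⊤)
    (h : ∀ x, ∑' i, ‖block D a i u x‖ₑ ≤ B) :
    AEStronglyMeasurable (fun x => ∑' i, block D a i u x) volume :=
  aestronglyMeasurable_of_tendsto_ae atTop
    (f := fun n x => ∑ i ∈ Finset.range n, block D a i u x)
    (fun _ => (continuous_finsetSum _ fun i _ => ha.continuous_block D i u).aestronglyMeasurable)
    (.of_forall fun x => (summable_of_tsum_enorm_le hB (h x)).hasSum.tendsto_sum_nat)

theorem convergesInSPrime (ha : IsSymbolS11 d m a) (D : LPData d) (hB : B ≠ ⊤)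
    (h : ∀ x, ∑' i, ‖block D a i u x‖ₑ ≤ B) {T : TD d}
    (hT : ∀ ψ, T ψ = ∫ x, (∑' i, block D a i u x) * ψ x) : ConvergesInSPrime D a u T := by
  intro ψ
  rw [hT]
  simp_rw [ha.pdoPartial_eq_sum_block]
  refine tendsto_integral_of_dominated_convergence (fun x => B.toReal * ‖ψ x‖) (fun n => ?_)
    (ψ.integrable.norm.const_mul _) (fun n => .of_forall fun x => ?_) (.of_forall fun x => ?_)
  · exact ((continuous_finsetSum _ fun i _ => ha.continuous_block D i u).mul
      ψ.continuous).aestronglyMeasurable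
  · rw [norm_mul]
    exact mul_le_mul_of_nonneg_right (norm_sum_le_of_tsum_enorm_le hB (h x) _) (norm_nonneg _)
  · exact (((summable_of_tsum_enorm_le hB (h x)).hasSum.tendsto_sum_nat).comp
      (tendsto_add_atTop_nat 1)).mul_const _

theorem enorm_LPdist_le (ha : IsSymbolS11 d m a) (D : LPData d) (hB : B ≠ ⊤)
    (h : ∀ x, ∑' i, ‖block D a i u x‖ₑ ≤ B) {T : TD d}
    (hT : ∀ ψ, T ψ = ∫ x, (∑' i, block D a i u x) * ψ x) (l : ℕ) (x : RD d) :
    ‖LPdist D l T x‖ₑ ≤ ∫⁻ y, ‖LPS D l (x - y)‖ₑ * ∑' i, ‖block D a (l - 4 + i) u y‖ₑ := by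
  set ψ := reflShift (LPS D l) x with hψ
  have hsum := fun y => summable_of_tsum_enorm_le hB (h y)
  have hintg : Integrable fun y => (∑' i, block D a i u y) * ψ y :=
    ψ.integrable.bdd_mul (c := B.toReal) (ha.aestronglyMeasurable_tsum_block D hB h)
      (.of_forall fun y => by
        rw [← toReal_enorm]
        exact ENNReal.toReal_mono hB (enorm_tsum_le_tsum_enorm.trans (h y)))
  have hintg' : Integrable fun y => (∑ i ∈ Finset.range (l - 4), block D a i u y) * ψ y :=
    ψ.integrable.bdd_mul (c := B.toReal)
      (continuous_finsetSum _ fun i _ => ha.continuous_block D i u).aestronglyMeasurable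
      (.of_forall fun y => norm_sum_le_of_tsum_enorm_le hB (h y) _)
  have hzero : ∫ y, (∑ i ∈ Finset.range (l - 4), block D a i u y) * ψ y = 0 := by
    rcases Nat.lt_or_ge 4 l with hl | hl
    · obtain ⟨n, rfl⟩ := Nat.exists_eq_add_of_le' hl
      simp_rw [show n + (4 + 1) - 4 = n + 1 by omega, ← ha.pdoPartial_eq_sum_block]
      exact ha.integral_pdoPartial_mul_eq_zero D le_rfl u x
    · simp [Nat.sub_eq_zero_of_le hl]
  have hrepr : LPdist D l T x = ∫ y, (∑' i, block D a (l - 4 + i) u y) * ψ y := by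
    rw [LPdist_eq, hT, ← sub_zero (∫ y, _ * _), ← hzero, ← integral_sub hintg hintg']
    refine integral_congr_ae (.of_forall fun y => ?_)
    simp only
    rw [← sub_mul, ← (hsum y).sum_add_tsum_nat_add (l - 4), add_sub_cancel_left]
    simp_rw [add_comm _ (l - 4)]
  rw [hrepr]
  refine (enorm_integral_le_lintegral_enorm _).trans (lintegral_mono fun y => ?_)
  rw [enorm_mul, mul_comm, hψ, reflShift_apply]
  exact mul_le_mul_right enorm_tsum_le_tsum_enorm _

end

/-- The estimate of a Littlewood–Paley piece of `T_a u` by the envelopes of `u`. -/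
theorem exists_enorm_LPdist_le (ha : IsSymbolS11 d m a) (D : LPData d) {s q δ M' : ℝ}
    (hq : 0 < q) (hs : δ ≤ s - (d / min 1 q - d)) (hM' : (d:ℝ) < M') :
    ∃ C : ℝ≥0∞, C ≠ ⊤ ∧ ∀ u : TD d, FinftyNormDist D (s + m) q u ≠ ⊤ → ∀ (B : ℝ≥0∞), B ≠ ⊤ →
      (∀ x, ∑' i, ‖block D a i u x‖ₑ ≤ B) → ∀ T : TD d,
      (∀ ψ, T ψ = ∫ x, (∑' i, block D a i u x) * ψ x) → ∀ (l : ℕ) x,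
      2 ^ (s * l) * ‖LPdist D l T x‖ₑ ≤ C * ∑' k : ℕ, ((2:ℝ≥0∞) ^ (-δ)) ^ ((k:ℤ) - l).natAbs *
        lconvol (etaKernel (min k l) M') (LPpow D (s + m) q u k) x ^ (1 / q) := by
  set M := M' + d + 1 with hMdef
  have hM : (d:ℝ) < M := by
    have : (0:ℝ) ≤ d := Nat.cast_nonneg d
    linarith
  obtain ⟨L, hL⟩ := exists_nat_gt (max (M' / min 1 q) (M / q + d))
  obtain ⟨N, hN⟩ := exists_nat_ge (s + δ)
  obtain ⟨C₁, hC₁, h₁⟩ := lconvol_lconvol_rpow_inv_le (d := d) hq hM' (by linarith : M' + d < M)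
    ((le_max_left _ _).trans hL.le) ((le_max_right _ _).trans_lt hL)
  obtain ⟨C₂, hC₂, h₂⟩ := ha.exists_tsum_enorm_block_le D s hq hM N
  obtain ⟨C₃, hC₃, h₃⟩ := exists_enorm_LPS_le D L
  refine ⟨C₃ * C₂ * C₁, ENNReal.mul_ne_top (ENNReal.mul_ne_top hC₃ hC₂) hC₁,
    fun u hu B hB hblock T hT l x => ?_⟩
  set τ := (d:ℝ) / min 1 q - d with hτ
  set w : ℕ → ℝ≥0∞ := fun k => 2 ^ (-(s * k)) * (2 ^ (N * (l - k)))⁻¹ with hw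
  set G : ℕ → ℝ≥0∞ := fun k =>
    lconvol (etaKernel (min k l) M') (LPpow D (s + m) q u k) x ^ (1 / q) with hG
  have h4 : ‖LPdist D l T x‖ₑ ≤ C₃ * C₂ * ∑' k, w k *
      lconvol (etaKernel l L) (LPenv D (s + m) q M u k) x := by
    refine (ha.enorm_LPdist_le D hB hblock hT l x).trans ?_
    calc ∫⁻ y, ‖LPS D l (x - y)‖ₑ * ∑' i, ‖block D a (l - 4 + i) u y‖ₑ
        ≤ ∫⁻ y, C₃ * C₂ * ∑' k, w k *
          (etaKernel l L (x - y) * LPenv D (s + m) q M u k y) := by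
          refine lintegral_mono fun y => ?_
          refine (mul_le_mul' (h₃ l (x - y)) (h₂ u hu l y)).trans_eq ?_
          rw [mul_mul_mul_comm, ← ENNReal.tsum_mul_left]
          congr 2
          ext k
          rw [hw]
          ring
      _ = C₃ * C₂ * ∑' k, w k * lconvol (etaKernel l L) (LPenv D (s + m) q M u k) x := by
          have hmeas : ∀ k, Measurable fun y =>
              etaKernel l L (x - y) * LPenv D (s + m) q M u k y := fun k =>
            ((measurable_etaKernel l L).comp (measurable_const.sub measurable_id)).mul
              (measurable_LPenv D (s + m) q M u k)
          rw [lintegral_const_mul' _ _ (ENNReal.mul_ne_top hC₃ hC₂),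
            lintegral_tsum fun k => ((hmeas k).const_mul _).aemeasurable]
          simp_rw [lintegral_const_mul _ (hmeas _)]
          rfl
  have h5 : ∀ k, 2 ^ (s * l) * (w k * (2:ℝ≥0∞) ^ (τ * ((k - l : ℕ) : ℝ))) ≤
      ((2:ℝ≥0∞) ^ (-δ)) ^ ((k:ℤ) - l).natAbs := fun k => by
    have hwk : w k = 2 ^ (-(s * k) + -((N:ℝ) * ((l - k : ℕ) : ℝ))) := by
      rw [two_rpow_add, ENNReal.rpow_neg 2 ((N:ℝ) * _), ← Nat.cast_mul, ENNReal.rpow_natCast]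
    rw [hwk, ← two_rpow_add, ← two_rpow_add, ← ENNReal.rpow_natCast, ← ENNReal.rpow_mul]
    refine ENNReal.rpow_le_rpow_of_exponent_le one_le_two ?_
    rcases le_total k l with hkl | hkl
    · rw [Nat.sub_eq_zero_of_le hkl, show ((k:ℤ) - l).natAbs = l - k by omega,
        Nat.cast_sub hkl]
      have : (0:ℝ) ≤ l - k := sub_nonneg.2 (by exact_mod_cast hkl)
      push_cast
      nlinarith
    · rw [Nat.sub_eq_zero_of_le hkl, show ((k:ℤ) - l).natAbs = k - l by omega,
        Nat.cast_sub hkl]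
      have : (0:ℝ) ≤ k - l := sub_nonneg.2 (by exact_mod_cast hkl)
      push_cast
      nlinarith
  calc 2 ^ (s * l) * ‖LPdist D l T x‖ₑ
      ≤ 2 ^ (s * l) * (C₃ * C₂ * ∑' k, w k * (C₁ * 2 ^ (τ * ((k - l : ℕ) : ℝ)) * G k)) := by
        refine mul_le_mul_right (h4.trans (mul_le_mul_right (ENNReal.tsum_le_tsum fun k =>
          mul_le_mul_right ?_ _) _)) _
        exact h₁ k l _ (measurable_LPpow D (s + m) q u k) x
    _ = C₃ * C₂ * C₁ * ∑' k, 2 ^ (s * l) * (w k * 2 ^ (τ * ((k - l : ℕ) : ℝ))) * G k := by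
        simp_rw [← ENNReal.tsum_mul_left]
        congr 1
        ext k
        ring
    _ ≤ _ := mul_le_mul_right (ENNReal.tsum_le_tsum fun k => mul_le_mul_left (h5 k) _) _

theorem exists_FinftyNormDist_le (ha : IsSymbolS11 d m a) (D : LPData d) {s q : ℝ}
    (hq : 0 < q) (hs : (d:ℝ) / min 1 q - d < s) :
    ∃ C : ℝ≥0∞, C ≠ ⊤ ∧ ∀ u : TD d, FinftyNormDist D (s + m) q u ≠ ⊤ →
      ∃ T : TD d, ConvergesInSPrime D a u T ∧
        FinftyNormDist D s q T ≤ C * FinftyNormDist D (s + m) q u := by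
  have hτ : 0 ≤ (d:ℝ) / min 1 q - d := by
    rw [sub_nonneg, le_div_iff₀ (by positivity)]
    exact mul_le_of_le_one_right (Nat.cast_nonneg d) (min_le_left _ _)
  have hδ : 0 < s - ((d:ℝ) / min 1 q - d) := sub_pos.2 hs
  have hr : (2:ℝ≥0∞) ^ (-(s - ((d:ℝ) / min 1 q - d))) < 1 := by
    rw [ENNReal.rpow_neg, ENNReal.inv_lt_one]
    exact ENNReal.one_lt_rpow (by norm_num) hδ
  have hd0 : (0:ℝ) ≤ d := Nat.cast_nonneg d
  have hM : (d:ℝ) < d + 1 := lt_add_one _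
  obtain ⟨K, hK, hblock⟩ := ha.exists_tsum_enorm_block_le_norm D (hτ.trans_lt hs) hq
  obtain ⟨C₁, hC₁, h₁⟩ := ha.exists_enorm_LPdist_le D (s := s) hq le_rfl
    (by linarith : (d:ℝ) < (d + 1) + (d + 1))
  obtain ⟨C₂, hC₂, h₂⟩ := CubeBound.exists_lintegral_le d hq hM hr
  obtain ⟨C₃, hC₃, h₃⟩ := exists_enorm_LPS_le D (d + 1)
  have hmass : etaMass d ((d + 1 : ℕ) : ℝ) ≠ ⊤ := etaMass_ne_top (by push_cast; exact hM)
  refine ⟨C₃ * K * etaMass d ((d + 1 : ℕ) : ℝ) + C₂ ^ (1 / q) * C₁, ENNReal.add_ne_top.2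
    ⟨ENNReal.mul_ne_top (ENNReal.mul_ne_top hC₃ hK) hmass, ENNReal.mul_ne_top
      (ENNReal.rpow_ne_top_of_nonneg (by positivity) hC₂) hC₁⟩, fun u hu => ?_⟩
  set A := FinftyNormDist D (s + m) q u with hA
  have hB : K * A ≠ ⊤ := ENNReal.mul_ne_top hK hu
  have hb := hblock u hu
  obtain ⟨T, hT⟩ := exists_TD_eq_integral (B := (K * A).toReal)
    (ha.aestronglyMeasurable_tsum_block D hB hb) fun x => by
      rw [← toReal_enorm]
      exact ENNReal.toReal_mono hB (enorm_tsum_le_tsum_enorm.trans (hb x))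
  refine ⟨T, ha.convergesInSPrime D hB hb hT, ?_⟩
  rw [FinftyNormDist, add_mul]
  refine add_le_add (iSup_le fun x => ?_) (iSup_le fun μ => iSup_le fun hμ => iSup_le fun n => ?_)
  · refine (ha.enorm_LPdist_le D hB hb hT 0 x).trans ?_
    simp only [zero_tsub, zero_add]
    calc ∫⁻ y, ‖LPS D 0 (x - y)‖ₑ * ∑' i, ‖block D a i u y‖ₑ
        ≤ ∫⁻ y, C₃ * (K * A) * etaKernel 0 ((d + 1 : ℕ) : ℝ) (x - y) := by
          refine lintegral_mono fun y => ?_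
          refine (mul_le_mul' (h₃ 0 (x - y)) (hb y)).trans_eq ?_
          ring
      _ = _ := by
          rw [lintegral_const_mul' _ _ (ENNReal.mul_ne_top hC₃ hB), lintegral_etaKernel_sub]
          ring
  · have h4 := h₂ _ _ (cubeBound_LPpow D (s + m) hq u)
      (fun l x => 2 ^ (s * l) * ‖LPdist D l T x‖ₑ) C₁
      (fun l _ x => h₁ u hu _ hB hb T hT l x) μ hμ n
    have h5 : cubePiece d μ n μ s q (fun k x => LPdist D k T x) ^ q ≤ C₂ * C₁ ^ q * A ^ q := by
      rw [cubePiece_rpow D s hq]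
      refine le_trans (le_of_eq ?_) h4
      simp only [LPpow]
      simp_rw [ENNReal.mul_rpow_of_nonneg _ _ hq.le, ← ENNReal.rpow_mul]
    refine (ENNReal.le_rpow_inv_iff hq).2 h5 |>.trans_eq ?_
    rw [mul_assoc, ← ENNReal.mul_rpow_of_nonneg _ _ hq.le, ENNReal.mul_rpow_of_nonneg _ _
      (by positivity), ← ENNReal.rpow_mul, mul_inv_cancel₀ hq.ne', ENNReal.rpow_one, one_div,
      mul_assoc]

end IsSymbolS11

/-- for `s > τ_q`, `T_a` (defined by the limit of `Σ_{j,k≤N} T_{a_{j,k}} f`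
in `S'`) is bounded from `F_∞^{s+m,q}` to `F_∞^{s,q}`. -/
theorem statement1 (d : ℕ) (hd : 1 ≤ d) (m q s : ℝ) (hq : 0 < q)
    (hs : s > (d : ℝ) / min 1 q - d)
    (D : LPData d) (a : RD d → RD d → ℂ) (ha : IsSymbolS11 d m a) :
    ∃ C : ℝ≥0, ∀ u : TD d, FinftyNormDist D (s+m) q u ≠ ⊤ →
      ∃ Tf : TD d, ConvergesInSPrime D a u Tf ∧
        FinftyNormDist D s q Tf ≤ (C : ℝ≥0∞) * FinftyNormDist D (s+m) q u := by
  obtain ⟨C, hC, h⟩ := ha.exists_FinftyNormDist_le D hq hs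
  refine ⟨C.toNNReal, fun u hu => ?_⟩
  obtain ⟨T, hconv, hle⟩ := h u hu
  exact ⟨T, hconv, by rwa [ENNReal.coe_toNNReal hC]⟩

end
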